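/- Assume q and q̂ both satisfy Hypothesis (H) with parameters l and l̂ respectively, and let φ, φ̂ be the corresponding solutions of the Volterra integral equations. Let α, β ∈ ℝ ∪ {∞} with α ≠ β, and for γ ∈ ℝ ∪ {∞} write F_γ(z) := φ′(z,1) + γ φ(z,1) if γ ∈ ℝ and F_∞(z) := φ(z,1), with F̂_γ defined analogously from φ̂. If the zero set of F_α equals the zero set of F̂_α and the zero set of F_β equals the zero set of F̂_β, then l = l̂ and q = q̂ almost everywhere on (0,1). (That is, two spectra corresponding to two distinct boundary conditions at x = 1 uniquely determine q and l.) -/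

import Mathlib

open MeasureTheory Filter Set
open scoped Classical

/-- Bessel function of the first kind `J_ν(z)`, defined by its power series
(with the principal branch of `(z/2)^(ν+2k)`, branch cut along the negative real axis). -/
noncomputable def besselJ (ν : ℝ) (z : ℂ) : ℂ :=
  ∑' k : ℕ, (-1 : ℂ) ^ k * (z / 2) ^ ((ν : ℂ) + 2 * k) /
    ((k.factorial : ℂ) * Complex.Gamma ((ν : ℂ) + k + 1))

/-- Bessel function of the second kind `Y_ν(z)`: for non-integer `ν` given by the usual
formula, for integer `ν` by the limit of that formula. -/
noncomputable def besselY (ν : ℝ) (z : ℂ) : ℂ :=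
  if Real.sin (ν * Real.pi) ≠ 0 then
    (besselJ ν z * Real.cos (ν * Real.pi) - besselJ (-ν) z) / (Real.sin (ν * Real.pi) : ℂ)
  else
    limUnder (nhdsWithin ν {μ : ℝ | Real.sin (μ * Real.pi) ≠ 0})
      (fun μ : ℝ =>
        (besselJ μ z * Real.cos (μ * Real.pi) - besselJ (-μ) z) / (Real.sin (μ * Real.pi) : ℂ))

/-- `φ_l(z,x) = √(πx/2) z^{-(2l+1)/4} J_{l+1/2}(√z x)`. -/
noncomputable def phil (l : ℝ) (z : ℂ) (x : ℝ) : ℂ :=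
  (Real.sqrt (Real.pi * x / 2) : ℂ) * z ^ (-(2 * (l : ℂ) + 1) / 4) *
    besselJ (l + 1/2) (z ^ (1/2 : ℂ) * (x : ℂ))

/-- `θ_l(z,x)`, a second entire-in-`z` solution of the unperturbed equation. -/
noncomputable def thetal (l : ℝ) (z : ℂ) (x : ℝ) : ℂ :=
  if ∃ n : ℕ, l + 1/2 = (n : ℝ) then
    -(z ^ ((2 * (l : ℂ) + 1) / 4) * (Real.sqrt (Real.pi * x / 2) : ℂ) *
      (besselY (l + 1/2) (z ^ (1/2 : ℂ) * (x : ℂ)) -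
        (1 / (Real.pi : ℂ)) * Complex.log z * besselJ (l + 1/2) (z ^ (1/2 : ℂ) * (x : ℂ))))
  else
    z ^ ((2 * (l : ℂ) + 1) / 4) * (Real.sqrt (Real.pi * x / 2) : ℂ) *
      besselJ (-(l + 1/2)) (z ^ (1/2 : ℂ) * (x : ℂ)) / (Real.sin ((l + 1/2) * Real.pi) : ℂ)

/-- The Green function `G_l(z,x,y) = φ_l(z,x) θ_l(z,y) − φ_l(z,y) θ_l(z,x)`. -/
noncomputable def Greenl (l : ℝ) (z : ℂ) (x y : ℝ) : ℂ :=
  phil l z x * thetal l z y - phil l z y * thetal l z x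

/-- `q̃(x) = |q(x)|` for `l > −1/2` and `q̃(x) = (1 − log x)|q(x)|` for `l = −1/2`. -/
noncomputable def qtilde (l : ℝ) (q : ℝ → ℝ) (x : ℝ) : ℝ :=
  if l = -(1:ℝ)/2 then (1 - Real.log x) * |q x| else |q x|

/-- `φ` is (the) solution of the Volterra integral equation
`φ(z,x) = φ_l(z,x) + ∫₀ˣ G_l(z,x,y) q(y) φ(z,y) dy` on `(0,1]`. -/
def IsSol (l : ℝ) (q : ℝ → ℝ) (φ : ℂ → ℝ → ℂ) : Prop :=
  (∀ z : ℂ, ContinuousOn (φ z) (Set.Ioc 0 1)) ∧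
  ∀ z : ℂ, ∀ x ∈ Set.Ioc (0 : ℝ) 1,
    MeasureTheory.IntegrableOn (fun y => Greenl l z x y * (q y : ℂ) * φ z y) (Set.Ioo 0 x) ∧
    φ z x = phil l z x + ∫ y in Set.Ioo (0 : ℝ) x, Greenl l z x y * (q y : ℂ) * φ z y

/-- `f` solves `−f″ + (l(l+1)/x² + q)f = z f` on `(0,1)`. -/
def SolvesODE (l : ℝ) (q : ℝ → ℝ) (z : ℂ) (f : ℝ → ℂ) : Prop :=
  ∀ x ∈ Set.Ioo (0 : ℝ) 1,
    HasDerivAt f (deriv f x) x ∧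
    HasDerivAt (deriv f) ((((l * (l + 1) / x ^ 2 + q x : ℝ) : ℂ) - z) * f x) x

/-- `ψ_l^∞(z,x) = G_l(z,x,1)`. -/
noncomputable def psilInf (l : ℝ) (z : ℂ) (x : ℝ) : ℂ := Greenl l z x 1

/-- `ψ_l^β(z,x) = −β G_l(z,x,1) + (∂G_l/∂y)(z,x,1)` for `β ∈ ℝ`. -/
noncomputable def psilB (l β : ℝ) (z : ℂ) (x : ℝ) : ℂ :=
  -(β : ℂ) * Greenl l z x 1 + deriv (fun y : ℝ => Greenl l z x y) 1

/-- `ψ` is (the) solution of the integral equation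
`ψ(z,x) = ψ_l(z,x) − ∫ₓ¹ G_l(z,x,y) q(y) ψ(z,y) dy` on `(0,1]`. -/
def IsPsiSol (l : ℝ) (q : ℝ → ℝ) (ψl ψ : ℂ → ℝ → ℂ) : Prop :=
  (∀ z : ℂ, ContinuousOn (ψ z) (Set.Ioc 0 1)) ∧
  ∀ z : ℂ, ∀ x ∈ Set.Ioc (0 : ℝ) 1,
    MeasureTheory.IntegrableOn (fun y => Greenl l z x y * (q y : ℂ) * ψ z y) (Set.Ioo x 1) ∧
    ψ z x = ψl z x - ∫ y in Set.Ioo x 1, Greenl l z x y * (q y : ℂ) * ψ z y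

/-- The characteristic function of the boundary condition `f'(1) + γ f(1) = 0` (for `some γ`),
resp. the Dirichlet condition `f(1) = 0` (for `none`, i.e. `γ = ∞`). -/
noncomputable def bcFun (φ : ℂ → ℝ → ℂ) : Option ℝ → ℂ → ℂ
  | none => fun z => φ z 1
  | some γ => fun z => derivWithin (φ z) (Set.Ioc 0 1) 1 + (γ : ℂ) * φ z 1

open scoped Topology Interval ComplexConjugate BoundedContinuousFunction

/-- `f` is a primitive of the integrable function `f'` on `[a, b]`. -/
structure IsPrim (f f' : ℝ → ℂ) (a b : ℝ) : Prop where
  le : a ≤ b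
  int : IntervalIntegrable f' volume a b
  eq : ∀ x ∈ Icc a b, f x = f a + ∫ t in a..x, f' t

namespace IsPrim

variable {f g f' g' : ℝ → ℂ} {a b : ℝ}

theorem int_sub (h : IsPrim f f' a b) {x y : ℝ} (hx : x ∈ Icc a b) (hy : y ∈ Icc a b) :
    IntervalIntegrable f' volume x y := by
  refine h.int.mono_set ?_
  rw [uIcc_of_le h.le]
  exact uIcc_subset_Icc hx hy

theorem sub_eq (h : IsPrim f f' a b) {x y : ℝ} (hx : x ∈ Icc a b) (hy : y ∈ Icc a b) :
    f y - f x = ∫ t in x..y, f' t := by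
  have ha : a ∈ Icc a b := ⟨le_rfl, h.le⟩
  rw [h.eq x hx, h.eq y hy, ← intervalIntegral.integral_interval_sub_left
    (h.int_sub ha hy) (h.int_sub ha hx)]
  ring

theorem continuousOn (h : IsPrim f f' a b) : ContinuousOn f (Icc a b) := by
  have h1 := intervalIntegral.continuousOn_primitive_interval
    (f := f') (μ := volume) (a := a) (b := b) (by
      rw [← intervalIntegrable_iff']
      exact h.int)
  rw [uIcc_of_le h.le] at h1
  exact (continuousOn_const.add h1).congr h.eq

theorem mono (h : IsPrim f f' a b) {c d : ℝ} (hc : a ≤ c) (hcd : c ≤ d) (hd : d ≤ b) :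
    IsPrim f f' c d where
  le := hcd
  int := h.int_sub ⟨hc, hcd.trans hd⟩ ⟨hc.trans hcd, hd⟩
  eq x hx := by
    rw [← h.sub_eq ⟨hc, hcd.trans hd⟩ ⟨hc.trans hx.1, hx.2.trans hd⟩]
    ring

theorem congr_deriv (h : IsPrim f f' a b) (hg : ∀ x ∈ Icc a b, f' x = g' x) :
    IsPrim f g' a b where
  le := h.le
  int := h.int.congr (fun x hx => hg x (by
    rw [uIoc_of_le h.le] at hx; exact Ioc_subset_Icc_self hx))
  eq x hx := by
    rw [h.eq x hx]
    congr 1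
    refine intervalIntegral.integral_congr fun t ht => hg t ?_
    rw [uIcc_of_le hx.1] at ht
    exact ⟨ht.1, ht.2.trans hx.2⟩

theorem congr (h : IsPrim f f' a b) (hg : ∀ x ∈ Icc a b, f x = g x) : IsPrim g f' a b where
  le := h.le
  int := h.int
  eq x hx := by rw [← hg x hx, ← hg a ⟨le_rfl, h.le⟩, h.eq x hx]

theorem const (hab : a ≤ b) (c : ℂ) : IsPrim (fun _ => c) (fun _ => 0) a b :=
  ⟨hab, by simp, by simp⟩

theorem add (hf : IsPrim f f' a b) (hg : IsPrim g g' a b) :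
    IsPrim (fun x => f x + g x) (fun x => f' x + g' x) a b where
  le := hf.le
  int := hf.int.add hg.int
  eq x hx := by
    have ha : a ∈ Icc a b := ⟨le_rfl, hf.le⟩
    rw [intervalIntegral.integral_add (hf.int_sub ha hx) (hg.int_sub ha hx), hf.eq x hx,
      hg.eq x hx]
    ring

theorem const_mul (hf : IsPrim f f' a b) (c : ℂ) :
    IsPrim (fun x => c * f x) (fun x => c * f' x) a b where
  le := hf.le
  int := hf.int.const_mul c
  eq x hx := by
    rw [intervalIntegral.integral_const_mul, hf.eq x hx]
    ring

theorem neg (hf : IsPrim f f' a b) : IsPrim (fun x => -f x) (fun x => -f' x) a b := by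
  simpa using hf.const_mul (-1)

theorem sub (hf : IsPrim f f' a b) (hg : IsPrim g g' a b) :
    IsPrim (fun x => f x - g x) (fun x => f' x - g' x) a b := by
  simpa [sub_eq_add_neg] using hf.add hg.neg

theorem conjugate (hf : IsPrim f f' a b) :
    IsPrim (fun x => conj (f x)) (fun x => conj (f' x)) a b where
  le := hf.le
  int := by
    have := hf.int
    rw [intervalIntegrable_iff] at this ⊢
    exact (Complex.conjLIE.toContinuousLinearEquiv.toContinuousLinearMap.integrable_comp this)
  eq x hx := by
    have : (∫ t in a..x, conj (f' t)) = conj (∫ t in a..x, f' t) := by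
      rw [intervalIntegral.integral_of_le hx.1, intervalIntegral.integral_of_le hx.1,
        integral_conj]
    rw [this, hf.eq x hx, map_add]

theorem of_hasDerivAt (hab : a ≤ b) (hd : ∀ x ∈ Icc a b, HasDerivAt f (f' x) x)
    (hc : ContinuousOn f' (Icc a b)) : IsPrim f f' a b where
  le := hab
  int := ContinuousOn.intervalIntegrable (by rwa [uIcc_of_le hab])
  eq x hx := by
    rw [intervalIntegral.integral_eq_sub_of_hasDerivAt]
    · ring
    · intro t ht
      rw [uIcc_of_le hx.1] at ht
      exact hd t ⟨ht.1, ht.2.trans hx.2⟩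
    · refine ContinuousOn.intervalIntegrable ?_
      rw [uIcc_of_le hx.1]
      exact hc.mono (Icc_subset_Icc_right hx.2)

theorem ae_hasDerivAt (h : IsPrim f f' a b) : ∀ᵐ x, x ∈ Ioo a b → HasDerivAt f (f' x) x := by
  filter_upwards [h.int.ae_hasDerivAt_integral] with x hx hxI
  have h1 := hx (by rw [uIcc_of_le h.le]; exact Ioo_subset_Icc_self hxI) a (by simp)
  refine (h1.const_add (f a)).congr_of_eventuallyEq ?_
  filter_upwards [Ioo_mem_nhds hxI.1 hxI.2] with y hy
  exact h.eq y (Ioo_subset_Icc_self hy)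

theorem absolutelyContinuous_integral {f' : ℝ → ℂ} (hab : a ≤ b)
    (h : IntervalIntegrable f' volume a b) :
    AbsolutelyContinuousOnInterval (fun x => ∫ t in a..x, f' t) a b := by
  have hre : IntervalIntegrable (fun t => (f' t).re) volume a b :=
    ⟨h.1.re, h.2.re⟩
  have him : IntervalIntegrable (fun t => (f' t).im) volume a b :=
    ⟨h.1.im, h.2.im⟩
  have key : ∀ u : ℝ → ℝ, AbsolutelyContinuousOnInterval u a b →
      AbsolutelyContinuousOnInterval (fun x => (u x : ℂ)) a b := by
    intro u hu
    unfold AbsolutelyContinuousOnInterval at hu ⊢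
    simpa [Complex.dist_eq, ← Complex.ofReal_sub, Real.dist_eq] using hu
  have h1 := key _ (hre.absolutelyContinuousOnInterval_intervalIntegral (left_mem_uIcc))
  have h2 := key _ (him.absolutelyContinuousOnInterval_intervalIntegral (left_mem_uIcc))
  have h3 := h1.add (h2.const_smul Complex.I)
  unfold AbsolutelyContinuousOnInterval at h3 ⊢
  refine h3.congr' ?_
  have : ∀ᶠ E in AbsolutelyContinuousOnInterval.totalLengthFilter ⊓
      𝓟 (AbsolutelyContinuousOnInterval.disjWithin a b),
      E ∈ AbsolutelyContinuousOnInterval.disjWithin a b :=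
    eventually_inf_principal.mpr (by simp)
  filter_upwards [this] with E hE
  refine Finset.sum_congr rfl fun i hi => ?_
  have e : ∀ x ∈ uIcc a b, (∫ t in a..x, f' t) =
      ((∫ t in a..x, (f' t).re : ℝ) : ℂ) + Complex.I * ((∫ t in a..x, (f' t).im : ℝ) : ℂ) := by
    intro x hx
    have hi : IntervalIntegrable f' volume a x :=
      h.mono_set (uIcc_subset_uIcc_left hx)
    have hi' := hi.1
    rw [uIcc_of_le hab] at hx
    rw [intervalIntegral.integral_of_le hx.1, intervalIntegral.integral_of_le hx.1,
      intervalIntegral.integral_of_le hx.1, mul_comm]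
    exact (integral_re_add_im hi').symm
  have hE1 := hE.1 i hi
  rw [e _ hE1.1, e _ hE1.2]
  simp

theorem absolutelyContinuous (h : IsPrim f f' a b) : AbsolutelyContinuousOnInterval f a b := by
  have h1 := absolutelyContinuous_integral h.le h.int
  unfold AbsolutelyContinuousOnInterval at h1 ⊢
  refine h1.congr' ?_
  have : ∀ᶠ E in AbsolutelyContinuousOnInterval.totalLengthFilter ⊓
      𝓟 (AbsolutelyContinuousOnInterval.disjWithin a b),
      E ∈ AbsolutelyContinuousOnInterval.disjWithin a b :=
    eventually_inf_principal.mpr (by simp)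
  filter_upwards [this] with E hE
  refine Finset.sum_congr rfl fun i hi => ?_
  have hE1 := hE.1 i hi
  rw [uIcc_of_le h.le] at hE1
  rw [h.eq _ hE1.1, h.eq _ hE1.2]
  simp

theorem mul (hf : IsPrim f f' a b) (hg : IsPrim g g' a b) :
    IsPrim (fun x => f x * g x) (fun x => f' x * g x + f x * g' x) a b := by
  have hInt : IntervalIntegrable (fun x => f' x * g x + f x * g' x) volume a b := by
    refine IntervalIntegrable.add ?_ ?_
    · exact hf.int.mul_continuousOn (by rw [uIcc_of_le hf.le]; exact hg.continuousOn)
    · exact hg.int.continuousOn_mul (by rw [uIcc_of_le hf.le]; exact hf.continuousOn)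
  refine ⟨hf.le, hInt, ?_⟩
  have hac : AbsolutelyContinuousOnInterval
      ((fun x => f x • g x) - fun x => ∫ t in a..x, (f' t * g t + f t * g' t)) a b :=
    (hf.absolutelyContinuous.smul hg.absolutelyContinuous).sub
      (absolutelyContinuous_integral hf.le hInt)
  have h₁ : ∀ᵐ x : ℝ, x ≠ a := by simp [ae_iff, measure_singleton]
  have h₂ : ∀ᵐ x : ℝ, x ≠ b := by simp [ae_iff, measure_singleton]
  obtain ⟨C, hC⟩ := hac.const_of_ae_hasDerivAt_zero (by
    filter_upwards [hf.ae_hasDerivAt, hg.ae_hasDerivAt, hInt.ae_hasDerivAt_integral, h₁, h₂]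
      with x h1 h2 h3 ha hb hx
    have h3' := h3 hx a (by simp)
    rw [uIcc_of_le hf.le] at hx
    have hx' : x ∈ Ioo a b := ⟨lt_of_le_of_ne hx.1 (Ne.symm ha), lt_of_le_of_ne hx.2 hb⟩
    have := ((h1 hx').mul (h2 hx')).sub h3'
    rw [sub_self] at this
    exact this)
  rw [uIcc_of_le hf.le] at hC
  intro x hx
  have e1 := hC x hx
  have e2 := hC a ⟨le_rfl, hf.le⟩
  simp only [Pi.sub_apply, smul_eq_mul, intervalIntegral.integral_same, sub_zero] at e1 e2
  rw [e2, ← e1]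
  ring

theorem eq_of_deriv_zero (h : IsPrim f (fun _ => 0) a b) {x : ℝ} (hx : x ∈ Icc a b) :
    f x = f a := by
  simpa using h.eq x hx

theorem ae_eq_deriv (hf : IsPrim f f' a b) (hg : IsPrim f g' a b) :
    ∀ᵐ x, x ∈ Ioo a b → f' x = g' x := by
  filter_upwards [hf.ae_hasDerivAt, hg.ae_hasDerivAt] with x h1 h2 hx
  exact (h1 hx).unique (h2 hx)

/-- Reflection `x ↦ 1 - x`. -/
theorem reflect (h : IsPrim f f' a b) :
    IsPrim (fun t => f (1 - t)) (fun t => -f' (1 - t)) (1 - b) (1 - a) where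
  le := by linarith [h.le]
  int := ((h.int.symm).comp_sub_left 1).neg
  eq x hx := by
    rw [intervalIntegral.integral_neg, intervalIntegral.integral_comp_sub_left (fun t => f' t) 1,
      ← h.sub_eq (x := 1 - x) (y := 1 - (1 - b))]
    · ring
    · exact ⟨by linarith [hx.2], by linarith [hx.1]⟩
    · exact ⟨by linarith [h.le], by linarith⟩

theorem hasDerivAt (h : IsPrim f f' a b) (hc : ContinuousOn f' (Icc a b)) {x : ℝ}
    (hx : x ∈ Ioo a b) : HasDerivAt f (f' x) x := by
  have h1 : HasDerivAt (fun x => ∫ t in a..x, f' t) (f' x) x := by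
    refine intervalIntegral.integral_hasDerivAt_right
      (h.int_sub ⟨le_rfl, h.le⟩ (Ioo_subset_Icc_self hx)) ?_
      (hc.continuousAt (Icc_mem_nhds hx.1 hx.2))
    exact (hc.mono Ioo_subset_Icc_self).stronglyMeasurableAtFilter isOpen_Ioo x hx
  refine (h1.const_add (f a)).congr_of_eventuallyEq ?_
  filter_upwards [Ioo_mem_nhds hx.1 hx.2] with y hy
  exact h.eq y (Ioo_subset_Icc_self hy)

theorem hasDerivWithinAt_right (h : IsPrim f f' a b) (hab : a < b)
    (hc : ContinuousOn f' (Icc a b)) : HasDerivWithinAt f (f' b) (Iic b) b := by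
  have h1 : HasDerivWithinAt (fun x => ∫ t in a..x, f' t) (f' b) (Iic b) b := by
    refine intervalIntegral.integral_hasDerivWithinAt_right h.int
      (t := Iic b) ?_ ?_
    · exact ⟨Icc a b, Icc_mem_nhdsLE hab, hc.aestronglyMeasurable measurableSet_Icc⟩
    · exact (hc b ⟨hab.le, le_rfl⟩).mono_of_mem_nhdsWithin (Icc_mem_nhdsLE hab)
  refine (h1.const_add (f a)).congr_of_eventuallyEq ?_ (h.eq b ⟨hab.le, le_rfl⟩)
  filter_upwards [Icc_mem_nhdsLE hab] with y hy
  exact h.eq y hy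

end IsPrim

/-- `(u, v)` solves the first order system `u' = v`, `v' = (Q - z) u` on `[a, b]`, in the
integrated sense. -/
structure SLSol (Q : ℝ → ℝ) (z : ℂ) (u v : ℝ → ℂ) (a b : ℝ) : Prop where
  fst : IsPrim u v a b
  snd : IsPrim v (fun x => ((Q x : ℂ) - z) * u x) a b

namespace SLSol

variable {Q : ℝ → ℝ} {z : ℂ} {u v u₁ v₁ : ℝ → ℂ} {a b : ℝ}

theorem mono (h : SLSol Q z u v a b) {c d : ℝ} (hc : a ≤ c) (hcd : c ≤ d) (hd : d ≤ b) :
    SLSol Q z u v c d :=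
  ⟨h.fst.mono hc hcd hd, h.snd.mono hc hcd hd⟩

theorem const_mul (h : SLSol Q z u v a b) (c : ℂ) :
    SLSol Q z (fun x => c * u x) (fun x => c * v x) a b :=
  ⟨h.fst.const_mul c, (h.snd.const_mul c).congr_deriv fun x _ => by ring⟩

theorem reflect (h : SLSol Q z u v a b) :
    SLSol (fun t => Q (1 - t)) z (fun t => u (1 - t)) (fun t => -v (1 - t)) (1 - b) (1 - a) := by
  refine ⟨h.fst.reflect, (h.snd.reflect.neg).congr_deriv fun x _ => by ring⟩

theorem wronskian_eq (h : SLSol Q z u v a b) (h₁ : SLSol Q z u₁ v₁ a b) {x : ℝ}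
    (hx : x ∈ Icc a b) : u x * v₁ x - v x * u₁ x = u a * v₁ a - v a * u₁ a := by
  have := (((h.fst.mul h₁.snd).sub (h.snd.mul h₁.fst))).congr_deriv
    (g' := fun _ => 0) (fun x _ => by ring)
  exact this.eq_of_deriv_zero hx

theorem energy_eq (h : SLSol Q z u v a b) {x y : ℝ} (hx : x ∈ Icc a b) (hy : y ∈ Icc a b) :
    (v y * conj (u y)).im - (v x * conj (u x)).im = -(z.im * ∫ t in x..y, ‖u t‖ ^ 2) := by
  have h1 := ((h.snd.mul h.fst.conjugate).sub (h.snd.conjugate.mul h.fst)).congr_deriv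
    (g' := fun t => ((‖u t‖ ^ 2 : ℝ) : ℂ) * (conj z - z)) (fun t _ => by
      simp only [map_mul, map_sub, Complex.conj_ofReal]
      rw [← Complex.normSq_eq_norm_sq, Complex.normSq_eq_conj_mul_self]
      ring)
  have h2 := h1.sub_eq hx hy
  rw [intervalIntegral.integral_mul_const, intervalIntegral.integral_ofReal] at h2
  have h3 := congrArg Complex.im h2
  simp at h3
  simp
  linarith

/-- A solution is determined by its data at the left end and a fundamental system. -/
theorem eq_combination {c c' s s' : ℝ → ℂ} (h : SLSol Q z u v a b)
    (hc : SLSol Q z c c' a b) (hs : SLSol Q z s s' a b)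
    (hca : c a = 1) (hca' : c' a = 0) (hsa : s a = 0) (hsa' : s' a = 1) {x : ℝ}
    (hx : x ∈ Icc a b) : u x = u a * c x + v a * s x ∧ v x = u a * c' x + v a * s' x := by
  have e1 := h.wronskian_eq hs hx
  have e2 := h.wronskian_eq hc hx
  have e3 := hc.wronskian_eq hs hx
  rw [hsa, hsa'] at e1
  rw [hca, hca'] at e2
  rw [hca, hca', hsa, hsa'] at e3
  constructor
  · linear_combination c x * e1 - s x * e2 - u x * e3
  · linear_combination c' x * e1 - s' x * e2 - v x * e3

theorem weyl_bound {T : ℝ} {s s' : ℝ → ℂ} (hT : 0 ≤ T) (hu : SLSol Q z u v 0 T)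
    (hs : SLSol Q z s s' 0 T)
    (hu0 : u 0 = 1) (hs0 : s 0 = 0) (hs0' : s' 0 = 1)
    (hsign : 0 ≤ z.im * (v T * conj (u T)).im) :
    ‖u T‖ * |(s' T * conj (s T)).im| ≤ ‖s T‖ := by
  have hw := hu.wronskian_eq hs (x := T) ⟨hT, le_rfl⟩
  rw [hu0, hs0, hs0'] at hw
  have hen := hs.energy_eq (x := 0) (y := T) ⟨le_rfl, hT⟩ ⟨hT, le_rfl⟩
  rw [hs0, hs0'] at hen
  simp only [map_zero, mul_zero, Complex.zero_im, sub_zero] at hen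
  have hpos : 0 ≤ ∫ t in (0:ℝ)..T, ‖s t‖ ^ 2 :=
    intervalIntegral.integral_nonneg hT fun _ _ => by positivity
  set S := s' T * conj (s T) with hS
  set V := v T * conj (u T) with hV
  have key : (‖u T‖ ^ 2 : ℝ) * S.im - (‖s T‖ ^ 2 : ℝ) * V.im = -(u T * s T).im := by
    have : ((‖u T‖ ^ 2 : ℝ) : ℂ) * S - ((‖s T‖ ^ 2 : ℝ) : ℂ) * V = conj (u T * s T) := by
      rw [← Complex.normSq_eq_norm_sq, Complex.normSq_eq_conj_mul_self,
        ← Complex.normSq_eq_norm_sq, Complex.normSq_eq_conj_mul_self, hS, hV, map_mul]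
      linear_combination (conj (u T) * conj (s T)) * hw
    have h3 := congrArg Complex.im this
    rw [Complex.sub_im, Complex.im_ofReal_mul, Complex.im_ofReal_mul, Complex.conj_im] at h3
    exact h3
  have habs : ‖u T‖ ^ 2 * |S.im| ≤ ‖u T‖ * ‖s T‖ := by
    have h1 : |(u T * s T).im| ≤ ‖u T‖ * ‖s T‖ := by
      rw [← norm_mul]; exact Complex.abs_im_le_norm _
    have h2 : ‖u T‖ ^ 2 * |S.im| ≤ |(u T * s T).im| := by
      rcases lt_trichotomy z.im 0 with hz | hz | hz
      · have hV0 : V.im ≤ 0 := by nlinarith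
        have hS0 : 0 ≤ S.im := by rw [hen]; nlinarith
        rw [abs_of_nonneg hS0]
        have := neg_le_abs (u T * s T).im
        nlinarith [mul_nonneg (sq_nonneg ‖s T‖) (neg_nonneg.2 hV0)]
      · have : S.im = 0 := by rw [hen, hz]; simp
        rw [this]; simp
      · have hV0 : 0 ≤ V.im := by nlinarith
        have hS0 : S.im ≤ 0 := by rw [hen]; nlinarith
        rw [abs_of_nonpos hS0]
        have := le_abs_self (u T * s T).im
        nlinarith [mul_nonneg (sq_nonneg ‖s T‖) hV0]
    exact h2.trans h1
  rcases eq_or_lt_of_le (norm_nonneg (u T)) with h0 | h0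
  · rw [← h0]; simp
  · refine le_of_mul_le_mul_left ?_ h0
    calc ‖u T‖ * (‖u T‖ * |S.im|) = ‖u T‖ ^ 2 * |S.im| := by ring
      _ ≤ _ := habs

/-- Exponential asymptotics of solutions, with the initial amplitude
`A = (‖v 0 + κ u 0‖ + ‖v 0 - κ u 0‖) / (2‖κ‖)`. -/
theorem exp_estimate {κ : ℂ} {T A N : ℝ} (hT : 0 ≤ T) (hu : SLSol Q z u v 0 T)
    (hQ : IntervalIntegrable Q volume 0 T) (hκ : κ ^ 2 = -z) (hre : 0 ≤ κ.re)
    (hN : ∫ t in (0:ℝ)..T, |Q t| = N) (hκN : 2 * N ≤ ‖κ‖) (hκ0 : 0 < ‖κ‖)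
    (hA : (‖v 0 + κ * u 0‖ + ‖v 0 - κ * u 0‖) / (2 * ‖κ‖) ≤ A) :
    ‖Complex.exp (-κ * T) * (v T + κ * u T) - (v 0 + κ * u 0)‖ ≤ 2 * A * N ∧
    ‖Complex.exp (-κ * T) * (v T - κ * u T)‖ ≤
      Real.exp (-2 * κ.re * T) * ‖v 0 - κ * u 0‖ + 2 * A * N := by
  have hexp : ∀ c : ℂ, IsPrim (fun t : ℝ => Complex.exp (c * t))
      (fun t => c * Complex.exp (c * t)) 0 T := by
    intro c
    refine IsPrim.of_hasDerivAt hT (fun x _ => ?_) (by fun_prop)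
    have := ((Complex.ofRealCLM.hasDerivAt (x := x)).const_mul c).cexp
    simpa [mul_comm] using this
  have hP := ((hexp (-κ)).mul (hu.snd.add (hu.fst.const_mul κ))).congr_deriv
    (g' := fun t => (Q t : ℂ) * (Complex.exp (-κ * t) * u t)) (fun t _ => by
      linear_combination (-Complex.exp (-κ * t) * u t) * hκ)
  have hR := ((hexp κ).mul (hu.snd.sub (hu.fst.const_mul κ))).congr_deriv
    (g' := fun t => (Q t : ℂ) * (Complex.exp (κ * t) * u t)) (fun t _ => by
      linear_combination (-Complex.exp (κ * t) * u t) * hκ)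
  have hcont : ContinuousOn (fun t : ℝ => Complex.exp (-κ * t) * u t) (Icc 0 T) :=
    (by fun_prop : Continuous fun t : ℝ => Complex.exp (-κ * t)).continuousOn.mul
      hu.fst.continuousOn
  obtain ⟨t₀, ht₀, hmax⟩ := isCompact_Icc.exists_isMaxOn (nonempty_Icc.2 hT) hcont.norm
  set B := ‖Complex.exp (-κ * t₀) * u t₀‖ with hB
  have hBnn : 0 ≤ B := norm_nonneg _
  have hUB : ∀ t ∈ Icc (0:ℝ) T, ‖Complex.exp (-κ * t) * u t‖ ≤ B := fun t ht => hmax ht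
  have hQabs : IntervalIntegrable (fun t => |Q t|) volume 0 T := hQ.abs
  have hQt : ∀ t ∈ Icc (0:ℝ) T, ∫ τ in (0:ℝ)..t, |Q τ| ≤ N := by
    intro t ht
    rw [← hN]
    exact intervalIntegral.integral_mono_interval le_rfl ht.1 ht.2
      (Eventually.of_forall fun _ => abs_nonneg _) hQabs
  have hsub : ∀ t ∈ Icc (0:ℝ) T, IntervalIntegrable (fun t => |Q t|) volume 0 t := by
    intro t ht
    refine hQabs.mono_set ?_
    rw [uIcc_of_le ht.1, uIcc_of_le hT]
    exact Icc_subset_Icc_right ht.2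
  have key : ∀ f : ℝ → ℂ, ∀ t ∈ Icc (0:ℝ) T, (∀ τ ∈ Icc (0:ℝ) t, ‖f τ‖ ≤ B) →
      ‖∫ τ in (0:ℝ)..t, (Q τ : ℂ) * f τ‖ ≤ N * B := by
    intro f t ht hf
    have h1 : ‖∫ τ in (0:ℝ)..t, (Q τ : ℂ) * f τ‖ ≤ ∫ τ in (0:ℝ)..t, |Q τ| * B := by
      refine intervalIntegral.norm_integral_le_of_norm_le ht.1
        (Eventually.of_forall fun τ hτ => ?_) ((hsub t ht).mul_const B)
      rw [norm_mul, Complex.norm_real, Real.norm_eq_abs]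
      exact mul_le_mul_of_nonneg_left (hf τ (Ioc_subset_Icc_self hτ)) (abs_nonneg _)
    rw [intervalIntegral.integral_mul_const] at h1
    exact h1.trans (mul_le_mul_of_nonneg_right (hQt t ht) hBnn)
  have hPb : ∀ t ∈ Icc (0:ℝ) T,
      ‖Complex.exp (-κ * t) * (v t + κ * u t) - (v 0 + κ * u 0)‖ ≤ N * B := by
    intro t ht
    have h1 := hP.sub_eq (x := 0) (y := t) ⟨le_rfl, hT⟩ ht
    simp only [Complex.ofReal_zero, mul_zero, Complex.exp_zero, one_mul] at h1
    rw [h1]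
    exact key _ t ht fun τ hτ => hUB τ ⟨hτ.1, hτ.2.trans ht.2⟩
  have hRb : ∀ t ∈ Icc (0:ℝ) T,
      ‖Complex.exp (-κ * t) * (v t - κ * u t)‖ ≤
        Real.exp (-2 * κ.re * t) * ‖v 0 - κ * u 0‖ + N * B := by
    intro t ht
    have h1 := hR.sub_eq (x := 0) (y := t) ⟨le_rfl, hT⟩ ht
    simp only [Complex.ofReal_zero, mul_zero, Complex.exp_zero, one_mul] at h1
    have h2 : Complex.exp (-κ * t) * (v t - κ * u t) =
        Complex.exp (-2 * κ * t) * (v 0 - κ * u 0) +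
        ∫ τ in (0:ℝ)..t, (Q τ : ℂ) * (Complex.exp (-2 * κ * t) * (Complex.exp (κ * τ) * u τ)) := by
      have e : ∀ τ, (Q τ : ℂ) * (Complex.exp (-2 * κ * t) * (Complex.exp (κ * τ) * u τ)) =
        Complex.exp (-2 * κ * t) * ((Q τ : ℂ) * (Complex.exp (κ * τ) * u τ)) := fun τ => by ring
      simp_rw [e]
      rw [intervalIntegral.integral_const_mul, ← h1]
      have : Complex.exp (-κ * t) = Complex.exp (-2 * κ * t) * Complex.exp (κ * t) := by
        rw [← Complex.exp_add]; ring_nf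
      rw [this]; ring
    rw [h2]
    refine (norm_add_le _ _).trans (add_le_add ?_ ?_)
    · rw [norm_mul, Complex.norm_exp]
      simp
    · refine key _ t ht fun τ hτ => ?_
      have : Complex.exp (-2 * κ * t) * (Complex.exp (κ * τ) * u τ) =
          Complex.exp (-2 * κ * (t - τ)) * (Complex.exp (-κ * τ) * u τ) := by
        rw [← mul_assoc, ← mul_assoc, ← Complex.exp_add, ← Complex.exp_add]; ring_nf
      rw [this, norm_mul]
      have h3 : ‖Complex.exp (-2 * κ * (t - τ))‖ ≤ 1 := by
        rw [Complex.norm_exp, ← Complex.ofReal_sub]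
        simp only [Complex.mul_re, Complex.neg_re, Complex.ofReal_re, Complex.ofReal_im, mul_zero,
          sub_zero, Complex.re_ofNat, Complex.neg_im, Complex.im_ofNat, neg_zero, zero_mul]
        rw [Real.exp_le_one_iff]
        nlinarith [hτ.2]
      calc _ ≤ 1 * B := mul_le_mul h3 (hUB τ ⟨hτ.1, hτ.2.trans ht.2⟩) (norm_nonneg _) zero_le_one
        _ = B := one_mul B
  have hBA : B ≤ 2 * A := by
    have h1 := hPb t₀ ht₀
    have h2 := hRb t₀ ht₀
    have e : 2 * κ * (Complex.exp (-κ * t₀) * u t₀) =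
        (Complex.exp (-κ * t₀) * (v t₀ + κ * u t₀) - (v 0 + κ * u 0)) + (v 0 + κ * u 0)
          - Complex.exp (-κ * t₀) * (v t₀ - κ * u t₀) := by ring
    have h3 : 2 * ‖κ‖ * B ≤ N * B + ‖v 0 + κ * u 0‖ + (‖v 0 - κ * u 0‖ + N * B) := by
      have : ‖2 * κ * (Complex.exp (-κ * t₀) * u t₀)‖ = 2 * ‖κ‖ * B := by
        rw [norm_mul, norm_mul, hB]; simp
      rw [← this, e]
      have h4 : Real.exp (-2 * κ.re * t₀) ≤ 1 := by
        rw [Real.exp_le_one_iff]; nlinarith [ht₀.1]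
      have h5 : Real.exp (-2 * κ.re * t₀) * ‖v 0 - κ * u 0‖ ≤ ‖v 0 - κ * u 0‖ :=
        mul_le_of_le_one_left (norm_nonneg _) h4
      refine (norm_sub_le _ _).trans (add_le_add ((norm_add_le _ _).trans ?_) (h2.trans ?_))
      · gcongr
      · gcongr
    rw [div_le_iff₀ (by positivity)] at hA
    have h6 : 2 * N * B ≤ ‖κ‖ * B := mul_le_mul_of_nonneg_right hκN hBnn
    have h7 : ‖κ‖ * B ≤ ‖κ‖ * (2 * A) := by nlinarith
    exact le_of_mul_le_mul_left h7 hκ0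
  have hNnn : 0 ≤ N := hN ▸ intervalIntegral.integral_nonneg hT fun _ _ => abs_nonneg _
  have hNB : N * B ≤ 2 * A * N := by nlinarith
  exact ⟨(hPb T ⟨hT, le_rfl⟩).trans hNB,
    (hRb T ⟨hT, le_rfl⟩).trans (by gcongr)⟩

end SLSol

/-- `z → ∞` inside the double sector `‖z‖ ≤ 2 |Im z|`. -/
noncomputable def sectorFilter : Filter ℂ := comap norm atTop ⊓ 𝓟 {z | ‖z‖ ≤ 2 * |z.im|}

theorem sectorFilter_mem : ∀ᶠ z in sectorFilter, ‖z‖ ≤ 2 * |z.im| :=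
  eventually_inf_principal.2 (Eventually.of_forall fun _ h => h)

theorem tendsto_norm_sectorFilter : Tendsto norm sectorFilter atTop :=
  tendsto_comap.mono_left inf_le_left

theorem sectorFilter_im_ne_zero : ∀ᶠ z in sectorFilter, z.im ≠ 0 := by
  filter_upwards [sectorFilter_mem, tendsto_norm_sectorFilter.eventually_gt_atTop 0] with z h1 h2 h3
  rw [h3] at h1
  simp at h1
  rw [h1] at h2
  simp at h2

theorem tendsto_sectorFilter_of_ray (w : ℂ) (hw : w ≠ 0) (h : ‖w‖ ≤ 2 * |w.im|) :
    Tendsto (fun x : ℝ => (x : ℂ) * w) atTop sectorFilter := by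
  refine tendsto_inf.2 ⟨tendsto_comap_iff.2 ?_, tendsto_principal.2 ?_⟩
  · have : Tendsto (fun x : ℝ => |x| * ‖w‖) atTop atTop :=
      (tendsto_abs_atTop_atTop).atTop_mul_const (norm_pos_iff.2 hw)
    refine this.congr fun x => ?_
    simp
  · filter_upwards with x
    simp only [norm_mul, Complex.norm_real, Real.norm_eq_abs, Complex.im_ofReal_mul,
      abs_mul]
    nlinarith [abs_nonneg x]

instance : NeBot sectorFilter :=
  (tendsto_sectorFilter_of_ray Complex.I Complex.I_ne_zero (by simp)).neBot

theorem exists_sq_eq_neg (z : ℂ) : ∃ κ : ℂ, κ ^ 2 = -z ∧ 0 ≤ κ.re := by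
  obtain ⟨w, h⟩ := IsAlgClosed.exists_pow_nat_eq (-z) (n := 2) (by norm_num)
  rcases le_total 0 w.re with h1 | h1
  · exact ⟨w, h, h1⟩
  · exact ⟨-w, by rw [neg_sq]; exact h, by simpa using h1⟩

/-- A square root of `-z` with non-negative real part. -/
noncomputable def negSqrt (z : ℂ) : ℂ := (exists_sq_eq_neg z).choose

theorem negSqrt_sq (z : ℂ) : negSqrt z ^ 2 = -z := (exists_sq_eq_neg z).choose_spec.1

theorem negSqrt_re (z : ℂ) : 0 ≤ (negSqrt z).re := (exists_sq_eq_neg z).choose_spec.2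

theorem norm_negSqrt_sq (z : ℂ) : ‖negSqrt z‖ ^ 2 = ‖z‖ := by
  rw [← norm_pow, negSqrt_sq, norm_neg]

theorem tendsto_norm_negSqrt : Tendsto (fun z => ‖negSqrt z‖) sectorFilter atTop := by
  have : ∀ z, ‖negSqrt z‖ = Real.sqrt ‖z‖ := fun z => by
    rw [← norm_negSqrt_sq z, Real.sqrt_sq (norm_nonneg _)]
  simp_rw [this]
  exact Real.tendsto_sqrt_atTop.comp tendsto_norm_sectorFilter

theorem negSqrt_re_im_bound : ∀ᶠ z in sectorFilter,
    ‖negSqrt z‖ ≤ 4 * (negSqrt z).re ∧ ‖negSqrt z‖ ≤ 4 * |(negSqrt z).im| := by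
  filter_upwards [sectorFilter_mem, tendsto_norm_negSqrt.eventually_gt_atTop 0] with z h1 h2
  set κ := negSqrt z with hκ
  have h3 : z.im = -(2 * κ.re * κ.im) := by
    have := congrArg Complex.im (negSqrt_sq z)
    rw [← hκ, sq, Complex.mul_im, Complex.neg_im] at this
    linarith
  have h4 : |z.im| = 2 * κ.re * |κ.im| := by
    rw [h3, abs_neg, abs_mul, abs_mul, abs_of_nonneg (show 0 ≤ κ.re from negSqrt_re z)]; simp
  have h5 := Complex.abs_im_le_norm κ
  have h6 := Complex.re_le_norm κ
  have h7 := norm_negSqrt_sq z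
  rw [← hκ] at h7
  have h8 : 0 ≤ κ.re := negSqrt_re z
  rw [← h7, h4] at h1
  constructor
  · refine le_of_mul_le_mul_right ?_ h2
    nlinarith [mul_le_mul_of_nonneg_left h5 h8]
  · refine le_of_mul_le_mul_right ?_ h2
    nlinarith [mul_le_mul_of_nonneg_right h6 (abs_nonneg κ.im)]

theorem tendsto_negSqrt_re : Tendsto (fun z => (negSqrt z).re) sectorFilter atTop := by
  refine tendsto_atTop_mono' _ ?_ (tendsto_norm_negSqrt.atTop_div_const (r := 4) (by norm_num))
  filter_upwards [negSqrt_re_im_bound] with z h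
  linarith [h.1]

theorem tendsto_exp_negSqrt {T : ℝ} (hT : 0 < T) :
    Tendsto (fun z => Real.exp (-2 * (negSqrt z).re * T)) sectorFilter (𝓝 0) := by
  refine Real.tendsto_exp_atBot.comp ?_
  have : Tendsto (fun z => (negSqrt z).re * (2 * T)) sectorFilter atTop :=
    tendsto_negSqrt_re.atTop_mul_const (by positivity)
  refine (tendsto_neg_atTop_atBot.comp this).congr fun z => ?_
  simp; ring

theorem tendsto_const_div_norm_negSqrt (C : ℝ) :
    Tendsto (fun z => C / ‖negSqrt z‖) sectorFilter (𝓝 0) :=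
  tendsto_norm_negSqrt.const_div_atTop C

theorem tendsto_negSqrt_mul_exp {T : ℝ} (hT : 0 < T) :
    Tendsto (fun z => negSqrt z * Complex.exp (-negSqrt z * T) ^ 2) sectorFilter (𝓝 0) := by
  rw [tendsto_zero_iff_norm_tendsto_zero]
  have h1 : Tendsto (fun x : ℝ => 4 * (x * Real.exp (-(2 * T) * x))) atTop (𝓝 0) := by
    have := (Real.tendsto_pow_mul_exp_neg_atTop_nhds_zero 1).comp
      (tendsto_id.const_mul_atTop (r := 2 * T) (by positivity : (0:ℝ) < 2 * T))
    have := this.const_mul (4 / (2 * T))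
    rw [mul_zero] at this
    refine this.congr fun x => ?_
    simp only [Function.comp, id, pow_one]
    field_simp
  refine squeeze_zero' (Eventually.of_forall fun _ => norm_nonneg _) ?_ (h1.comp tendsto_negSqrt_re)
  filter_upwards [negSqrt_re_im_bound] with z h
  rw [norm_mul, norm_pow, Complex.norm_exp]
  simp only [Function.comp]
  have : Real.exp (-negSqrt z * T : ℂ).re ^ 2 = Real.exp (-(2 * T) * (negSqrt z).re) := by
    rw [← Real.exp_nat_mul]
    congr 1
    simp; ring
  rw [this, ← mul_assoc]
  exact mul_le_mul_of_nonneg_right h.1 (Real.exp_nonneg _)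

namespace SLSol

variable {Q : ℝ → ℝ} {T : ℝ} {u v : ℂ → ℝ → ℂ}

theorem tendsto_sine (hT : 0 < T) (hQ : IntervalIntegrable Q volume 0 T)
    (h : ∀ z, SLSol Q z (u z) (v z) 0 T) (hu0 : ∀ z, u z 0 = 0) (hv0 : ∀ z, v z 0 = 1) :
    Tendsto (fun z => 2 * negSqrt z * Complex.exp (-negSqrt z * T) * u z T) sectorFilter (𝓝 1) ∧
    Tendsto (fun z => 2 * Complex.exp (-negSqrt z * T) * v z T) sectorFilter (𝓝 1) := by
  set N := ∫ t in (0:ℝ)..T, |Q t|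
  have hev : ∀ᶠ z in sectorFilter,
      ‖Complex.exp (-negSqrt z * T) * (v z T + negSqrt z * u z T) - 1‖ ≤ (2 * N) / ‖negSqrt z‖ ∧
      ‖Complex.exp (-negSqrt z * T) * (v z T - negSqrt z * u z T)‖ ≤
        Real.exp (-2 * (negSqrt z).re * T) + (2 * N) / ‖negSqrt z‖ := by
    filter_upwards [tendsto_norm_negSqrt.eventually_gt_atTop 0,
      tendsto_norm_negSqrt.eventually_ge_atTop (2 * N)] with z h1 h2
    have := (h z).exp_estimate (κ := negSqrt z) (A := 1 / ‖negSqrt z‖) hT.le hQ (negSqrt_sq z)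
      (negSqrt_re z) rfl h2 h1 (by rw [hu0, hv0]; simp; field_simp; norm_num)
    rw [hu0, hv0] at this
    simp only [mul_zero, add_zero, sub_zero, norm_one, mul_one] at this
    have e : 2 * (1 / ‖negSqrt z‖) * N = (2 * N) / ‖negSqrt z‖ := by ring
    rwa [e] at this
  have hlim := tendsto_const_div_norm_negSqrt (2 * N)
  have hlim2 : Tendsto (fun z => Real.exp (-2 * (negSqrt z).re * T) + (2 * N) / ‖negSqrt z‖)
      sectorFilter (𝓝 0) := by simpa using (tendsto_exp_negSqrt hT).add hlim
  have hp : Tendsto (fun z => Complex.exp (-negSqrt z * T) * (v z T + negSqrt z * u z T))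
      sectorFilter (𝓝 1) := by
    rw [tendsto_iff_norm_sub_tendsto_zero]
    exact squeeze_zero' (Eventually.of_forall fun _ => norm_nonneg _) (hev.mono fun z h => h.1) hlim
  have hm : Tendsto (fun z => Complex.exp (-negSqrt z * T) * (v z T - negSqrt z * u z T))
      sectorFilter (𝓝 0) := by
    rw [tendsto_zero_iff_norm_tendsto_zero]
    exact squeeze_zero' (Eventually.of_forall fun _ => norm_nonneg _) (hev.mono fun z h => h.2)
      hlim2
  constructor
  · have := hp.sub hm
    rw [sub_zero] at this
    exact this.congr fun z => by ring
  · have := hp.add hm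
    rw [add_zero] at this
    exact this.congr fun z => by ring

theorem tendsto_cosine (hT : 0 < T) (hQ : IntervalIntegrable Q volume 0 T)
    (h : ∀ z, SLSol Q z (u z) (v z) 0 T) (hu0 : ∀ z, u z 0 = 1) (hv0 : ∀ z, v z 0 = 0) :
    Tendsto (fun z => 2 * Complex.exp (-negSqrt z * T) * u z T) sectorFilter (𝓝 1) := by
  set N := ∫ t in (0:ℝ)..T, |Q t|
  rw [tendsto_iff_norm_sub_tendsto_zero]
  have hlim2 : Tendsto (fun z => Real.exp (-2 * (negSqrt z).re * T) + (4 * N) / ‖negSqrt z‖)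
      sectorFilter (𝓝 0) := by
    simpa using (tendsto_exp_negSqrt hT).add (tendsto_const_div_norm_negSqrt (4 * N))
  refine squeeze_zero' (Eventually.of_forall fun _ => norm_nonneg _) ?_ hlim2
  filter_upwards [tendsto_norm_negSqrt.eventually_gt_atTop 0,
    tendsto_norm_negSqrt.eventually_ge_atTop (2 * N)] with z h1 h2
  have := (h z).exp_estimate (κ := negSqrt z) (A := 1) hT.le hQ (negSqrt_sq z)
    (negSqrt_re z) rfl h2 h1 (by rw [hu0, hv0]; simp; field_simp; norm_num)
  rw [hu0, hv0] at this
  simp only [mul_one, zero_add, zero_sub, norm_neg] at this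
  obtain ⟨ha, hb⟩ := this
  set κ := negSqrt z
  have hκ : κ ≠ 0 := norm_pos_iff.1 h1
  have e : 2 * Complex.exp (-κ * T) * u z T - 1 =
      ((Complex.exp (-κ * T) * (v z T + κ * u z T) - κ) -
        Complex.exp (-κ * T) * (v z T - κ * u z T)) / κ := by
    field_simp; ring
  rw [e, norm_div, div_le_iff₀ h1, add_mul, div_mul_cancel₀ _ h1.ne']
  refine (norm_sub_le _ _).trans ?_
  change _ ≤ 2 * N at ha
  change _ ≤ _ + 2 * N at hb
  linarith

end SLSol

/-- Decay of Weyl solutions times growing solutions in the sector. -/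
theorem tendsto_weyl_mul {T : ℝ} {U S S' Sh : ℂ → ℂ}
    (hU : ∀ᶠ z in sectorFilter, ‖U z‖ * |(S' z * conj (S z)).im| ≤ ‖S z‖)
    (hS : Tendsto (fun z => 2 * negSqrt z * Complex.exp (-negSqrt z * T) * S z) sectorFilter (𝓝 1))
    (hS' : Tendsto (fun z => 2 * Complex.exp (-negSqrt z * T) * S' z) sectorFilter (𝓝 1))
    (hSh : Tendsto (fun z => 2 * negSqrt z * Complex.exp (-negSqrt z * T) * Sh z)
      sectorFilter (𝓝 1)) :
    Tendsto (fun z => U z * Sh z) sectorFilter (𝓝 0) := by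
  rw [tendsto_zero_iff_norm_tendsto_zero]
  refine squeeze_zero' (Eventually.of_forall fun _ => norm_nonneg _) ?_
    (tendsto_const_div_norm_negSqrt 32)
  have hprod : Tendsto (fun z => (2 * Complex.exp (-negSqrt z * T) * S' z) *
      conj (2 * negSqrt z * Complex.exp (-negSqrt z * T) * S z)) sectorFilter (𝓝 (1 * conj 1)) :=
    hS'.mul ((Complex.continuous_conj.tendsto _).comp hS)
  rw [map_one, one_mul] at hprod
  have hb1 := (hS.norm.eventually_lt_const (u := 2) (by norm_num))
  have hb2 := (hSh.norm.eventually_lt_const (u := 2) (by norm_num))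
  have hb3 : ∀ᶠ z in sectorFilter, ‖(2 * Complex.exp (-negSqrt z * T) * S' z) *
      conj (2 * negSqrt z * Complex.exp (-negSqrt z * T) * S z) - 1‖ < 1 / 8 :=
    (tendsto_iff_norm_sub_tendsto_zero.1 hprod).eventually_lt_const (by norm_num)
  filter_upwards [hU, hb1, hb2, hb3, negSqrt_re_im_bound,
    tendsto_norm_negSqrt.eventually_gt_atTop 0] with z h0 h1 h2 h3 h4 h5
  set κ := negSqrt z
  set E := Complex.exp (-κ * T) with hE
  have hκ : κ ≠ 0 := norm_pos_iff.1 h5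
  have hE0 : 0 < ‖E‖ := norm_pos_iff.2 (Complex.exp_ne_zero _)
  set X := (2 * E * S' z) * conj (2 * κ * E * S z) with hX
  have e1 : ((4 * ‖E‖ ^ 2 * ‖κ‖ ^ 2 : ℝ) : ℂ) * (S' z * conj (S z)) = κ * X := by
    rw [hX]
    simp only [map_mul, Complex.ofReal_mul, Complex.ofReal_pow]
    rw [← Complex.mul_conj', ← Complex.mul_conj']
    have h2 : conj (2 : ℂ) = 2 := Complex.conj_ofNat 2
    rw [h2, Complex.ofReal_ofNat]
    ring
  have e2 := congrArg Complex.im e1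
  rw [Complex.im_ofReal_mul] at e2
  have h6 : ‖κ‖ / 8 ≤ |(κ * X).im| := by
    have : κ * X = κ + κ * (X - 1) := by ring
    rw [this, Complex.add_im]
    have h7 : |(κ * (X - 1)).im| ≤ ‖κ‖ * (1 / 8) := by
      refine (Complex.abs_im_le_norm _).trans ?_
      rw [norm_mul]
      gcongr
    have h8 := abs_sub_abs_le_abs_add κ.im (κ * (X - 1)).im
    linarith [h4.2]
  rw [← e2, abs_mul, abs_of_pos (by positivity)] at h6
  rw [norm_mul, le_div_iff₀ h5]
  simp only [norm_mul, Complex.norm_ofNat] at h1 h2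
  set I := |(S' z * conj (S z)).im|
  have hI : 0 ≤ I := abs_nonneg _
  have h9 : ‖S z‖ * ‖Sh z‖ * (4 * ‖E‖ ^ 2 * ‖κ‖ ^ 2) ≤ 4 := by
    calc _ = (2 * ‖κ‖ * ‖E‖ * ‖S z‖) * (2 * ‖κ‖ * ‖E‖ * ‖Sh z‖) := by ring
      _ ≤ 2 * 2 := by gcongr
      _ = 4 := by norm_num
  have hp : 0 < 4 * ‖E‖ ^ 2 * ‖κ‖ ^ 2 := by positivity
  have h10 : ‖U z‖ * ‖Sh z‖ * (4 * ‖E‖ ^ 2 * ‖κ‖ ^ 2 * I) ≤ 4 := by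
    calc _ = (‖U z‖ * I) * ‖Sh z‖ * (4 * ‖E‖ ^ 2 * ‖κ‖ ^ 2) := by ring
      _ ≤ ‖S z‖ * ‖Sh z‖ * (4 * ‖E‖ ^ 2 * ‖κ‖ ^ 2) := by gcongr
      _ ≤ 4 := h9
  have h11 : ‖U z‖ * ‖Sh z‖ * (‖κ‖ / 8) ≤ ‖U z‖ * ‖Sh z‖ * (4 * ‖E‖ ^ 2 * ‖κ‖ ^ 2 * I) := by
    gcongr
  linarith

/-- Asymptotics of the Weyl function. -/
theorem tendsto_weyl_function {T : ℝ} (hT : 0 < T) {U C S S' m : ℂ → ℂ}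
    (hU : ∀ᶠ z in sectorFilter, ‖U z‖ * |(S' z * conj (S z)).im| ≤ ‖S z‖)
    (hm : ∀ᶠ z in sectorFilter, U z = C z + m z * S z)
    (hC : Tendsto (fun z => 2 * Complex.exp (-negSqrt z * T) * C z) sectorFilter (𝓝 1))
    (hS : Tendsto (fun z => 2 * negSqrt z * Complex.exp (-negSqrt z * T) * S z) sectorFilter (𝓝 1))
    (hS' : Tendsto (fun z => 2 * Complex.exp (-negSqrt z * T) * S' z) sectorFilter (𝓝 1)) :
    Tendsto (fun z => m z / negSqrt z) sectorFilter (𝓝 (-1)) := by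
  have h1 := tendsto_weyl_mul hU hS hS' hS
  have h2 : Tendsto (fun z => (U z * S z) * (4 * (negSqrt z * Complex.exp (-negSqrt z * T) ^ 2)) /
      (2 * negSqrt z * Complex.exp (-negSqrt z * T) * S z) ^ 2 -
      (2 * Complex.exp (-negSqrt z * T) * C z) /
        (2 * negSqrt z * Complex.exp (-negSqrt z * T) * S z)) sectorFilter
      (𝓝 (0 * (4 * 0) / 1 ^ 2 - 1 / 1)) :=
    ((h1.mul ((tendsto_negSqrt_mul_exp hT).const_mul 4)).div (hS.pow 2) (by norm_num)).sub
      (hC.div hS (by norm_num))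
  have e : (0 * (4 * 0) / 1 ^ 2 - 1 / 1 : ℂ) = -1 := by norm_num
  rw [e] at h2
  refine h2.congr' ?_
  filter_upwards [hm, tendsto_norm_negSqrt.eventually_gt_atTop 0,
    hS.eventually_ne (one_ne_zero)] with z h3 h4 h5
  have hκ : negSqrt z ≠ 0 := norm_pos_iff.1 h4
  have hE : Complex.exp (-negSqrt z * T) ≠ 0 := Complex.exp_ne_zero _
  have hSz : S z ≠ 0 := fun h => h5 (by rw [h]; ring)
  have hmz : m z = (U z - C z) / S z := by rw [h3]; field_simp; ring
  rw [hmz]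
  field_simp
  try ring

/-- Phragmén–Lindelöf and Liouville in the sector setting. -/
theorem eq_const_of_bounded_sector {f : ℂ → ℂ} (hf : Differentiable ℂ f) {B : ℝ}
    (hB : ∀ z, ‖f z‖ ≤ Real.exp (B * (1 + ‖z‖))) {C : ℝ}
    (hC : ∀ᶠ z in sectorFilter, ‖f z‖ ≤ C) : ∃ c, ∀ z, f z = c := by
  obtain ⟨R, hR⟩ : ∃ R : ℝ, ∀ z : ℂ, R ≤ ‖z‖ → ‖z‖ ≤ 2 * |z.im| → ‖f z‖ ≤ C := by
    rw [sectorFilter, eventually_inf_principal, eventually_comap] at hC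
    obtain ⟨R, hR⟩ := eventually_atTop.1 hC
    exact ⟨R, fun z h1 h2 => hR ‖z‖ h1 z rfl h2⟩
  obtain ⟨C₁, hC₁⟩ := (isCompact_closedBall (0:ℂ) R).exists_bound_of_continuousOn
    hf.continuous.continuousOn
  have hD : ∀ z : ℂ, ‖z‖ ≤ 2 * |z.im| → ‖f z‖ ≤ max C C₁ := by
    intro z hz
    rcases le_total R ‖z‖ with h | h
    · exact (hR z h hz).trans (le_max_left _ _)
    · exact (hC₁ z (by simpa using h)).trans (le_max_right _ _)
  set g : ℂ → ℂ := fun w => f ((1 + Complex.I) * w) with hg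
  have hgd : Differentiable ℂ g := hf.comp (by fun_prop)
  have hn : ‖(1 + Complex.I : ℂ)‖ ≤ 2 := by
    refine (norm_add_le _ _).trans ?_
    simp; norm_num
  have hI : ‖(1 + Complex.I : ℂ)‖ ^ 2 = 2 := by
    rw [← Complex.normSq_eq_norm_sq, Complex.normSq_apply]; simp; norm_num
  have hgB : ∀ s : Set ℂ, ∃ c < (2 : ℝ), ∃ B', g =O[Bornology.cobounded ℂ ⊓ 𝓟 s]
      fun z => Real.exp (B' * ‖z‖ ^ c) := by
    intro s
    refine ⟨1, by norm_num, |B| * 2, ?_⟩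
    refine Asymptotics.IsBigO.of_bound (Real.exp |B|) (Eventually.of_forall fun z => ?_)
    rw [Real.norm_of_nonneg (Real.exp_nonneg _), ← Real.exp_add, Real.rpow_one]
    refine (hB _).trans (Real.exp_le_exp.2 ?_)
    rw [norm_mul]
    have h1 : ‖(1 + Complex.I : ℂ)‖ * ‖z‖ ≤ 2 * ‖z‖ := by gcongr
    calc B * (1 + ‖(1 + Complex.I : ℂ)‖ * ‖z‖)
        ≤ |B| * (1 + ‖(1 + Complex.I : ℂ)‖ * ‖z‖) := by gcongr; exact le_abs_self B
      _ ≤ |B| * (1 + 2 * ‖z‖) := by gcongr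
      _ = _ := by ring
  have hre : ∀ x : ℝ, ‖g x‖ ≤ max C C₁ := by
    intro x
    refine hD _ ?_
    rw [norm_mul, Complex.norm_real, Complex.im_mul_ofReal, abs_mul, Real.norm_eq_abs]
    simp
    nlinarith [abs_nonneg x]
  have him : ∀ x : ℝ, ‖g (x * Complex.I)‖ ≤ max C C₁ := by
    intro x
    refine hD _ ?_
    have : (1 + Complex.I) * (x * Complex.I) = x * (Complex.I - 1) := by
      linear_combination (x : ℂ) * Complex.I_sq
    rw [this, norm_mul, Complex.norm_real, Complex.im_ofReal_mul, abs_mul, Real.norm_eq_abs]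
    have h2 : ‖(Complex.I - 1 : ℂ)‖ ≤ 2 := by
      refine (norm_sub_le _ _).trans ?_
      simp; norm_num
    simp
    nlinarith [abs_nonneg x]
  have hgb : ∀ w, ‖g w‖ ≤ max C C₁ := by
    intro w
    rcases le_total 0 w.re with h1 | h1 <;> rcases le_total 0 w.im with h2 | h2
    · exact PhragmenLindelof.quadrant_I hgd.diffContOnCl (hgB _) (fun x _ => hre x)
        (fun x _ => him x) h1 h2
    · exact PhragmenLindelof.quadrant_IV hgd.diffContOnCl (hgB _) (fun x _ => hre x)
        (fun x _ => him x) h1 h2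
    · exact PhragmenLindelof.quadrant_II hgd.diffContOnCl (hgB _) (fun x _ => hre x)
        (fun x _ => him x) h1 h2
    · exact PhragmenLindelof.quadrant_III hgd.diffContOnCl (hgB _) (fun x _ => hre x)
        (fun x _ => him x) h1 h2
  have hI0 : (1 + Complex.I : ℂ) ≠ 0 := by
    intro h; rw [h] at hI; simp at hI
  refine ⟨f 0, fun z => hf.apply_eq_apply_of_bounded ?_ z 0⟩
  refine isBounded_iff_forall_norm_le.2 ⟨max C C₁, ?_⟩
  rintro _ ⟨z, rfl⟩
  have := hgb (z / (1 + Complex.I))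
  simp only [hg] at this
  rwa [mul_div_cancel₀ _ hI0] at this

theorem integral_mul_primitive_pow {b : ℝ → ℝ} {X : ℝ} (hX : 0 ≤ X)
    (hb : IntervalIntegrable b volume 0 X) (n : ℕ) :
    ∫ y in (0:ℝ)..X, b y * (∫ t in (0:ℝ)..y, b t) ^ n =
      (∫ t in (0:ℝ)..X, b t) ^ (n + 1) / (n + 1) := by
  have h1 : IsPrim (fun x => ((∫ t in (0:ℝ)..x, b t : ℝ) : ℂ)) (fun x => (b x : ℂ)) 0 X :=
    ⟨hX, ⟨hb.1.ofReal, hb.2.ofReal⟩, fun x _ => by simp [intervalIntegral.integral_ofReal]⟩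
  have h2 : ∀ n : ℕ, IsPrim (fun x => ((∫ t in (0:ℝ)..x, b t : ℝ) : ℂ) ^ (n + 1))
      (fun x => (n + 1) * ((b x : ℂ) * ((∫ t in (0:ℝ)..x, b t : ℝ) : ℂ) ^ n)) 0 X := by
    intro n
    induction n with
    | zero => simpa using h1
    | succ n ih =>
      refine ((ih.mul h1).congr_deriv fun x _ => ?_).congr fun x _ => ?_
      · push_cast; ring
      · ring
  have h3 := (h2 n).eq X ⟨hX, le_rfl⟩
  rw [intervalIntegral.integral_const_mul] at h3
  simp only [intervalIntegral.integral_same, Complex.ofReal_zero, ne_eq, Nat.add_eq_zero_iff,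
    one_ne_zero, and_false, not_false_eq_true, zero_pow, zero_add] at h3
  have h4 : ((∫ y in (0:ℝ)..X, b y * (∫ t in (0:ℝ)..y, b t) ^ n : ℝ) : ℂ) =
      ∫ y in (0:ℝ)..X, (b y : ℂ) * ((∫ t in (0:ℝ)..y, b t : ℝ) : ℂ) ^ n := by
    rw [← intervalIntegral.integral_ofReal]
    push_cast
    rfl
  rw [eq_div_iff (by positivity), ← Complex.ofReal_inj]
  push_cast
  rw [h4, h3]
  ring

/-- A dominated Volterra kernel on the half line. -/
structure VolterraKernel (K : ℝ → ℝ → ℂ) (b : ℝ → ℝ) : Prop where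
  meas : ∀ x, AEStronglyMeasurable (K x) volume
  cont : ∀ y, Continuous fun x => K x y
  bound : ∀ x y, ‖K x y‖ ≤ b y
  zero : ∀ x y, x ≤ y → K x y = 0
  int : Integrable b
  bzero : ∀ y ≤ 0, b y = 0

namespace VolterraKernel

variable {K : ℝ → ℝ → ℂ} {b : ℝ → ℝ}

theorem nonneg (h : VolterraKernel K b) (y : ℝ) : 0 ≤ b y := (norm_nonneg _).trans (h.bound 0 y)

theorem norm_mul_le (h : VolterraKernel K b) (f : ℝ →ᵇ ℂ) (x y : ℝ) :
    ‖K x y * f y‖ ≤ b y * ‖f‖ := by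
  rw [norm_mul]
  exact mul_le_mul (h.bound x y) (f.norm_coe_le_norm y) (norm_nonneg _) (h.nonneg y)

theorem integrable (h : VolterraKernel K b) (f : ℝ →ᵇ ℂ) (x : ℝ) :
    Integrable fun y => K x y * f y :=
  (h.int.mul_const ‖f‖).mono' ((h.meas x).mul f.continuous.aestronglyMeasurable)
    (Eventually.of_forall (h.norm_mul_le f x))

/-- The Volterra operator on bounded continuous functions. -/
noncomputable def op (h : VolterraKernel K b) : (ℝ →ᵇ ℂ) →L[ℂ] (ℝ →ᵇ ℂ) :=
  LinearMap.mkContinuous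
    { toFun := fun f => BoundedContinuousFunction.ofNormedAddCommGroup
        (fun x => ∫ y, K x y * f y)
        (continuous_of_dominated (fun x => (h.integrable f x).aestronglyMeasurable)
          (fun x => Eventually.of_forall (h.norm_mul_le f x)) (h.int.mul_const ‖f‖)
          (Eventually.of_forall fun y => (h.cont y).mul continuous_const))
        (∫ y, b y * ‖f‖) (fun x => norm_integral_le_of_norm_le (h.int.mul_const ‖f‖)
          (Eventually.of_forall (h.norm_mul_le f x)))
      map_add' := fun f g => by
        ext x
        simp only [BoundedContinuousFunction.coe_ofNormedAddCommGroup,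
          BoundedContinuousFunction.coe_add, Pi.add_apply, mul_add]
        exact integral_add (h.integrable f x) (h.integrable g x)
      map_smul' := fun c f => by
        ext x
        simp only [BoundedContinuousFunction.coe_ofNormedAddCommGroup, smul_eq_mul,
          BoundedContinuousFunction.coe_smul, RingHom.id_apply, mul_left_comm _ c]
        exact integral_const_mul _ _ } (∫ y, b y) (fun f => by
    rw [BoundedContinuousFunction.norm_le (mul_nonneg (integral_nonneg h.nonneg) (norm_nonneg _)),
      ← integral_mul_const]
    exact fun x => norm_integral_le_of_norm_le (h.int.mul_const ‖f‖)
      (Eventually.of_forall (h.norm_mul_le f x)))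

theorem op_apply (h : VolterraKernel K b) (f : ℝ →ᵇ ℂ) (x : ℝ) :
    h.op f x = ∫ y, K x y * f y := rfl

theorem primitive_nonneg (h : VolterraKernel K b) (x : ℝ) : 0 ≤ ∫ t in (0:ℝ)..x, b t := by
  rcases le_total 0 x with hx | hx
  · exact intervalIntegral.integral_nonneg hx fun y _ => h.nonneg y
  · rw [intervalIntegral.integral_congr (g := fun _ => (0:ℝ))]
    · simp
    · intro y hy
      rw [uIcc_of_ge hx] at hy
      exact h.bzero y hy.2

theorem primitive_le (h : VolterraKernel K b) (x : ℝ) : ∫ t in (0:ℝ)..x, b t ≤ ∫ t, b t := by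
  rcases le_total 0 x with hx | hx
  · rw [intervalIntegral.integral_of_le hx]
    exact setIntegral_le_integral h.int (Eventually.of_forall h.nonneg)
  · refine le_trans ?_ (integral_nonneg h.nonneg)
    rw [intervalIntegral.integral_symm]
    exact neg_nonpos.2 (intervalIntegral.integral_nonneg hx fun y _ => h.nonneg y)

theorem op_apply_of_nonpos (h : VolterraKernel K b) (f : ℝ →ᵇ ℂ) {x : ℝ} (hx : x ≤ 0) :
    h.op f x = 0 := by
  rw [op_apply]
  refine integral_eq_zero_of_ae (Eventually.of_forall fun y => ?_)
  rcases le_total x y with hy | hy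
  · simp [h.zero x y hy]
  · have := h.bound x y
    rw [h.bzero y (hy.trans hx)] at this
    simp [norm_le_zero_iff.1 this]

theorem op_apply_eq (h : VolterraKernel K b) (f : ℝ →ᵇ ℂ) {x : ℝ} (hx : 0 ≤ x) :
    h.op f x = ∫ y in (0:ℝ)..x, K x y * f y := by
  rw [op_apply, intervalIntegral.integral_of_le hx, setIntegral_eq_integral_of_forall_compl_eq_zero]
  intro y hy
  rw [mem_Ioc, not_and_or, not_lt, not_le] at hy
  rcases hy with hy | hy
  · have := h.bound x y
    rw [h.bzero y hy] at this
    simp [norm_le_zero_iff.1 this]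
  · simp [h.zero x y hy.le]

theorem norm_op_le (h : VolterraKernel K b) (f : ℝ →ᵇ ℂ) {x : ℝ} (hx : 0 ≤ x) {F : ℝ → ℝ}
    (hF : ∀ y ∈ Icc 0 x, ‖f y‖ ≤ F y) (hFi : IntervalIntegrable (fun y => b y * F y) volume 0 x) :
    ‖h.op f x‖ ≤ ∫ y in (0:ℝ)..x, b y * F y := by
  rw [h.op_apply_eq f hx]
  refine intervalIntegral.norm_integral_le_of_norm_le hx ?_ hFi
  refine Eventually.of_forall fun y hy => ?_
  rw [norm_mul]
  exact mul_le_mul (h.bound x y) (hF y (Ioc_subset_Icc_self hy)) (norm_nonneg _) (h.nonneg y)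

theorem norm_op_pow_apply_le (h : VolterraKernel K b) (f : ℝ →ᵇ ℂ) (n : ℕ) (x : ℝ) :
    ‖(h.op ^ n) f x‖ ≤ ‖f‖ * ((∫ t in (0:ℝ)..x, b t) ^ n / n.factorial) := by
  induction n generalizing x with
  | zero => simpa using f.norm_coe_le_norm x
  | succ n ih =>
    rw [pow_succ', mul_apply_eq_comp]
    rcases le_total x 0 with hx | hx
    · rw [h.op_apply_of_nonpos _ hx, norm_zero]
      have := h.primitive_nonneg x
      positivity
    · refine (h.norm_op_le _ hx (fun y _ => ih y) ?_).trans ?_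
      · refine h.int.intervalIntegrable.mul_continuousOn ?_
        refine Continuous.continuousOn ?_
        have := intervalIntegral.continuous_primitive
          (fun a c => h.int.intervalIntegrable (a := a) (b := c)) 0
        fun_prop
      · have : ∀ y, b y * (‖f‖ * ((∫ t in (0:ℝ)..y, b t) ^ n / n.factorial)) =
            (‖f‖ / n.factorial) * (b y * (∫ t in (0:ℝ)..y, b t) ^ n) := fun y => by ring
        simp_rw [this]
        rw [intervalIntegral.integral_const_mul,
          integral_mul_primitive_pow hx h.int.intervalIntegrable, Nat.factorial_succ]
        push_cast
        apply le_of_eq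
        field_simp

theorem norm_op_pow_le (h : VolterraKernel K b) (n : ℕ) :
    ‖h.op ^ n‖ ≤ (∫ t, b t) ^ n / n.factorial := by
  have h0 : 0 ≤ ∫ t, b t := integral_nonneg h.nonneg
  refine ContinuousLinearMap.opNorm_le_bound _ (by positivity) fun f => ?_
  rw [BoundedContinuousFunction.norm_le (by positivity)]
  intro x
  refine (h.norm_op_pow_apply_le f n x).trans ?_
  rw [mul_comm]
  have := h.primitive_nonneg x
  have := h.primitive_le x
  gcongr

theorem summable_op_pow (h : VolterraKernel K b) : Summable fun n : ℕ => ‖h.op ^ n‖ :=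
  Summable.of_nonneg_of_le (fun _ => norm_nonneg _) h.norm_op_pow_le
    (Real.summable_pow_div_factorial _)

theorem isUnit_one_sub_op (h : VolterraKernel K b) : IsUnit (1 - h.op) := by
  have hs := h.summable_op_pow.of_norm
  exact ⟨⟨1 - h.op, ∑' n : ℕ, h.op ^ n, hs.one_sub_mul_tsum_pow, hs.tsum_pow_mul_one_sub⟩, rfl⟩

/-- The solution of `g = f + op g`. -/
noncomputable def sol (h : VolterraKernel K b) (f : ℝ →ᵇ ℂ) : ℝ →ᵇ ℂ :=
  Ring.inverse (1 - h.op) f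

theorem sol_eq (h : VolterraKernel K b) (f : ℝ →ᵇ ℂ) : h.sol f = f + h.op (h.sol f) := by
  have h1 := Ring.mul_inverse_cancel _ h.isUnit_one_sub_op
  have h2 := congrArg (fun A : (ℝ →ᵇ ℂ) →L[ℂ] (ℝ →ᵇ ℂ) => A f) h1
  simp only [mul_apply_eq_comp, sub_apply,
    one_apply_eq_self] at h2
  exact sub_eq_iff_eq_add.1 h2

theorem norm_sol_apply_le (h : VolterraKernel K b) (f : ℝ →ᵇ ℂ) (x : ℝ) :
    ‖h.sol f x‖ ≤ ‖f‖ * Real.exp (∫ t in (0:ℝ)..x, b t) := by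
  have hs := h.summable_op_pow.of_norm
  have h1 : Ring.inverse (1 - h.op) = ∑' n : ℕ, h.op ^ n := by
    have := hs.one_sub_mul_tsum_pow
    rw [← Ring.inverse_mul_cancel_left _ (∑' n : ℕ, h.op ^ n) h.isUnit_one_sub_op, this, mul_one]
  have h2 : HasSum (fun n : ℕ => (h.op ^ n) f x) (h.sol f x) := by
    rw [sol, h1]
    have := (hs.hasSum.mapL (ContinuousLinearMap.apply ℂ (ℝ →ᵇ ℂ) f))
    exact this.mapL (BoundedContinuousFunction.evalCLM ℂ x)
  have h3 : HasSum (fun n : ℕ => ‖f‖ * ((∫ t in (0:ℝ)..x, b t) ^ n / n.factorial))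
      (‖f‖ * Real.exp (∫ t in (0:ℝ)..x, b t)) := by
    have := NormedSpace.expSeries_div_hasSum_exp (∫ t in (0:ℝ)..x, b t)
    rw [← Real.exp_eq_exp_ℝ] at this
    exact this.mul_left ‖f‖
  exact h2.norm_le_of_bounded h3 fun n => h.norm_op_pow_apply_le f n x

end VolterraKernel

/-- The primitive of `s ↦ s ^ (-m)` vanishing at `1`. -/
noncomputable def wS (m x : ℝ) : ℝ := ∫ s in (1:ℝ)..x, s ^ (-m)

theorem continuousOn_rpow_neg (m : ℝ) : ContinuousOn (fun s : ℝ => s ^ (-m)) (Ioi 0) :=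
  fun s hs => (Real.continuousAt_rpow_const s _ (Or.inl (ne_of_gt hs))).continuousWithinAt

theorem hasDerivAt_wS {m x : ℝ} (hx : 0 < x) : HasDerivAt (wS m) (x ^ (-m)) x := by
  refine intervalIntegral.integral_hasDerivAt_right ?_ ?_ ?_
  · refine ((continuousOn_rpow_neg m).mono fun s hs => ?_).intervalIntegrable
    exact lt_of_lt_of_le (lt_min one_pos hx) hs.1
  · exact (continuousOn_rpow_neg m).stronglyMeasurableAtFilter isOpen_Ioi x hx
  · exact (continuousOn_rpow_neg m).continuousAt (Ioi_mem_nhds hx)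

theorem wS_one (m : ℝ) : wS m 1 = 0 := by simp [wS]

theorem wS_zero (x : ℝ) : wS 0 x = x - 1 := by simp [wS]

theorem continuousOn_wS (m : ℝ) : ContinuousOn (wS m) (Ioi 0) :=
  fun _ hx => (hasDerivAt_wS hx).continuousAt.continuousWithinAt

theorem wS_sub_eq {m x y : ℝ} (hx : 0 < x) (hy : 0 < y) :
    wS m y - wS m x = ∫ s in x..y, s ^ (-m) := by
  have hi : ∀ u v : ℝ, 0 < u → 0 < v → IntervalIntegrable (fun s : ℝ => s ^ (-m)) volume u v := by
    intro u v hu hv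
    refine ((continuousOn_rpow_neg m).mono fun s hs => ?_).intervalIntegrable
    exact lt_of_lt_of_le (lt_min hu hv) hs.1
  exact intervalIntegral.integral_interval_sub_left (hi _ _ one_pos hy) (hi _ _ one_pos hx)

theorem wS_mono {m x y : ℝ} (hx : 0 < x) (hxy : x ≤ y) : wS m x ≤ wS m y := by
  rw [← sub_nonneg, wS_sub_eq hx (hx.trans_le hxy)]
  exact intervalIntegral.integral_nonneg hxy fun s hs =>
    Real.rpow_nonneg (hx.le.trans hs.1) _

theorem wS_nonpos {m x : ℝ} (hx : 0 < x) (hx1 : x ≤ 1) : wS m x ≤ 0 := by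
  rw [← wS_one m]; exact wS_mono hx hx1

theorem rpow_mul_one_sub_wS_le {m x : ℝ} (hm : 0 ≤ m) (hx : 0 < x) (hx1 : x ≤ 1) :
    x ^ m * (1 - wS m x) ≤ 2 := by
  have h1 : 0 - wS m x ≤ ∫ s in x..1, x ^ (-m) := by
    rw [← wS_one m, wS_sub_eq hx one_pos]
    refine intervalIntegral.integral_mono_on hx1 ?_ (by simp) fun s hs => ?_
    · refine ((continuousOn_rpow_neg m).mono fun s hs => ?_).intervalIntegrable
      exact lt_of_lt_of_le (lt_min hx one_pos) hs.1
    · exact Real.rpow_le_rpow_of_nonpos hx hs.1 (by linarith)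
  rw [intervalIntegral.integral_const, smul_eq_mul] at h1
  have h2 : x ^ m * x ^ (-m) = 1 := by rw [← Real.rpow_add hx]; simp
  have h3 : x ^ m ≤ 1 := Real.rpow_le_one hx.le hx1 hm
  have h4 : 0 ≤ x ^ m := Real.rpow_nonneg hx.le _
  have h5 := mul_le_mul_of_nonneg_left h1 h4
  nlinarith

/-- The kernel `y^m (S(x) - S(y)) r(y)` on `0 < y < x ≤ 1`. -/
noncomputable def wker (m : ℝ) (r : ℝ → ℂ) (x y : ℝ) : ℂ :=
  (Ioo (0:ℝ) 1).indicator
    (fun y => ((y ^ m * (wS m (max y (min x 1)) - wS m y) : ℝ) : ℂ) * r y) y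

/-- The dominating function of `wker`. -/
noncomputable def wbound (m : ℝ) (r : ℝ → ℂ) (y : ℝ) : ℝ :=
  (Ioo (0:ℝ) 1).indicator (fun y => y ^ m * (1 - wS m y) * ‖r y‖) y

theorem continuousOn_rpow_pos (m : ℝ) : ContinuousOn (fun s : ℝ => s ^ m) (Ioi 0) :=
  fun s hs => (Real.continuousAt_rpow_const s _ (Or.inl (ne_of_gt hs))).continuousWithinAt

theorem volterraKernel_wker {m : ℝ} {r : ℝ → ℂ} (hr : Measurable r)
    (hi : IntegrableOn (fun y => y ^ m * (1 - wS m y) * ‖r y‖) (Ioo 0 1)) :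
    VolterraKernel (wker m r) (wbound m r) where
  meas x := by
    refine (aestronglyMeasurable_indicator_iff measurableSet_Ioo).2 ?_
    refine AEStronglyMeasurable.mul ?_ hr.aestronglyMeasurable
    refine ContinuousOn.aestronglyMeasurable ?_ measurableSet_Ioo
    refine Complex.continuous_ofReal.comp_continuousOn ?_
    refine ((continuousOn_rpow_pos m).mono fun y hy => hy.1).mul (ContinuousOn.sub ?_
      ((continuousOn_wS m).mono fun y hy => hy.1))
    refine (continuousOn_wS m).comp (t := Ioi 0) (by fun_prop) fun y hy => ?_
    exact lt_of_lt_of_le hy.1 (le_max_left _ _)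
  cont y := by
    unfold wker
    by_cases hy : y ∈ Ioo (0:ℝ) 1
    · simp only [indicator_of_mem hy]
      have : Continuous fun x => wS m (max y (min x 1)) := by
        refine (continuousOn_wS m).comp_continuous (by fun_prop) fun x => ?_
        exact lt_of_lt_of_le hy.1 (le_max_left _ _)
      fun_prop
    · simp only [indicator_of_notMem hy]
      exact continuous_const
  bound x y := by
    unfold wker wbound
    by_cases hy : y ∈ Ioo (0:ℝ) 1
    · simp only [indicator_of_mem hy]
      rw [norm_mul, Complex.norm_real, Real.norm_eq_abs]
      have h1 : wS m y ≤ wS m (max y (min x 1)) := wS_mono hy.1 (le_max_left _ _)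
      have h2 : wS m (max y (min x 1)) ≤ 0 := wS_nonpos (hy.1.trans_le (le_max_left _ _))
        (max_le hy.2.le (min_le_right _ _))
      have h3 : 0 ≤ y ^ m := Real.rpow_nonneg hy.1.le _
      rw [abs_of_nonneg (mul_nonneg h3 (sub_nonneg.2 h1))]
      gcongr
      linarith
    · simp only [indicator_of_notMem hy, norm_zero, le_refl]
  zero x y hxy := by
    unfold wker
    by_cases hy : y ∈ Ioo (0:ℝ) 1
    · simp only [indicator_of_mem hy]
      rw [max_eq_left ((min_le_left _ _).trans hxy)]
      simp
    · simp only [indicator_of_notMem hy]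
  int := (integrable_indicator_iff measurableSet_Ioo).2 hi
  bzero y hy := indicator_of_notMem (fun h => absurd h.1 (not_lt.2 hy)) _

theorem differentiableAt_inverse_one_sub {E : Type*} [NormedAddCommGroup E] [NormedSpace ℂ E]
    [CompleteSpace E] (A B : E →L[ℂ] E) (g : E) {z : ℂ} (h : IsUnit (1 - (A - z • B))) :
    DifferentiableAt ℂ (fun z : ℂ => Ring.inverse (1 - (A - z • B)) g) z := by
  have h1 : DifferentiableAt ℂ (fun z : ℂ => 1 - (A - z • B)) z := by fun_prop
  have h2 := DifferentiableAt.comp (g := Ring.inverse) z (differentiableAt_inverse (𝕜 := ℂ) h) h1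
  exact (ContinuousLinearMap.apply ℂ E g).differentiableAt.comp z h2

/-- Potentials integrable against the weight `y^m (1 - S(y))`. -/
structure WPot (m : ℝ) (p : ℝ → ℝ) : Prop where
  hm : 0 ≤ m
  meas : Measurable p
  int : IntegrableOn (fun y => y ^ m * (1 - wS m y) * |p y|) (Ioo 0 1)

namespace WPot

variable {m : ℝ} {p : ℝ → ℝ}

theorem weight_nonneg {m y : ℝ} (hy : y ∈ Ioo (0:ℝ) 1) : 0 ≤ y ^ m * (1 - wS m y) :=
  mul_nonneg (Real.rpow_nonneg hy.1.le _) (by linarith [wS_nonpos (m := m) hy.1 hy.2.le])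

theorem continuousOn_weight (m : ℝ) : ContinuousOn (fun y => y ^ m * (1 - wS m y)) (Ioo 0 1) :=
  ((continuousOn_rpow_pos m).mono fun _ hy => hy.1).mul (continuousOn_const.sub
    ((continuousOn_wS m).mono fun _ hy => hy.1))

theorem int_one (hm : 0 ≤ m) : IntegrableOn (fun y => y ^ m * (1 - wS m y)) (Ioo 0 1) := by
  refine Integrable.of_bound (C := 2)
    ((continuousOn_weight m).aestronglyMeasurable measurableSet_Ioo) ?_
  filter_upwards [ae_restrict_mem measurableSet_Ioo] with y hy
  rw [Real.norm_of_nonneg (weight_nonneg hy)]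
  exact rpow_mul_one_sub_wS_le hm hy.1 hy.2.le

theorem int_sub (h : WPot m p) (z : ℂ) :
    IntegrableOn (fun y => y ^ m * (1 - wS m y) * ‖(p y : ℂ) - z‖) (Ioo 0 1) := by
  refine Integrable.mono' (h.int.add ((int_one h.hm).mul_const ‖z‖)) ?_ ?_
  · refine ((continuousOn_weight m).aestronglyMeasurable measurableSet_Ioo).mul ?_
    exact ((Complex.measurable_ofReal.comp h.meas).sub_const z).norm.aestronglyMeasurable
  · filter_upwards [ae_restrict_mem measurableSet_Ioo] with y hy
    rw [Real.norm_of_nonneg (mul_nonneg (weight_nonneg hy) (norm_nonneg _))]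
    simp only [Pi.add_apply]
    rw [← mul_add]
    refine mul_le_mul_of_nonneg_left ?_ (weight_nonneg hy)
    refine (norm_sub_le _ _).trans ?_
    simp

theorem ker (h : WPot m p) (z : ℂ) :
    VolterraKernel (wker m fun y => (p y : ℂ) - z) (wbound m fun y => (p y : ℂ) - z) :=
  volterraKernel_wker ((Complex.measurable_ofReal.comp h.meas).sub_const z) (h.int_sub z)

theorem kerOne (hm : 0 ≤ m) : VolterraKernel (wker m fun _ => 1) (wbound m fun _ => 1) :=
  volterraKernel_wker measurable_const (by simpa using int_one hm)

theorem op_ker (h : WPot m p) (z : ℂ) :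
    (h.ker z).op = (h.ker 0).op - z • (kerOne h.hm).op := by
  ext f x
  simp only [sub_apply, smul_apply, BoundedContinuousFunction.coe_sub, Pi.sub_apply,
    BoundedContinuousFunction.coe_smul, smul_eq_mul, VolterraKernel.op_apply]
  rw [← integral_const_mul, ← integral_sub ((h.ker 0).integrable f x)
    (((kerOne h.hm).integrable f x).const_mul z)]
  refine integral_congr_ae (Eventually.of_forall fun y => ?_)
  simp only [wker]
  by_cases hy : y ∈ Ioo (0:ℝ) 1
  · simp only [indicator_of_mem hy]
    ring
  · simp only [indicator_of_notMem hy]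
    ring

/-- The solution of the weighted Volterra equation with spectral parameter `z`. -/
noncomputable def sol (h : WPot m p) (g₀ : ℝ →ᵇ ℂ) (z : ℂ) : ℝ →ᵇ ℂ := (h.ker z).sol g₀

theorem differentiable_sol (h : WPot m p) (g₀ : ℝ →ᵇ ℂ) : Differentiable ℂ (h.sol g₀) := by
  intro z
  have h1 : h.sol g₀ = fun z =>
      (Ring.inverse (1 - ((h.ker 0).op - z • (kerOne h.hm).op)) :
        (ℝ →ᵇ ℂ) →L[ℂ] (ℝ →ᵇ ℂ)) g₀ := by
    funext z
    rw [← h.op_ker]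
    rfl
  have h2 : IsUnit (1 - ((h.ker 0).op - z • (kerOne h.hm).op)) := by
    rw [← h.op_ker]
    exact (h.ker z).isUnit_one_sub_op
  rw [h1]
  exact differentiableAt_inverse_one_sub _ _ _ h2

/-- The quasi-derivative of the solution. -/
noncomputable def quasi (h : WPot m p) (g₀ : ℝ →ᵇ ℂ) (z : ℂ) (x : ℝ) : ℂ :=
  ∫ y in (0:ℝ)..x, ((y ^ m : ℝ) : ℂ) * ((p y : ℂ) - z) * h.sol g₀ z y

/-- The size function of the kernel. -/
noncomputable def size (_ : WPot m p) (z : ℂ) (x : ℝ) : ℝ :=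
  ∫ t in (0:ℝ)..x, wbound m (fun y => (p y : ℂ) - z) t

theorem norm_sol_apply_le (h : WPot m p) (g₀ : ℝ →ᵇ ℂ) (z : ℂ) (x : ℝ) :
    ‖h.sol g₀ z x‖ ≤ ‖g₀‖ * Real.exp (h.size z x) := (h.ker z).norm_sol_apply_le g₀ x

theorem size_nonneg (h : WPot m p) (z : ℂ) (x : ℝ) : 0 ≤ h.size z x := (h.ker z).primitive_nonneg x

theorem size_mono (h : WPot m p) (z : ℂ) {x y : ℝ} (hxy : x ≤ y) : h.size z x ≤ h.size z y := by
  unfold size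
  rw [← sub_nonneg, intervalIntegral.integral_interval_sub_left
    ((h.ker z).int.intervalIntegrable) ((h.ker z).int.intervalIntegrable)]
  exact intervalIntegral.integral_nonneg hxy fun t _ => (h.ker z).nonneg t

theorem continuous_size (h : WPot m p) (z : ℂ) : Continuous (h.size z) :=
  intervalIntegral.continuous_primitive
    (fun _ _ => (h.ker z).int.intervalIntegrable) 0

theorem size_zero (h : WPot m p) (z : ℂ) : h.size z 0 = 0 := intervalIntegral.integral_same

theorem wbound_sub_le (h : WPot m p) (z : ℂ) (y : ℝ) :
    wbound m (fun y => (p y : ℂ) - z) y ≤ wbound m (fun y => (p y : ℂ) - 0) y + 2 * ‖z‖ := by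
  unfold wbound
  by_cases hy : y ∈ Ioo (0:ℝ) 1
  · simp only [indicator_of_mem hy]
    have h1 := rpow_mul_one_sub_wS_le h.hm hy.1 hy.2.le
    have h2 := weight_nonneg (m := m) hy
    have h3 := norm_sub_le (p y : ℂ) z
    rw [sub_zero]
    calc _ ≤ y ^ m * (1 - wS m y) * (‖(p y : ℂ)‖ + ‖z‖) := by gcongr
      _ = y ^ m * (1 - wS m y) * ‖(p y : ℂ)‖ + y ^ m * (1 - wS m y) * ‖z‖ := by ring
      _ ≤ _ := by gcongr
  · simp only [indicator_of_notMem hy]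
    positivity

theorem size_le (h : WPot m p) (z : ℂ) {x : ℝ} (hx : 0 ≤ x) :
    h.size z x ≤ h.size 0 x + 2 * ‖z‖ * x := by
  have h1 : 2 * ‖z‖ * x = ∫ _ in (0:ℝ)..x, 2 * ‖z‖ := by simp; ring
  rw [h1]
  unfold size
  rw [← intervalIntegral.integral_add (h.ker 0).int.intervalIntegrable (by simp)]
  exact intervalIntegral.integral_mono_on hx (h.ker z).int.intervalIntegrable
    ((h.ker 0).int.intervalIntegrable.add (by simp)) fun y _ => h.wbound_sub_le z y

end WPot

namespace WPot

variable {m : ℝ} {p : ℝ → ℝ}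

theorem sol_eq (h : WPot m p) (g₀ : ℝ →ᵇ ℂ) (z : ℂ) (x : ℝ) :
    h.sol g₀ z x = g₀ x + (h.ker z).op (h.sol g₀ z) x := by
  conv_lhs => rw [sol, VolterraKernel.sol_eq]
  rfl

theorem norm_rpow_mul_le {m y : ℝ} (hy : y ∈ Ioo (0:ℝ) 1) (r : ℝ → ℂ) :
    ‖((y ^ m : ℝ) : ℂ) * r y‖ * (1 - wS m y) = wbound m r y := by
  rw [wbound, indicator_of_mem hy, norm_mul, Complex.norm_real,
    Real.norm_of_nonneg (Real.rpow_nonneg hy.1.le _)]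
  ring

theorem norm_rpow_mul_le_wbound {m y : ℝ} (hy : y ∈ Ioo (0:ℝ) 1) (r : ℝ → ℂ) :
    ‖((y ^ m : ℝ) : ℂ) * r y‖ ≤ wbound m r y := by
  rw [← norm_rpow_mul_le hy]
  refine le_mul_of_one_le_right (norm_nonneg _) ?_
  linarith [wS_nonpos (m := m) hy.1 hy.2.le]

theorem aestronglyMeasurable_rpow_mul {m : ℝ} {r : ℝ → ℂ} (hr : Measurable r) :
    AEStronglyMeasurable (fun y => ((y ^ m : ℝ) : ℂ) * r y) (volume.restrict (Ioo 0 1)) := by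
  refine AEStronglyMeasurable.mul ?_ hr.aestronglyMeasurable
  refine ContinuousOn.aestronglyMeasurable ?_ measurableSet_Ioo
  exact Complex.continuous_ofReal.comp_continuousOn
    ((continuousOn_rpow_pos m).mono fun y hy => hy.1)

theorem integrableOn_weight_mul (h : WPot m p) (z : ℂ) :
    IntegrableOn (fun y => ((y ^ m : ℝ) : ℂ) * ((p y : ℂ) - z)) (Ioo 0 1) := by
  refine Integrable.mono' (h.ker z).int.integrableOn (aestronglyMeasurable_rpow_mul
    ((Complex.measurable_ofReal.comp h.meas).sub_const z)) ?_
  filter_upwards [ae_restrict_mem measurableSet_Ioo] with y hy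
  exact norm_rpow_mul_le_wbound hy (fun y => (p y : ℂ) - z)

theorem integrableOn_weight_wS_mul (h : WPot m p) (z : ℂ) :
    IntegrableOn (fun y => (wS m y : ℂ) * (((y ^ m : ℝ) : ℂ) * ((p y : ℂ) - z))) (Ioo 0 1) := by
  refine Integrable.mono' (h.ker z).int.integrableOn (AEStronglyMeasurable.mul ?_
    (aestronglyMeasurable_rpow_mul
    ((Complex.measurable_ofReal.comp h.meas).sub_const z))) ?_
  · refine ContinuousOn.aestronglyMeasurable ?_ measurableSet_Ioo
    exact Complex.continuous_ofReal.comp_continuousOn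
      ((continuousOn_wS m).mono fun y hy => hy.1)
  filter_upwards [ae_restrict_mem measurableSet_Ioo] with y hy
  rw [← norm_rpow_mul_le hy (fun y => (p y : ℂ) - z), norm_mul, mul_comm]
  refine mul_le_mul_of_nonneg_left ?_ (norm_nonneg _)
  rw [Complex.norm_real, Real.norm_of_nonpos (wS_nonpos hy.1 hy.2.le)]
  linarith

theorem intervalIntegrable_of_Ioo {f : ℝ → ℂ} (hf : IntegrableOn f (Ioo 0 1)) {a b : ℝ}
    (ha : a ∈ Icc (0:ℝ) 1) (hb : b ∈ Icc (0:ℝ) 1) : IntervalIntegrable f volume a b := by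
  have : IntervalIntegrable f volume 0 1 := by
    rw [intervalIntegrable_iff_integrableOn_Ioo_of_le zero_le_one]
    exact hf
  refine this.mono_set ?_
  rw [uIcc_of_le (zero_le_one (α := ℝ))]
  exact uIcc_subset_Icc ha hb

theorem integrableOn_mul_bcf {f : ℝ → ℂ} (hf : IntegrableOn f (Ioo 0 1)) (g : ℝ →ᵇ ℂ) :
    IntegrableOn (fun y => f y * g y) (Ioo 0 1) :=
  Integrable.mul_bdd (c := ‖g‖) hf g.continuous.aestronglyMeasurable
    (Eventually.of_forall g.norm_coe_le_norm)

theorem isPrim_primitive {f : ℝ → ℂ} (hf : IntegrableOn f (Ioo 0 1)) {a : ℝ} (ha : 0 ≤ a)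
    (ha1 : a ≤ 1) : IsPrim (fun x => ∫ y in (0:ℝ)..x, f y) f a 1 := by
  refine ⟨ha1, intervalIntegrable_of_Ioo hf ⟨ha, ha1⟩ (by simp), fun x hx => ?_⟩
  rw [intervalIntegral.integral_add_adjacent_intervals]
  · exact intervalIntegrable_of_Ioo hf (by simp) ⟨ha, ha1⟩
  · exact intervalIntegrable_of_Ioo hf ⟨ha, ha1⟩ ⟨ha.trans hx.1, hx.2⟩

theorem isPrim_quasi (h : WPot m p) (g₀ : ℝ →ᵇ ℂ) (z : ℂ) {a : ℝ} (ha : 0 ≤ a) (ha1 : a ≤ 1) :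
    IsPrim (h.quasi g₀ z) (fun y => ((y ^ m : ℝ) : ℂ) * ((p y : ℂ) - z) * h.sol g₀ z y) a 1 :=
  isPrim_primitive (integrableOn_mul_bcf (h.integrableOn_weight_mul z) _) ha ha1

theorem op_sol_eq (h : WPot m p) (g₀ : ℝ →ᵇ ℂ) (z : ℂ) {x : ℝ} (hx : 0 ≤ x) (hx1 : x ≤ 1) :
    (h.ker z).op (h.sol g₀ z) x = wS m x * h.quasi g₀ z x -
      ∫ y in (0:ℝ)..x, (wS m y : ℂ) * (((y ^ m : ℝ) : ℂ) * ((p y : ℂ) - z)) * h.sol g₀ z y := by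
  rw [(h.ker z).op_apply_eq _ hx, quasi, ← intervalIntegral.integral_const_mul,
    ← intervalIntegral.integral_sub]
  · refine intervalIntegral.integral_congr_ae ?_
    have h1 : ∀ᵐ y : ℝ, y ≠ 1 := by simp [ae_iff]
    filter_upwards [h1] with y hy1 hy
    rw [uIoc_of_le hx] at hy
    have hy' : y ∈ Ioo (0:ℝ) 1 := ⟨hy.1, lt_of_le_of_ne (hy.2.trans hx1) hy1⟩
    rw [wker, indicator_of_mem hy', min_eq_left hx1, max_eq_right hy.2]
    push_cast
    ring
  · exact (intervalIntegrable_of_Ioo (integrableOn_mul_bcf (h.integrableOn_weight_mul z) _)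
      (by simp) ⟨hx, hx1⟩).const_mul _
  · exact intervalIntegrable_of_Ioo (integrableOn_mul_bcf (h.integrableOn_weight_wS_mul z) _)
      (by simp) ⟨hx, hx1⟩

theorem isPrim_wS {m a : ℝ} (ha : 0 < a ∨ m = 0) (ha1 : a ≤ 1) :
    IsPrim (fun x => (wS m x : ℂ)) (fun x => ((x ^ (-m) : ℝ) : ℂ)) a 1 := by
  rcases ha with ha | rfl
  · refine IsPrim.of_hasDerivAt ha1 (fun x hx => ?_) ?_
    · exact (hasDerivAt_wS (ha.trans_le hx.1)).ofReal_comp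
    · exact Complex.continuous_ofReal.comp_continuousOn
        ((continuousOn_rpow_neg m).mono fun y hy => ha.trans_le hy.1)
  · refine IsPrim.of_hasDerivAt ha1 (fun x hx => ?_) (by simpa using continuousOn_const)
    simp only [wS_zero, neg_zero, Real.rpow_zero]
    exact ((hasDerivAt_id x).sub_const 1).ofReal_comp

theorem isPrim_op_sol (h : WPot m p) (g₀ : ℝ →ᵇ ℂ) (z : ℂ) {a : ℝ} (ha0 : 0 ≤ a)
    (ha : 0 < a ∨ m = 0) (ha1 : a ≤ 1) :
    IsPrim (fun x => (h.ker z).op (h.sol g₀ z) x)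
      (fun x => ((x ^ (-m) : ℝ) : ℂ) * h.quasi g₀ z x) a 1 := by
  have h1 := ((isPrim_wS ha ha1).mul (h.isPrim_quasi g₀ z ha0 ha1)).sub
    (isPrim_primitive (integrableOn_mul_bcf (h.integrableOn_weight_wS_mul z) (h.sol g₀ z)) ha0 ha1)
  refine (h1.congr_deriv fun x hx => ?_).congr fun x hx => ?_
  · ring
  · exact (h.op_sol_eq g₀ z (ha0.trans hx.1) hx.2).symm

theorem norm_op_sol_le (h : WPot m p) (g₀ : ℝ →ᵇ ℂ) (z : ℂ) {x : ℝ} (hx : 0 ≤ x) :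
    ‖(h.ker z).op (h.sol g₀ z) x‖ ≤ h.size z x * (‖g₀‖ * Real.exp (h.size z x)) := by
  refine ((h.ker z).norm_op_le _ hx (F := fun _ => ‖g₀‖ * Real.exp (h.size z x))
    (fun y hy => ?_) ((h.ker z).int.intervalIntegrable.mul_const _)).trans_eq ?_
  · refine (h.norm_sol_apply_le g₀ z y).trans ?_
    gcongr
    exact h.size_mono z hy.2
  · exact intervalIntegral.integral_mul_const _ _

theorem norm_quasi_mul_le (h : WPot m p) (g₀ : ℝ →ᵇ ℂ) (z : ℂ) {x : ℝ} (hx : 0 < x)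
    (hx1 : x ≤ 1) :
    ‖h.quasi g₀ z x‖ * (1 - wS m x) ≤ h.size z x * ‖h.sol g₀ z‖ := by
  have h0 : 0 ≤ 1 - wS m x := by linarith [wS_nonpos (m := m) hx hx1]
  rw [← Real.norm_of_nonneg h0, ← Complex.norm_real, ← norm_mul, quasi,
    ← intervalIntegral.integral_mul_const, size, ← intervalIntegral.integral_mul_const]
  refine intervalIntegral.norm_integral_le_of_norm_le hx.le ?_
    ((h.ker z).int.intervalIntegrable.mul_const _)
  have h1 : ∀ᵐ y : ℝ, y ≠ 1 := by simp [ae_iff]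
  filter_upwards [h1] with y hy1 hy
  have hy' : y ∈ Ioo (0:ℝ) 1 := ⟨hy.1, lt_of_le_of_ne (hy.2.trans hx1) hy1⟩
  rw [← norm_rpow_mul_le hy' (fun y => (p y : ℂ) - z), norm_mul, norm_mul _ (h.sol g₀ z y),
    Complex.norm_real, Real.norm_of_nonneg h0, mul_right_comm]
  have := wS_mono (m := m) hy.1 hy.2
  gcongr
  · exact mul_nonneg (norm_nonneg _) (by linarith [wS_nonpos (m := m) hy'.1 hy'.2.le])
  · exact (h.sol g₀ z).norm_coe_le_norm y

theorem norm_quasi_le (h : WPot m p) (g₀ : ℝ →ᵇ ℂ) (z : ℂ) {x : ℝ} (hx : 0 < x)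
    (hx1 : x ≤ 1) : ‖h.quasi g₀ z x‖ ≤ h.size z x * ‖h.sol g₀ z‖ := by
  refine le_trans ?_ (h.norm_quasi_mul_le g₀ z hx hx1)
  refine le_mul_of_one_le_right (norm_nonneg _) ?_
  linarith [wS_nonpos (m := m) hx hx1]

theorem tendsto_size (h : WPot m p) (z : ℂ) : Tendsto (h.size z) (𝓝[>] 0) (𝓝 0) := by
  have := (h.continuous_size z).tendsto 0
  rw [h.size_zero] at this
  exact this.mono_left nhdsWithin_le_nhds

theorem size_one_le (h : WPot m p) (z : ℂ) : h.size z 1 ≤ (h.size 0 1 + 2) * (1 + ‖z‖) := by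
  have := h.size_le z zero_le_one
  have h1 := h.size_nonneg 0 1
  nlinarith [norm_nonneg z]

theorem size_le_size_one (h : WPot m p) (z : ℂ) (x : ℝ) : h.size z x ≤ h.size z 1 := by
  rcases le_total x 1 with hx | hx
  · exact h.size_mono z hx
  · have : h.size z x - h.size z 1 = 0 := by
      rw [size, size, intervalIntegral.integral_interval_sub_left
        ((h.ker z).int.intervalIntegrable) ((h.ker z).int.intervalIntegrable),
        intervalIntegral.integral_congr (g := fun _ => (0:ℝ))]
      · simp
      · intro y hy
        rw [uIcc_of_le hx] at hy
        exact indicator_of_notMem (fun h => absurd h.2 (not_lt.2 hy.1)) _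
    linarith

theorem norm_sol_le (h : WPot m p) (g₀ : ℝ →ᵇ ℂ) (z : ℂ) :
    ‖h.sol g₀ z‖ ≤ ‖g₀‖ * Real.exp ((h.size 0 1 + 2) * (1 + ‖z‖)) := by
  rw [BoundedContinuousFunction.norm_le (by positivity)]
  intro x
  refine (h.norm_sol_apply_le g₀ z x).trans ?_
  gcongr
  exact (h.size_le_size_one z x).trans (h.size_one_le z)

theorem differentiable_sol_apply (h : WPot m p) (g₀ : ℝ →ᵇ ℂ) (x : ℝ) :
    Differentiable ℂ fun z => h.sol g₀ z x := by
  have := (BoundedContinuousFunction.evalCLM (β := ℂ) ℂ x).differentiable.comp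
    (h.differentiable_sol g₀)
  exact this

/-- Integration against an integrable function as a functional on bounded functions. -/
noncomputable def integralCLM (f : ℝ → ℂ) (hf : IntegrableOn f (Ioo 0 1)) : (ℝ →ᵇ ℂ) →L[ℂ] ℂ :=
  LinearMap.mkContinuous
    { toFun := fun g => ∫ y in Ioo (0:ℝ) 1, f y * g y
      map_add' := fun g g' => by
        simp only [BoundedContinuousFunction.coe_add, Pi.add_apply, mul_add]
        exact integral_add (integrableOn_mul_bcf hf g) (integrableOn_mul_bcf hf g')
      map_smul' := fun c g => by
        simp only [BoundedContinuousFunction.coe_smul, smul_eq_mul, mul_left_comm _ c,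
          RingHom.id_apply]
        exact integral_const_mul _ _ } (∫ y in Ioo (0:ℝ) 1, ‖f y‖) (fun g => by
    rw [← integral_mul_const]
    refine norm_integral_le_of_norm_le (hf.norm.mul_const _) (Eventually.of_forall fun y => ?_)
    rw [norm_mul]
    gcongr
    exact g.norm_coe_le_norm y)

theorem integralCLM_apply (f : ℝ → ℂ) (hf : IntegrableOn f (Ioo 0 1)) (g : ℝ →ᵇ ℂ) :
    integralCLM f hf g = ∫ y in Ioo (0:ℝ) 1, f y * g y := rfl

theorem differentiable_quasi_one (h : WPot m p) (g₀ : ℝ →ᵇ ℂ) :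
    Differentiable ℂ fun z => h.quasi g₀ z 1 := by
  have h0 := h.integrableOn_weight_mul 0
  have h1 : IntegrableOn (fun y => ((y ^ m : ℝ) : ℂ)) (Ioo 0 1) := by
    have := h0.sub (h.integrableOn_weight_mul 1)
    refine this.congr (Eventually.of_forall fun y => ?_)
    simp only [Pi.sub_apply]
    ring
  have : (fun z => h.quasi g₀ z 1) = fun z =>
      integralCLM _ h0 (h.sol g₀ z) - z * integralCLM _ h1 (h.sol g₀ z) := by
    funext z
    rw [integralCLM_apply, integralCLM_apply, ← integral_const_mul, ← integral_sub
      (integrableOn_mul_bcf h0 _) ((integrableOn_mul_bcf h1 _).const_mul z), quasi,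
      intervalIntegral.integral_of_le zero_le_one, integral_Ioc_eq_integral_Ioo]
    refine integral_congr_ae (Eventually.of_forall fun y => ?_)
    simp only
    ring
  rw [this]
  have hd := h.differentiable_sol g₀
  exact ((integralCLM _ h0).differentiable.comp hd).sub
    (differentiable_id.mul ((integralCLM _ h1).differentiable.comp hd))

end WPot

theorem wPot_zero_indicator {Q : ℝ → ℝ} {T : ℝ} (hT : 0 ≤ T)
    (hQm : Measurable Q) (hQ : IntervalIntegrable Q volume 0 T) :
    WPot 0 ((Icc 0 T).indicator Q) where
  hm := le_rfl
  meas := hQm.indicator measurableSet_Icc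
  int := by
    have h1 : Integrable ((Icc 0 T).indicator Q) := by
      rw [integrable_indicator_iff measurableSet_Icc, integrableOn_Icc_iff_integrableOn_Ioc]
      exact (intervalIntegrable_iff_integrableOn_Ioc_of_le hT).1 hQ
    refine Integrable.mono' (h1.norm.const_mul 2).integrableOn ?_ ?_
    · refine ((WPot.continuousOn_weight 0).aestronglyMeasurable measurableSet_Ioo).mul ?_
      exact (hQm.indicator measurableSet_Icc).norm.aestronglyMeasurable
    · filter_upwards [ae_restrict_mem measurableSet_Ioo] with y hy
      rw [Real.norm_of_nonneg (mul_nonneg (WPot.weight_nonneg hy) (abs_nonneg _))]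
      exact mul_le_mul_of_nonneg_right (rpow_mul_one_sub_wS_le le_rfl hy.1 hy.2.le) (abs_nonneg _)

/-- The function `x ↦ x` clipped to `[0,1]`. -/
noncomputable def clipBCF : ℝ →ᵇ ℂ :=
  BoundedContinuousFunction.ofNormedAddCommGroup (fun x : ℝ => ((max 0 (min x 1) : ℝ) : ℂ))
    (by fun_prop) 1 (fun x => by
      rw [Complex.norm_real, Real.norm_of_nonneg (le_max_left _ _)]
      exact max_le zero_le_one (min_le_right _ _))

theorem clipBCF_apply {x : ℝ} (hx : x ∈ Icc (0:ℝ) 1) : clipBCF x = x := by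
  change ((max 0 (min x 1) : ℝ) : ℂ) = x
  rw [min_eq_left hx.2, max_eq_right hx.1]

theorem norm_clipBCF_le : ‖clipBCF‖ ≤ 1 :=
  BoundedContinuousFunction.norm_ofNormedAddCommGroup_le _ zero_le_one _

/-- Existence of the cosine and sine type solutions, entire in the spectral parameter. -/
theorem exists_fundamental_system {Q : ℝ → ℝ} {T : ℝ} (hT : 0 ≤ T) (hT1 : T ≤ 1)
    (hQm : Measurable Q) (hQ : IntervalIntegrable Q volume 0 T) :
    ∃ (c c' s s' : ℂ → ℝ → ℂ) (B : ℝ), ∀ z,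
      (SLSol Q z (c z) (c' z) 0 T ∧ c z 0 = 1 ∧ c' z 0 = 0) ∧
      (SLSol Q z (s z) (s' z) 0 T ∧ s z 0 = 0 ∧ s' z 0 = 1) ∧
      (∀ t, Differentiable ℂ (fun z => c z t) ∧ ‖c z t‖ ≤ Real.exp (B * (1 + ‖z‖))) ∧
      (∀ t, Differentiable ℂ (fun z => s z t) ∧ ‖s z t‖ ≤ Real.exp (B * (1 + ‖z‖))) := by
  have hW := wPot_zero_indicator hT hQm hQ
  have hq : ∀ g₀ z, IsPrim (hW.quasi g₀ z) (fun x => ((Q x : ℂ) - z) * hW.sol g₀ z x) 0 T := by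
    intro g₀ z
    refine ((hW.isPrim_quasi g₀ z le_rfl zero_le_one).mono le_rfl hT hT1).congr_deriv
      fun x hx => ?_
    rw [indicator_of_mem hx]
    simp
  have hs : ∀ g₀ z, IsPrim (fun x => (hW.ker z).op (hW.sol g₀ z) x) (hW.quasi g₀ z) 0 T := by
    intro g₀ z
    refine ((hW.isPrim_op_sol g₀ z le_rfl (Or.inr rfl) zero_le_one).mono le_rfl hT hT1).congr_deriv
      fun x hx => ?_
    simp
  have hq0 : ∀ g₀ z, hW.quasi g₀ z 0 = 0 := fun g₀ z => intervalIntegral.integral_same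
  have hs0 : ∀ g₀ z, hW.sol g₀ z 0 = g₀ 0 := fun g₀ z => by
    rw [hW.sol_eq, VolterraKernel.op_apply_of_nonpos _ _ le_rfl, add_zero]
  have hb : ∀ g₀ : ℝ →ᵇ ℂ, ‖g₀‖ ≤ 1 → ∀ z t,
      ‖hW.sol g₀ z t‖ ≤ Real.exp ((hW.size 0 1 + 2) * (1 + ‖z‖)) := by
    intro g₀ h z t
    refine ((hW.sol g₀ z).norm_coe_le_norm t).trans ((hW.norm_sol_le g₀ z).trans ?_)
    exact mul_le_of_le_one_left (Real.exp_nonneg _) h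
  refine ⟨fun z => hW.sol 1 z, fun z => hW.quasi 1 z, fun z => hW.sol clipBCF z,
    fun z x => 1 + hW.quasi clipBCF z x, hW.size 0 1 + 2, fun z => ⟨⟨⟨?_, hq 1 z⟩, ?_, hq0 1 z⟩,
    ⟨⟨?_, ?_⟩, ?_, ?_⟩, fun t => ⟨hW.differentiable_sol_apply 1 t, ?_⟩,
    fun t => ⟨hW.differentiable_sol_apply _ t, hb _ norm_clipBCF_le z t⟩⟩⟩
  · refine ((IsPrim.const hT 1).add (hs 1 z)).congr_deriv (by simp) |>.congr fun x hx => ?_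
    beta_reduce
    rw [hW.sol_eq]
    rfl
  · beta_reduce
    rw [hs0]
    rfl
  · have hid : IsPrim (fun x : ℝ => (x : ℂ)) (fun _ => 1) 0 T :=
      IsPrim.of_hasDerivAt hT (fun x _ => Complex.ofRealCLM.hasDerivAt) continuousOn_const
    refine (hid.add (hs clipBCF z)).congr fun x hx => ?_
    beta_reduce
    rw [hW.sol_eq, clipBCF_apply ⟨hx.1, hx.2.trans hT1⟩]
  · refine ((IsPrim.const hT 1).add (hq clipBCF z)).congr_deriv (by simp)
  · beta_reduce
    rw [hs0, clipBCF_apply (by simp)]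
    simp
  · simp [hq0]
  · refine hb _ ?_ z t
    exact norm_one.le

section Regular

variable {l : ℝ} {q : ℝ → ℝ}

theorem rpow_mul_one_sub_wS_le_const_mul {m y : ℝ} (hm : 1 < m) (hy : y ∈ Ioo (0:ℝ) 1) :
    y ^ m * (1 - wS m y) ≤ (1 + 1 / (m - 1)) * y := by
  have h1 : wS m y = (y ^ (-m + 1) - 1) / (-m + 1) := by
    rw [wS, integral_rpow]
    · simp
    · refine Or.inr ⟨by linarith, fun h => ?_⟩
      rw [uIcc_of_ge hy.2.le] at h
      exact absurd h.1 (not_le.2 hy.1)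
  have h2 : y ^ m * y ^ (-m + 1) = y := by
    rw [← Real.rpow_add hy.1]; simp
  have h3 : y ^ m ≤ y := by
    simpa using Real.rpow_le_rpow_of_exponent_ge hy.1 hy.2.le hm.le
  have h4 : 0 ≤ y ^ m := Real.rpow_nonneg hy.1.le _
  have hm1 : 0 < m - 1 := by linarith
  have e : -m + 1 = -(m - 1) := by ring
  have h5 : y ^ m * (1 - wS m y) = y ^ m + (y - y ^ m) / (m - 1) := by
    rw [h1]
    calc _ = y ^ m + (y ^ m * y ^ (-m + 1) - y ^ m) / (m - 1) := by
          rw [e]; field_simp; ring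
      _ = _ := by rw [h2]
  rw [h5, add_mul, one_mul]
  have : (y - y ^ m) / (m - 1) ≤ 1 / (m - 1) * y := by
    rw [div_mul_eq_mul_div, one_mul]
    gcongr
    linarith
  linarith

theorem wPot_of_qtilde (hl : -(1:ℝ) / 2 ≤ l) (hqm : Measurable q)
    (hq : IntegrableOn (fun x => x * qtilde l q x) (Ioo 0 1)) : WPot (2 * l + 2) q where
  hm := by linarith
  meas := hqm
  int := by
    have hmeas : AEStronglyMeasurable (fun y => y ^ (2 * l + 2) * (1 - wS (2 * l + 2) y) * |q y|)
        (volume.restrict (Ioo 0 1)) :=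
      ((WPot.continuousOn_weight _).aestronglyMeasurable measurableSet_Ioo).mul
        hqm.norm.aestronglyMeasurable
    rcases eq_or_lt_of_le hl with h | h
    · refine hq.congr ?_
      filter_upwards [ae_restrict_mem measurableSet_Ioo] with y hy
      have : 2 * l + 2 = 1 := by rw [← h]; norm_num
      rw [this, qtilde, if_pos h.symm, Real.rpow_one, wS]
      simp only [Real.rpow_neg_one]
      rw [integral_inv_of_pos one_pos hy.1]
      simp only [div_one]
      ring
    · refine Integrable.mono' (hq.const_mul (1 + 1 / (2 * l + 2 - 1))) hmeas ?_
      filter_upwards [ae_restrict_mem measurableSet_Ioo] with y hy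
      rw [Real.norm_of_nonneg (mul_nonneg (WPot.weight_nonneg hy) (abs_nonneg _)), qtilde,
        if_neg h.ne', ← mul_assoc]
      exact mul_le_mul_of_nonneg_right
        (rpow_mul_one_sub_wS_le_const_mul (by linarith) hy) (abs_nonneg _)

/-- The full potential `l(l+1)/x² + q`. -/
noncomputable def fullPot (l : ℝ) (q : ℝ → ℝ) (x : ℝ) : ℝ := l * (l + 1) / x ^ 2 + q x

/-- The regular solution. -/
noncomputable def regU (h : WPot (2 * l + 2) q) (z : ℂ) (x : ℝ) : ℂ :=
  ((x ^ (l + 1) : ℝ) : ℂ) * h.sol 1 z x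

/-- The derivative of the regular solution. -/
noncomputable def regV (h : WPot (2 * l + 2) q) (z : ℂ) (x : ℝ) : ℂ :=
  (((l + 1) * x ^ l : ℝ) : ℂ) * h.sol 1 z x + ((x ^ (-l - 1) : ℝ) : ℂ) * h.quasi 1 z x

theorem isPrim_rpow (c : ℝ) {a : ℝ} (ha : 0 < a) (ha1 : a ≤ 1) :
    IsPrim (fun x => ((x ^ c : ℝ) : ℂ)) (fun x => ((c * x ^ (c - 1) : ℝ) : ℂ)) a 1 := by
  refine IsPrim.of_hasDerivAt ha1 (fun x hx => ?_) ?_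
  · exact (Real.hasDerivAt_rpow_const (Or.inl (ha.trans_le hx.1).ne')).ofReal_comp
  · exact Complex.continuous_ofReal.comp_continuousOn (continuousOn_const.mul
      ((continuousOn_rpow_pos (c - 1)).mono fun y hy => ha.trans_le hy.1))

theorem isPrim_sol_one (h : WPot (2 * l + 2) q) (z : ℂ) {a : ℝ} (ha : 0 < a) (ha1 : a ≤ 1) :
    IsPrim (h.sol 1 z) (fun x => ((x ^ (-(2 * l + 2)) : ℝ) : ℂ) * h.quasi 1 z x) a 1 := by
  refine ((IsPrim.const ha1 1).add
    (h.isPrim_op_sol 1 z ha.le (Or.inl ha) ha1)).congr_deriv (by simp) |>.congr fun x hx => ?_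
  rw [h.sol_eq]
  rfl

theorem slSol_reg (h : WPot (2 * l + 2) q) (z : ℂ) {a : ℝ} (ha : 0 < a) (ha1 : a ≤ 1) :
    SLSol (fullPot l q) z (regU h z) (regV h z) a 1 := by
  have hg := isPrim_sol_one h z ha ha1
  constructor
  · refine ((isPrim_rpow (l + 1) ha ha1).mul hg).congr_deriv fun x hx => ?_
    have hx0 : 0 < x := ha.trans_le hx.1
    rw [regV, ← mul_assoc, ← Complex.ofReal_mul, ← Real.rpow_add hx0]
    ring_nf
  · have h1 : IsPrim (fun x => (((l + 1) * x ^ l : ℝ) : ℂ))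
        (fun x => (((l + 1) * (l * x ^ (l - 1)) : ℝ) : ℂ)) a 1 := by
      refine (((isPrim_rpow l ha ha1).const_mul ((l + 1 : ℝ) : ℂ)).congr_deriv
        fun x _ => ?_).congr fun x _ => ?_ <;> push_cast <;> ring
    refine ((h1.mul hg).add ((isPrim_rpow (-l - 1) ha ha1).mul
      (h.isPrim_quasi 1 z ha.le ha1))).congr_deriv fun x hx => ?_
    have hx0 : 0 < x := ha.trans_le hx.1
    have e1 : x ^ l * x ^ (-(2 * l + 2)) = x ^ (-l - 1 - 1) := by
      rw [← Real.rpow_add hx0]; ring_nf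
    have e2 : x ^ (-l - 1) * x ^ (2 * l + 2) = x ^ (l + 1) := by
      rw [← Real.rpow_add hx0]; ring_nf
    have e3 : x ^ (l - 1) = x ^ (l + 1) / x ^ 2 := by
      rw [← Real.rpow_natCast, ← Real.rpow_sub hx0]; norm_num; ring_nf
    rw [regU, fullPot, e3]
    have e1' : ((x ^ l : ℝ) : ℂ) * ((x ^ (-(2 * l + 2)) : ℝ) : ℂ) =
        ((x ^ (-l - 1 - 1) : ℝ) : ℂ) := by
      rw [← e1]; push_cast; rfl
    have e2' : ((x ^ (-l - 1) : ℝ) : ℂ) * ((x ^ (2 * l + 2) : ℝ) : ℂ) =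
        ((x ^ (l + 1) : ℝ) : ℂ) := by
      rw [← e2]; push_cast; rfl
    simp only [Complex.ofReal_mul, Complex.ofReal_add, Complex.ofReal_div, Complex.ofReal_sub,
      Complex.ofReal_neg, Complex.ofReal_one, Complex.ofReal_pow]
    linear_combination ((l : ℂ) + 1) * h.quasi 1 z x * e1' + ((q x : ℂ) - z) * h.sol 1 z x * e2'

theorem tendsto_sol_one (h : WPot (2 * l + 2) q) (z : ℂ) :
    Tendsto (h.sol 1 z) (𝓝[>] 0) (𝓝 1) := by
  have h1 := (h.sol 1 z).continuous.tendsto 0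
  rw [h.sol_eq, VolterraKernel.op_apply_of_nonpos _ _ le_rfl, add_zero] at h1
  exact h1.mono_left nhdsWithin_le_nhds

theorem tendsto_quasi_mul (h : WPot (2 * l + 2) q) (z : ℂ) :
    Tendsto (fun x => ‖h.quasi 1 z x‖ * (1 - wS (2 * l + 2) x)) (𝓝[>] 0) (𝓝 0) := by
  have h1 : Tendsto (fun x => h.size z x * ‖h.sol 1 z‖) (𝓝[>] 0) (𝓝 0) := by
    simpa using (h.tendsto_size z).mul_const ‖h.sol 1 z‖
  refine squeeze_zero' ?_ ?_ h1
  · filter_upwards [Ioo_mem_nhdsGT (zero_lt_one (α := ℝ))] with x hx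
    exact mul_nonneg (norm_nonneg _) (by linarith [wS_nonpos (m := 2 * l + 2) hx.1 hx.2.le])
  · filter_upwards [Ioo_mem_nhdsGT (zero_lt_one (α := ℝ))] with x hx
    exact h.norm_quasi_mul_le 1 z hx.1 hx.2.le

theorem tendsto_quasi (h : WPot (2 * l + 2) q) (z : ℂ) :
    Tendsto (h.quasi 1 z) (𝓝[>] 0) (𝓝 0) := by
  have h1 : Tendsto (fun x => h.size z x * ‖h.sol 1 z‖) (𝓝[>] 0) (𝓝 0) := by
    simpa using (h.tendsto_size z).mul_const ‖h.sol 1 z‖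
  rw [tendsto_zero_iff_norm_tendsto_zero]
  refine squeeze_zero' (Eventually.of_forall fun _ => norm_nonneg _) ?_ h1
  filter_upwards [Ioo_mem_nhdsGT (zero_lt_one (α := ℝ))] with x hx
  exact h.norm_quasi_le 1 z hx.1 hx.2.le

theorem im_regV_mul_conj (h : WPot (2 * l + 2) q) (z : ℂ) {x : ℝ} (hx : 0 < x) :
    (regV h z x * conj (regU h z x)).im = (h.quasi 1 z x * conj (h.sol 1 z x)).im := by
  have e : x ^ (-l - 1) * x ^ (l + 1) = 1 := by
    rw [← Real.rpow_add hx]; ring_nf; simp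
  have e' : ((x ^ (-l - 1) : ℝ) : ℂ) * ((x ^ (l + 1) : ℝ) : ℂ) = 1 := by
    rw [← Complex.ofReal_mul, e]; simp
  have : regV h z x * conj (regU h z x) =
      (((l + 1) * x ^ l * x ^ (l + 1) * Complex.normSq (h.sol 1 z x) : ℝ) : ℂ) +
        h.quasi 1 z x * conj (h.sol 1 z x) := by
    rw [regV, regU, map_mul, Complex.conj_ofReal]
    push_cast
    rw [← Complex.mul_conj]
    linear_combination h.quasi 1 z x * conj (h.sol 1 z x) * e'
  rw [this, Complex.add_im, Complex.ofReal_im, zero_add]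

theorem tendsto_im_reg (h : WPot (2 * l + 2) q) (z : ℂ) :
    Tendsto (fun x => (regV h z x * conj (regU h z x)).im) (𝓝[>] 0) (𝓝 0) := by
  have h1 : Tendsto (fun x => (h.quasi 1 z x * conj (h.sol 1 z x)).im) (𝓝[>] 0) (𝓝 0) := by
    have := (tendsto_quasi h z).mul ((Complex.continuous_conj.tendsto _).comp (tendsto_sol_one h z))
    rw [zero_mul] at this
    exact (Complex.continuous_im.tendsto _).comp this
  refine h1.congr' ?_
  filter_upwards [self_mem_nhdsWithin] with x hx
  exact (im_regV_mul_conj h z hx).symm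

theorem im_reg_bound (h : WPot (2 * l + 2) q) (z : ℂ) {a x : ℝ} (ha : 0 < a) (hax : a ≤ x)
    (hx1 : x ≤ 1) :
    z.im ^ 2 * (∫ t in a..x, ‖regU h z t‖ ^ 2) ≤ -(z.im * (regV h z x * conj (regU h z x)).im) := by
  have h1 : Tendsto (fun b => -(z.im * ((regV h z x * conj (regU h z x)).im -
      (regV h z b * conj (regU h z b)).im))) (𝓝[>] 0)
      (𝓝 (-(z.im * ((regV h z x * conj (regU h z x)).im - 0)))) :=
    ((tendsto_const_nhds.sub (tendsto_im_reg h z)).const_mul _).neg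
  rw [sub_zero] at h1
  refine ge_of_tendsto h1 ?_
  filter_upwards [Ioo_mem_nhdsGT ha] with b hb
  have hs := slSol_reg h z hb.1 (hb.2.le.trans (hax.trans hx1))
  have h2 := hs.energy_eq (x := b) (y := x) ⟨le_rfl, hb.2.le.trans (hax.trans hx1)⟩
    ⟨hb.2.le.trans hax, hx1⟩
  rw [h2]
  have hc : ContinuousOn (fun t => ‖regU h z t‖ ^ 2) (Icc b 1) := (hs.fst.continuousOn.norm).pow 2
  have hi : ∀ u v, u ∈ Icc b 1 → v ∈ Icc b 1 →
      IntervalIntegrable (fun t => ‖regU h z t‖ ^ 2) volume u v := fun u v hu hv =>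
    (hc.mono (uIcc_subset_Icc hu hv)).intervalIntegrable
  have h3 : ∫ t in a..x, ‖regU h z t‖ ^ 2 ≤ ∫ t in b..x, ‖regU h z t‖ ^ 2 := by
    rw [← intervalIntegral.integral_add_adjacent_intervals
      (hi b a ⟨le_rfl, hb.2.le.trans (hax.trans hx1)⟩ ⟨hb.2.le, hax.trans hx1⟩)
      (hi a x ⟨hb.2.le, hax.trans hx1⟩ ⟨hb.2.le.trans hax, hx1⟩)]
    have := intervalIntegral.integral_nonneg hb.2.le
      (fun t (_ : t ∈ Icc b a) => sq_nonneg ‖regU h z t‖) (μ := volume)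
    linarith
  nlinarith [sq_nonneg z.im]

theorem im_reg_sign (h : WPot (2 * l + 2) q) (z : ℂ) {x : ℝ} (hx : 0 < x) (hx1 : x ≤ 1) :
    z.im * (regV h z x * conj (regU h z x)).im ≤ 0 := by
  have := im_reg_bound h z hx le_rfl hx1
  rw [intervalIntegral.integral_same] at this
  linarith

end Regular

section CharFun

variable {l : ℝ} {q : ℝ → ℝ}

/-- The characteristic function of the regular solution. -/
noncomputable def charF (h : WPot (2 * l + 2) q) : Option ℝ → ℂ → ℂ
  | none => fun z => regU h z 1
  | some γ => fun z => regV h z 1 + (γ : ℂ) * regU h z 1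

theorem regU_one (h : WPot (2 * l + 2) q) (z : ℂ) : regU h z 1 = h.sol 1 z 1 := by simp [regU]

theorem regV_one (h : WPot (2 * l + 2) q) (z : ℂ) :
    regV h z 1 = ((l + 1 : ℝ) : ℂ) * h.sol 1 z 1 + h.quasi 1 z 1 := by simp [regV]

theorem differentiable_regU_one (h : WPot (2 * l + 2) q) :
    Differentiable ℂ fun z => regU h z 1 := by
  simp_rw [regU_one]
  exact h.differentiable_sol_apply 1 1

theorem differentiable_regV_one (h : WPot (2 * l + 2) q) :
    Differentiable ℂ fun z => regV h z 1 := by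
  simp_rw [regV_one]
  exact ((h.differentiable_sol_apply 1 1).const_mul _).add (h.differentiable_quasi_one 1)

theorem differentiable_charF (h : WPot (2 * l + 2) q) (γ : Option ℝ) :
    Differentiable ℂ (charF h γ) := by
  cases γ with
  | none => exact differentiable_regU_one h
  | some γ => exact (differentiable_regV_one h).add ((differentiable_regU_one h).const_mul _)

theorem exists_growth_bound (h : WPot (2 * l + 2) q) : ∃ C : ℝ, ∀ z,
    ‖regU h z 1‖ ≤ Real.exp (C * (1 + ‖z‖)) ∧ ‖regV h z 1‖ ≤ Real.exp (C * (1 + ‖z‖)) := by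
  set B := h.size 0 1 + 2 with hB
  have hB0 : 0 ≤ B := by linarith [h.size_nonneg 0 1]
  have hs : ∀ z, ‖h.sol 1 z‖ ≤ Real.exp (B * (1 + ‖z‖)) := fun z => by
    refine (h.norm_sol_le 1 z).trans (mul_le_of_le_one_left (Real.exp_nonneg _) norm_one.le)
  refine ⟨B + B + |l + 1|, fun z => ?_⟩
  have h1 : (h.sol 1 z) 1 = h.sol 1 z 1 := rfl
  have h2 : ‖h.sol 1 z 1‖ ≤ Real.exp (B * (1 + ‖z‖)) :=
    ((h.sol 1 z).norm_coe_le_norm 1).trans (hs z)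
  have hz : 0 ≤ ‖z‖ := norm_nonneg z
  have hl0 := abs_nonneg (l + 1)
  have h3 : B * (1 + ‖z‖) ≤ (B + B + |l + 1|) * (1 + ‖z‖) := by nlinarith
  constructor
  · rw [regU_one]
    exact h2.trans (Real.exp_le_exp.2 h3)
  · rw [regV_one]
    have h4 := h.norm_quasi_le 1 z one_pos le_rfl
    have h5 := h.size_one_le z
    have h6 : ‖h.quasi 1 z 1‖ ≤ (B * (1 + ‖z‖)) * Real.exp (B * (1 + ‖z‖)) :=
      h4.trans (mul_le_mul h5 (hs z) (norm_nonneg _) (by positivity))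
    refine (norm_add_le _ _).trans ?_
    rw [norm_mul, Complex.norm_real, Real.norm_eq_abs]
    have h7 : |l + 1| * ‖h.sol 1 z 1‖ ≤ |l + 1| * Real.exp (B * (1 + ‖z‖)) := by gcongr
    have h8 : (|l + 1| + B) * (1 + ‖z‖) + 1 ≤ Real.exp ((|l + 1| + B) * (1 + ‖z‖)) :=
      Real.add_one_le_exp _
    have h9 : (B + B + |l + 1|) * (1 + ‖z‖) =
      (|l + 1| + B) * (1 + ‖z‖) + B * (1 + ‖z‖) := by ring
    rw [h9, Real.exp_add]
    have h10 : |l + 1| + B * (1 + ‖z‖) ≤ Real.exp ((|l + 1| + B) * (1 + ‖z‖)) := by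
      nlinarith
    calc _ ≤ |l + 1| * Real.exp (B * (1 + ‖z‖)) + (B * (1 + ‖z‖)) * Real.exp (B * (1 + ‖z‖)) :=
          add_le_add h7 h6
      _ = (|l + 1| + B * (1 + ‖z‖)) * Real.exp (B * (1 + ‖z‖)) := by ring
      _ ≤ _ := by gcongr

theorem exists_growth_bound_charF (h : WPot (2 * l + 2) q) (γ : Option ℝ) : ∃ C : ℝ, ∀ z,
    ‖charF h γ z‖ ≤ Real.exp (C * (1 + ‖z‖)) := by
  obtain ⟨C, hC⟩ := exists_growth_bound h
  cases γ with
  | none => exact ⟨C, fun z => (hC z).1⟩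
  | some γ =>
    refine ⟨|γ| + C, fun z => ?_⟩
    refine (norm_add_le _ _).trans ?_
    rw [norm_mul, Complex.norm_real, Real.norm_eq_abs, add_mul, Real.exp_add]
    have h8 : |γ| * (1 + ‖z‖) + 1 ≤ Real.exp (|γ| * (1 + ‖z‖)) := Real.add_one_le_exp _
    have h9 : 1 + |γ| ≤ Real.exp (|γ| * (1 + ‖z‖)) := by
      nlinarith [abs_nonneg γ, norm_nonneg z]
    calc _ ≤ Real.exp (C * (1 + ‖z‖)) + |γ| * Real.exp (C * (1 + ‖z‖)) :=
          add_le_add (hC z).2 (mul_le_mul_of_nonneg_left (hC z).1 (abs_nonneg _))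
      _ = (1 + |γ|) * Real.exp (C * (1 + ‖z‖)) := by ring
      _ ≤ _ := by gcongr

theorem exists_lower_bound_integral (h : WPot (2 * l + 2) q) (hl : -(1:ℝ) / 2 ≤ l) :
    ∃ C : ℝ, ∀ z, ∃ a : ℝ, 0 < a ∧ a ≤ 1 ∧
      Real.exp (-(C * (1 + ‖z‖))) ≤ ∫ t in a..1, ‖regU h z t‖ ^ 2 := by
  obtain ⟨x₀, hx₀, hx₀1, hs₀⟩ : ∃ x₀ : ℝ, 0 < x₀ ∧ x₀ < 1 ∧ h.size 0 x₀ ≤ 1 / 8 := by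
    have h1 := (h.tendsto_size 0).eventually_le_const (u := 1 / 8) (by norm_num)
    obtain ⟨x, hx, hx'⟩ := (h1.and (Ioo_mem_nhdsGT (zero_lt_one (α := ℝ)))).exists
    exact ⟨x, hx'.1, hx'.2, hx⟩
  set c := min x₀ (1 / 16) / 2 with hc
  have hc0 : 0 < c := by positivity
  have hcx : 2 * c ≤ x₀ := by rw [hc]; linarith [min_le_left x₀ (1 / 16)]
  have hc16 : 2 * c ≤ 1 / 16 := by rw [hc]; linarith [min_le_right x₀ (1 / 16)]
  set k := |Real.log c| + 1 with hk
  refine ⟨k + 2 * k * (l + 1) + 2, fun z => ?_⟩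
  have hz : 0 < 1 + ‖z‖ := by positivity
  set d := c / (1 + ‖z‖) with hd
  have hd0 : 0 < d := by positivity
  have hdc : d ≤ c := div_le_self hc0.le (by linarith [norm_nonneg z])
  refine ⟨d, hd0, by linarith, ?_⟩
  have hsize : h.size z (2 * d) ≤ 1 / 4 := by
    refine (h.size_le z (by positivity)).trans ?_
    have h1 : h.size 0 (2 * d) ≤ h.size 0 x₀ := h.size_mono 0 (by linarith)
    have h2 : ‖z‖ * d ≤ c := by
      rw [hd, mul_div_assoc', div_le_iff₀ hz]
      nlinarith [norm_nonneg z]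
    nlinarith
  have hsol : ∀ t ∈ Icc d (2 * d), 1 / 2 ≤ ‖h.sol 1 z t‖ := by
    intro t ht
    have ht0 : 0 ≤ t := hd0.le.trans ht.1
    have h1 := h.norm_op_sol_le 1 z ht0
    have h2 : h.size z t ≤ 1 / 4 := (h.size_mono z ht.2).trans hsize
    have h3 : Real.exp (h.size z t) ≤ 2 := by
      refine (Real.exp_le_exp.2 h2).trans ?_
      have := Real.exp_one_lt_d9
      have e : Real.exp (1 / 4) ^ 4 = Real.exp 1 := by rw [← Real.exp_nat_mul]; norm_num
      by_contra hcon
      push Not at hcon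
      have : (2:ℝ) ^ 4 ≤ Real.exp (1 / 4) ^ 4 := by gcongr
      rw [e] at this
      linarith
    have h4 : h.size z t * (‖(1 : ℝ →ᵇ ℂ)‖ * Real.exp (h.size z t)) ≤ 1 / 4 * (1 * 2) := by
      have := h.size_nonneg z t
      have h1 : ‖(1 : ℝ →ᵇ ℂ)‖ ≤ 1 := norm_one.le
      gcongr
    have h5 : h.sol 1 z t = 1 + (h.ker z).op (h.sol 1 z) t := h.sol_eq 1 z t
    have h6 := norm_sub_le (h.sol 1 z t) ((h.ker z).op (h.sol 1 z) t)
    have h7 : h.sol 1 z t - (h.ker z).op (h.sol 1 z) t = 1 := by rw [h5]; ring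
    rw [h7, norm_one] at h6
    linarith
  have hE : Real.exp (-(k * (1 + ‖z‖))) ≤ d := by
    have h1 : 1 + ‖z‖ ≤ Real.exp ‖z‖ := by linarith [Real.add_one_le_exp ‖z‖]
    have h2 : c = Real.exp (Real.log c) := (Real.exp_log hc0).symm
    calc Real.exp (-(k * (1 + ‖z‖))) ≤ Real.exp (Real.log c - ‖z‖) := by
          apply Real.exp_le_exp.2
          have := neg_abs_le (Real.log c)
          nlinarith [norm_nonneg z, abs_nonneg (Real.log c)]
      _ = c / Real.exp ‖z‖ := by rw [Real.exp_sub, ← h2]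
      _ ≤ d := by rw [hd]; gcongr
  have hl1 : 0 ≤ l + 1 := by linarith
  have hU : ∀ t ∈ Icc d (2 * d),
      Real.exp (-(2 * k * (l + 1) * (1 + ‖z‖))) / 4 ≤ ‖regU h z t‖ ^ 2 := by
    intro t ht
    have ht0 : 0 ≤ t := hd0.le.trans ht.1
    have h1 : Real.exp (-(k * (1 + ‖z‖))) ^ (l + 1) ≤ t ^ (l + 1) :=
      Real.rpow_le_rpow (Real.exp_nonneg _) (hE.trans ht.1) hl1
    rw [← Real.exp_mul] at h1
    rw [regU, norm_mul, Complex.norm_real, Real.norm_of_nonneg (Real.rpow_nonneg ht0 _)]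
    have h2 := mul_le_mul h1 (hsol t ht) (by norm_num) (Real.rpow_nonneg ht0 _)
    have h3 := pow_le_pow_left₀ (by positivity) h2 2
    refine le_trans (le_of_eq ?_) h3
    rw [mul_pow, ← Real.exp_nat_mul]
    ring_nf
  have hs := slSol_reg h z hd0 (by linarith)
  have hcont : ContinuousOn (fun t => ‖regU h z t‖ ^ 2) (Icc d 1) :=
    hs.fst.continuousOn.norm.pow 2
  have hi : ∀ u v, u ∈ Icc d 1 → v ∈ Icc d 1 →
      IntervalIntegrable (fun t => ‖regU h z t‖ ^ 2) volume u v := fun u v hu hv =>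
    (hcont.mono (uIcc_subset_Icc hu hv)).intervalIntegrable
  have m1 : d ∈ Icc d 1 := ⟨le_rfl, by linarith⟩
  have m2 : 2 * d ∈ Icc d 1 := ⟨by linarith, by linarith⟩
  have m3 : (1:ℝ) ∈ Icc d 1 := ⟨by linarith, le_rfl⟩
  rw [← intervalIntegral.integral_add_adjacent_intervals (hi _ _ m1 m2) (hi _ _ m2 m3)]
  have h1 := intervalIntegral.integral_nonneg (μ := volume) m2.2
      (fun t (_ : t ∈ Icc (2 * d) 1) => sq_nonneg ‖regU h z t‖)
  have h2 := intervalIntegral.integral_mono_on m2.1 (by simp) (hi _ _ m1 m2) hU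
  rw [intervalIntegral.integral_const, smul_eq_mul] at h2
  have h3 : Real.exp (-(k * (1 + ‖z‖))) * (Real.exp (-(2 * k * (l + 1) * (1 + ‖z‖))) / 4) ≤
      (2 * d - d) * (Real.exp (-(2 * k * (l + 1) * (1 + ‖z‖))) / 4) := by
    gcongr
    linarith
  have h4 : Real.exp (-2) ≤ 1 / 4 := by
    rw [Real.exp_neg, inv_eq_one_div]
    have : (4:ℝ) ≤ Real.exp 2 := by
      have := Real.exp_one_gt_d9
      have e : Real.exp 2 = Real.exp 1 ^ 2 := by rw [← Real.exp_nat_mul]; norm_num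
      rw [e]; nlinarith
    gcongr
  have h5 : Real.exp (-((k + 2 * k * (l + 1) + 2) * (1 + ‖z‖))) ≤
      Real.exp (-(k * (1 + ‖z‖))) * (Real.exp (-(2 * k * (l + 1) * (1 + ‖z‖))) / 4) := by
    calc _ ≤ Real.exp (-(k * (1 + ‖z‖)) + -(2 * k * (l + 1) * (1 + ‖z‖)) + -2) := by
          apply Real.exp_le_exp.2
          nlinarith [norm_nonneg z]
      _ = Real.exp (-(k * (1 + ‖z‖))) * Real.exp (-(2 * k * (l + 1) * (1 + ‖z‖))) *
          Real.exp (-2) := by rw [Real.exp_add, Real.exp_add]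
      _ ≤ Real.exp (-(k * (1 + ‖z‖))) * Real.exp (-(2 * k * (l + 1) * (1 + ‖z‖))) * (1 / 4) := by
          gcongr
      _ = _ := by ring
  linarith

theorem im_charF_le (h : WPot (2 * l + 2) q) (γ : Option ℝ) (z : ℂ) :
    |(regV h z 1 * conj (regU h z 1)).im| ≤
      ‖charF h γ z‖ * (‖regU h z 1‖ + ‖regV h z 1‖) := by
  cases γ with
  | none =>
    refine (Complex.abs_im_le_norm _).trans ?_
    rw [norm_mul, RCLike.norm_conj]
    simp only [charF]
    nlinarith [norm_nonneg (regU h z 1), norm_nonneg (regV h z 1), sq_nonneg ‖regU h z 1‖]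
  | some γ =>
    have e : (regV h z 1 * conj (regU h z 1)).im =
        ((regV h z 1 + (γ : ℂ) * regU h z 1) * conj (regU h z 1)).im := by
      have : (regV h z 1 + (γ : ℂ) * regU h z 1) * conj (regU h z 1) =
          regV h z 1 * conj (regU h z 1) + ((γ * Complex.normSq (regU h z 1) : ℝ) : ℂ) := by
        push_cast
        rw [← Complex.mul_conj]
        ring
      rw [this, Complex.add_im, Complex.ofReal_im, add_zero]
    rw [e]
    refine (Complex.abs_im_le_norm _).trans ?_
    rw [norm_mul, RCLike.norm_conj]
    refine mul_le_mul_of_nonneg_left ?_ (norm_nonneg _)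
    linarith [norm_nonneg (regV h z 1)]

theorem exists_lower_bound_charF (h : WPot (2 * l + 2) q) (hl : -(1:ℝ) / 2 ≤ l) (γ : Option ℝ) :
    ∃ C : ℝ, ∀ z, |z.im| * Real.exp (-(C * (1 + ‖z‖))) ≤ ‖charF h γ z‖ := by
  obtain ⟨C₁, hC₁⟩ := exists_growth_bound h
  obtain ⟨C₂, hC₂⟩ := exists_lower_bound_integral h hl
  refine ⟨C₂ + C₁ + 1, fun z => ?_⟩
  rcases eq_or_ne z.im 0 with hz | hz
  · rw [hz]; simp
  obtain ⟨a, ha, ha1, hI⟩ := hC₂ z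
  have h1 := im_reg_bound h z ha ha1 le_rfl
  have h2 := im_charF_le h γ z
  have h3 : |z.im| * (∫ t in a..1, ‖regU h z t‖ ^ 2) ≤ |(regV h z 1 * conj (regU h z 1)).im| := by
    have hz' : 0 < |z.im| := abs_pos.2 hz
    refine le_of_mul_le_mul_left ?_ hz'
    rw [← mul_assoc, ← sq, sq_abs, ← abs_mul]
    exact h1.trans (neg_le_abs _)
  have h4 : |z.im| * Real.exp (-(C₂ * (1 + ‖z‖))) ≤
      ‖charF h γ z‖ * (2 * Real.exp (C₁ * (1 + ‖z‖))) := by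
    calc _ ≤ |z.im| * (∫ t in a..1, ‖regU h z t‖ ^ 2) := by gcongr
      _ ≤ _ := h3.trans (h2.trans (by gcongr; linarith [(hC₁ z).1, (hC₁ z).2]))
  have h5 : 2 * Real.exp (C₁ * (1 + ‖z‖)) ≤ Real.exp ((C₁ + 1) * (1 + ‖z‖)) := by
    rw [add_mul, Real.exp_add, mul_comm]
    gcongr
    have := Real.add_one_le_exp (1 * (1 + ‖z‖))
    linarith [norm_nonneg z]
  have h6 : |z.im| * Real.exp (-(C₂ * (1 + ‖z‖))) ≤
      ‖charF h γ z‖ * Real.exp ((C₁ + 1) * (1 + ‖z‖)) := h4.trans (by gcongr)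
  have h7 : Real.exp (-((C₂ + C₁ + 1) * (1 + ‖z‖))) =
      Real.exp (-(C₂ * (1 + ‖z‖))) / Real.exp ((C₁ + 1) * (1 + ‖z‖)) := by
    rw [← Real.exp_sub]; ring_nf
  rw [h7, mul_div_assoc', div_le_iff₀ (Real.exp_pos _)]
  exact h6

end CharFun

/-- Entire functions of exponential growth with only real zeros, bounded below in terms of
the distance to the real axis. -/
structure RealZeroType (F : ℂ → ℂ) : Prop where
  diff : Differentiable ℂ F
  upper : ∃ C : ℝ, ∀ z, ‖F z‖ ≤ Real.exp (C * (1 + ‖z‖))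
  lower : ∃ C : ℝ, ∀ z, |z.im| * Real.exp (-(C * (1 + ‖z‖))) ≤ ‖F z‖

namespace RealZeroType

variable {F G : ℂ → ℂ}

theorem ne_zero (hF : RealZeroType F) {z : ℂ} (hz : z.im ≠ 0) : F z ≠ 0 := by
  obtain ⟨C, hC⟩ := hF.lower
  intro h0
  have := hC z
  rw [h0, norm_zero] at this
  have h1 : 0 < |z.im| * Real.exp (-(C * (1 + ‖z‖))) :=
    mul_pos (abs_pos.2 hz) (Real.exp_pos _)
  linarith

theorem deriv_ne_zero (hF : RealZeroType F) {a : ℂ} (ha : F a = 0) : deriv F a ≠ 0 := by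
  obtain ⟨C, hC⟩ := hF.lower
  have him : a.im = 0 := by
    by_contra h
    exact hF.ne_zero h ha
  have hs : Tendsto (fun z => ‖slope F a z‖) (𝓝[≠] a) (𝓝 ‖deriv F a‖) :=
    (hasDerivAt_iff_tendsto_slope.1 (hF.diff a).hasDerivAt).norm
  have hpath : Tendsto (fun ε : ℝ => a + ε * Complex.I) (𝓝[>] 0) (𝓝[≠] a) := by
    refine tendsto_nhdsWithin_iff.2 ⟨?_, ?_⟩
    · have : Continuous fun ε : ℝ => a + ε * Complex.I := by fun_prop
      have h := this.tendsto 0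
      simp only [Complex.ofReal_zero, zero_mul, add_zero] at h
      exact h.mono_left nhdsWithin_le_nhds
    · filter_upwards [self_mem_nhdsWithin] with ε hε
      have : ε ≠ 0 := (Set.mem_Ioi.1 hε).ne'
      simp [this]
  have hlow : Tendsto (fun ε : ℝ => Real.exp (-(C * (1 + ‖a + ε * Complex.I‖)))) (𝓝[>] 0)
      (𝓝 (Real.exp (-(C * (1 + ‖a‖))))) := by
    have : Continuous fun ε : ℝ => Real.exp (-(C * (1 + ‖a + ε * Complex.I‖))) := by fun_prop
    have h := this.tendsto 0
    simp only [Complex.ofReal_zero, zero_mul, add_zero] at h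
    exact h.mono_left nhdsWithin_le_nhds
  have hle : Real.exp (-(C * (1 + ‖a‖))) ≤ ‖deriv F a‖ := by
    refine le_of_tendsto_of_tendsto hlow (hs.comp hpath) ?_
    filter_upwards [self_mem_nhdsWithin] with ε hε
    have hε : 0 < ε := hε
    have h1 := hC (a + ε * Complex.I)
    simp only [Complex.add_im, him, Complex.mul_im, Complex.ofReal_re, Complex.I_im, mul_one,
      Complex.ofReal_im, Complex.I_re, mul_zero, add_zero, zero_add, abs_of_pos hε] at h1
    simp only [Function.comp, slope_def_field, ha, sub_zero, add_sub_cancel_left, norm_div,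
      norm_mul, Complex.norm_real, Complex.norm_I, mul_one, Real.norm_of_nonneg hε.le]
    rw [le_div_iff₀ hε, mul_comm]
    exact h1
  intro h0
  rw [h0, norm_zero] at hle
  exact absurd hle (not_le.2 (Real.exp_pos _))

theorem exists_quotient (hF : RealZeroType F) (hG : RealZeroType G)
    (h0 : ∀ z, F z = 0 ↔ G z = 0) : ∃ h : ℂ → ℂ, Differentiable ℂ h ∧
      (∃ B : ℝ, ∀ z, ‖h z‖ ≤ Real.exp (B * (1 + ‖z‖))) ∧ ∀ z, F z = h z * G z := by
  set h : ℂ → ℂ := fun z => if G z = 0 then deriv F z / deriv G z else F z / G z with hh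
  have hmul : ∀ z, F z = h z * G z := by
    intro z
    by_cases hz : G z = 0
    · rw [hz, mul_zero, (h0 z).2 hz]
    · simp [hh, hz]
  have hd : Differentiable ℂ h := by
    intro a
    by_cases ha : G a = 0
    · have hFa := (h0 a).2 ha
      have hdF : DifferentiableAt ℂ (dslope F a) a :=
        ((Complex.differentiableOn_dslope univ_mem).2 hF.diff.differentiableOn).differentiableAt
          univ_mem
      have hdG : DifferentiableAt ℂ (dslope G a) a :=
        ((Complex.differentiableOn_dslope univ_mem).2 hG.diff.differentiableOn).differentiableAt
          univ_mem
      have hG1 : dslope G a a ≠ 0 := by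
        rw [dslope_same]
        exact hG.deriv_ne_zero ha
      refine (hdF.div hdG hG1).congr_of_eventuallyEq ?_
      filter_upwards [hdG.continuousAt.eventually_ne hG1] with z hz
      by_cases hza : z = a
      · simp [hh, hza, ha]
      · have hza' : z - a ≠ 0 := sub_ne_zero.2 hza
        rw [dslope_of_ne _ hza, slope_def_field, ha, sub_zero] at hz
        have hGz : G z ≠ 0 := fun h => hz (by simp [h])
        simp only [hh, hGz, if_false, Pi.div_apply, dslope_of_ne _ hza, slope_def_field, ha, hFa,
          sub_zero]
        field_simp
    · refine ((hF.diff a).div (hG.diff a) ha).congr_of_eventuallyEq ?_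
      filter_upwards [(hG.diff a).continuousAt.eventually_ne ha] with z hz
      simp [hh, hz]
  refine ⟨h, hd, ?_, hmul⟩
  obtain ⟨C₁, hC₁⟩ := hF.upper
  obtain ⟨C₂, hC₂⟩ := hG.lower
  set C := |C₁ + C₂| with hCdef
  have hC0 : 0 ≤ C := abs_nonneg _
  refine ⟨2 * C + 1, fun z => ?_⟩
  set R := ‖z‖ + 1 with hR
  have hz0 := norm_nonneg z
  have hR0 : 0 < R := by positivity
  have key : ‖(z ^ 2 - (R:ℂ) ^ 2) * h z‖ ≤ 2 * R * Real.exp (C * (1 + R)) := by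
    have hcl : z ∈ closure (Metric.ball (0:ℂ) R) := subset_closure (by simp [hR])
    refine Complex.norm_le_of_forall_mem_frontier_norm_le (U := Metric.ball (0:ℂ) R)
      (f := fun w => (w ^ 2 - (R:ℂ) ^ 2) * h w) Metric.isBounded_ball ?_ ?_ hcl
    · refine Differentiable.diffContOnCl ?_
      fun_prop
    · intro w hw
      rw [frontier_ball _ hR0.ne', mem_sphere_zero_iff_norm] at hw
      have hsq : w ^ 2 - (R:ℂ) ^ 2 = 2 * Complex.I * w.im * w := by
        have h1 : (R:ℂ) ^ 2 = w * conj w := by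
          rw [Complex.mul_conj, Complex.normSq_eq_norm_sq, hw]; push_cast; rfl
        have h2 : w - conj w = 2 * Complex.I * w.im := by
          apply Complex.ext <;> simp
          ring
        rw [h1, ← h2]; ring
      by_cases him : w.im = 0
      · rw [hsq, him]; simp; positivity
      · have hGw := hG.ne_zero him
        have h3 : ‖h w‖ * (|w.im| * Real.exp (-(C₂ * (1 + ‖w‖)))) ≤
            Real.exp (C₁ * (1 + ‖w‖)) := by
          refine (mul_le_mul_of_nonneg_left (hC₂ w) (norm_nonneg _)).trans ?_
          rw [← norm_mul, ← hmul]
          exact hC₁ w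
        rw [hsq, norm_mul, norm_mul, norm_mul, norm_mul, hw]
        simp only [Complex.norm_ofNat, Complex.norm_I, mul_one, Complex.norm_real,
          Real.norm_eq_abs]
        have h4 : ‖h w‖ * |w.im| ≤ Real.exp (C * (1 + R)) := by
          have h5 : ‖h w‖ * |w.im| ≤ Real.exp (C₁ * (1 + R)) * Real.exp (C₂ * (1 + R)) := by
            rw [hw] at h3
            have := mul_le_mul_of_nonneg_right h3 (Real.exp_nonneg (C₂ * (1 + R)))
            refine le_trans (le_of_eq ?_) this
            rw [mul_assoc, mul_assoc, ← Real.exp_add]; simp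
          refine h5.trans ?_
          rw [← Real.exp_add, ← add_mul]
          exact Real.exp_le_exp.2 (mul_le_mul_of_nonneg_right (le_abs_self _) (by linarith))
        calc 2 * |w.im| * R * ‖h w‖ = 2 * R * (‖h w‖ * |w.im|) := by ring
          _ ≤ _ := mul_le_mul_of_nonneg_left h4 (by positivity)
  have hlow : R ≤ ‖z ^ 2 - (R:ℂ) ^ 2‖ := by
    have h1 := norm_sub_norm_le ((R:ℂ) ^ 2) (z ^ 2)
    rw [norm_sub_rev, norm_pow, norm_pow, Complex.norm_real, Real.norm_of_nonneg hR0.le] at h1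
    nlinarith
  rw [norm_mul] at key
  have h2 : R * ‖h z‖ ≤ R * (2 * Real.exp (C * (1 + R))) :=
    (mul_le_mul_of_nonneg_right hlow (norm_nonneg _)).trans (key.trans (le_of_eq (by ring)))
  have h3 := le_of_mul_le_mul_left h2 hR0
  refine h3.trans ?_
  have h4 : (2:ℝ) ≤ Real.exp 1 := by linarith [Real.add_one_le_exp (1:ℝ)]
  calc 2 * Real.exp (C * (1 + R)) ≤ Real.exp 1 * Real.exp (C * (1 + R)) :=
        mul_le_mul_of_nonneg_right h4 (Real.exp_nonneg _)
    _ = Real.exp (1 + C * (1 + R)) := (Real.exp_add _ _).symm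
    _ ≤ _ := Real.exp_le_exp.2 (by rw [hR]; nlinarith [mul_nonneg hC0 hz0])

theorem eq_of_eqOn_nonreal {f g : ℂ → ℂ} (hf : Continuous f) (hg : Continuous g)
    (h : ∀ z : ℂ, z.im ≠ 0 → f z = g z) (z : ℂ) : f z = g z := by
  have hd : Dense {z : ℂ | z.im ≠ 0} := by
    have := (dense_compl_singleton (0:ℝ)).preimage Complex.isOpenMap_im
    exact this
  exact congrFun (hf.ext_on hd hg fun z hz => h z hz) z

theorem exists_unit_quotient (hF : RealZeroType F) (hG : RealZeroType G)
    (h0 : ∀ z, F z = 0 ↔ G z = 0) : ∃ h h' : ℂ → ℂ, Differentiable ℂ h ∧ Differentiable ℂ h' ∧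
      (∃ B : ℝ, ∀ z, ‖h z‖ ≤ Real.exp (B * (1 + ‖z‖))) ∧
      (∃ B : ℝ, ∀ z, ‖h' z‖ ≤ Real.exp (B * (1 + ‖z‖))) ∧ (∀ z, h z * h' z = 1) ∧
      ∀ z, F z = h z * G z := by
  obtain ⟨h, h1, h2, h3⟩ := hF.exists_quotient hG h0
  obtain ⟨h', h1', h2', h3'⟩ := hG.exists_quotient hF fun z => (h0 z).symm
  refine ⟨h, h', h1, h1', h2, h2', fun z => ?_, h3⟩
  refine eq_of_eqOn_nonreal (f := fun z => h z * h' z) (g := fun _ => 1)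
    (h1.continuous.mul h1'.continuous) continuous_const (fun z hz => ?_) z
  have := hF.ne_zero hz
  have e := h3 z
  rw [h3' z, ← mul_assoc] at e
  exact mul_right_cancel₀ this (by rw [← e, one_mul])

theorem id_mul (hF : RealZeroType F) (h0 : F 0 ≠ 0) : RealZeroType fun z => z * F z := by
  refine ⟨differentiable_id.mul hF.diff, ?_, ?_⟩
  · obtain ⟨C, hC⟩ := hF.upper
    refine ⟨1 + C, fun z => ?_⟩
    rw [norm_mul, add_mul, Real.exp_add, one_mul]
    refine mul_le_mul ?_ (hC z) (norm_nonneg _) (Real.exp_nonneg _)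
    linarith [Real.add_one_le_exp (1 + ‖z‖)]
  · obtain ⟨C, hC⟩ := hF.lower
    have hc : ∀ᶠ z in 𝓝 (0:ℂ), ‖F 0‖ / 2 < ‖F z‖ :=
      hF.diff.continuous.norm.continuousAt.eventually_const_lt
        (by have := norm_pos_iff.2 h0; linarith)
    obtain ⟨δ, hδ, hδ'⟩ := Metric.eventually_nhds_iff.1 hc
    set c := min (min (‖F 0‖ / 2) δ) 1 with hcdef
    have hc0 : 0 < c := lt_min (lt_min (by have := norm_pos_iff.2 h0; linarith) hδ) one_pos
    have hcc : c = Real.exp (-(-Real.log c)) := by rw [neg_neg, Real.exp_log hc0]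
    have hlog : 0 ≤ -Real.log c := neg_nonneg.2 (Real.log_nonpos hc0.le (min_le_right _ _))
    set D := -Real.log c + |C| with hD
    refine ⟨D, fun z => ?_⟩
    have hz0 := norm_nonneg z
    have hbig : Real.exp (-(D * (1 + ‖z‖))) ≤ c * Real.exp (-(C * (1 + ‖z‖))) := by
      rw [hcc, ← Real.exp_add]
      refine Real.exp_le_exp.2 ?_
      rw [hD]
      nlinarith [le_abs_self C, mul_nonneg hlog hz0, abs_nonneg C]
    have hbig2 : Real.exp (-(D * (1 + ‖z‖))) ≤ c := by
      rw [hcc]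
      refine Real.exp_le_exp.2 ?_
      rw [hD]
      nlinarith [abs_nonneg C, mul_nonneg hlog hz0, mul_nonneg (abs_nonneg C) hz0]
    rw [norm_mul]
    by_cases hz : ‖z‖ < δ
    · have h1 := hδ' (show dist z 0 < δ by simpa using hz)
      refine mul_le_mul (Complex.abs_im_le_norm z) ?_ (Real.exp_nonneg _) (norm_nonneg _)
      exact hbig2.trans (((min_le_left _ _).trans (min_le_left _ _)).trans h1.le)
    · have h1 : c ≤ ‖z‖ := ((min_le_left _ _).trans (min_le_right _ _)).trans (not_lt.1 hz)
      calc |z.im| * Real.exp (-(D * (1 + ‖z‖)))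
          ≤ |z.im| * (c * Real.exp (-(C * (1 + ‖z‖)))) :=
            mul_le_mul_of_nonneg_left hbig (abs_nonneg _)
        _ = c * (|z.im| * Real.exp (-(C * (1 + ‖z‖)))) := by ring
        _ ≤ ‖z‖ * ‖F z‖ := mul_le_mul h1 (hC z) (by positivity) hz0

theorem exists_pow_mul (hF : RealZeroType F) : ∃ e : ℕ,
    RealZeroType (fun z => z ^ e * F z) ∧ (0:ℂ) ^ e * F 0 = 0 := by
  by_cases h0 : F 0 = 0
  · exact ⟨0, by simpa using hF, by simp [h0]⟩
  · exact ⟨1, by simpa using hF.id_mul h0, by simp⟩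

/-- Functions with the same nonzero zeros differ by a unit and a power of `z`. -/
theorem exists_unit_quotient_pow (hF : RealZeroType F) (hG : RealZeroType G)
    (h0 : ∀ z, z ≠ 0 → (F z = 0 ↔ G z = 0)) : ∃ (a b : ℕ) (h h' : ℂ → ℂ),
      Differentiable ℂ h ∧ Differentiable ℂ h' ∧
      (∃ B : ℝ, ∀ z, ‖h z‖ ≤ Real.exp (B * (1 + ‖z‖))) ∧
      (∃ B : ℝ, ∀ z, ‖h' z‖ ≤ Real.exp (B * (1 + ‖z‖))) ∧ (∀ z, h z * h' z = 1) ∧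
      ∀ z, z ^ a * F z = h z * (z ^ b * G z) := by
  obtain ⟨a, ha, ha0⟩ := hF.exists_pow_mul
  obtain ⟨b, hb, hb0⟩ := hG.exists_pow_mul
  obtain ⟨h, h', H⟩ := ha.exists_unit_quotient hb fun z => by
    rcases eq_or_ne z 0 with rfl | hz
    · rw [ha0, hb0]
    · simp [hz, h0 z hz]
  exact ⟨a, b, h, h', H⟩

end RealZeroType

theorem tendsto_sector_pow_const {c : ℂ} {k : ℕ}
    (h : Tendsto (fun z => c * z ^ k) sectorFilter (𝓝 1)) : k = 0 ∧ c = 1 := by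
  by_cases hk : k = 0
  · subst hk
    refine ⟨rfl, ?_⟩
    simp only [pow_zero, mul_one] at h
    exact tendsto_nhds_unique tendsto_const_nhds h
  · exfalso
    have h1 : Tendsto (fun z : ℂ => ‖c * z ^ k‖) sectorFilter (𝓝 1) := by simpa using h.norm
    by_cases hc : c = 0
    · simp only [hc, zero_mul, norm_zero] at h1
      exact zero_ne_one (tendsto_nhds_unique tendsto_const_nhds h1)
    · have h2 : Tendsto (fun z : ℂ => ‖c‖ * ‖z‖ ^ k) sectorFilter atTop :=
        ((tendsto_pow_atTop hk).comp tendsto_norm_sectorFilter).const_mul_atTop (norm_pos_iff.2 hc)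
      refine not_tendsto_nhds_of_tendsto_atTop h2 1 (h1.congr fun z => ?_)
      simp

theorem eq_one_of_tendsto_sector {f : ℂ → ℂ} (hf : Differentiable ℂ f) {B : ℝ}
    (hB : ∀ z, ‖f z‖ ≤ Real.exp (B * (1 + ‖z‖))) {k : ℕ}
    (h : Tendsto (fun z => f z * z ^ k) sectorFilter (𝓝 1)) : k = 0 ∧ ∀ z, f z = 1 := by
  obtain ⟨c, hc⟩ := eq_const_of_bounded_sector hf hB (C := 2) (by
    have h1 : Tendsto (fun z => ‖f z * z ^ k‖) sectorFilter (𝓝 1) := by simpa using h.norm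
    filter_upwards [h1.eventually_le_const (u := 2) (by norm_num),
      tendsto_norm_sectorFilter.eventually_ge_atTop 1] with z h2 h3
    refine le_trans ?_ h2
    rw [norm_mul, norm_pow]
    exact le_mul_of_one_le_right (norm_nonneg _) (one_le_pow₀ h3))
  simp_rw [hc] at h
  obtain ⟨h1, h2⟩ := tendsto_sector_pow_const h
  exact ⟨h1, fun z => (hc z).trans h2⟩

theorem mul_exp_bound {f g : ℂ → ℂ} (hf : ∃ B : ℝ, ∀ z, ‖f z‖ ≤ Real.exp (B * (1 + ‖z‖)))
    (hg : ∃ B : ℝ, ∀ z, ‖g z‖ ≤ Real.exp (B * (1 + ‖z‖))) :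
    ∃ B : ℝ, ∀ z, ‖f z * g z‖ ≤ Real.exp (B * (1 + ‖z‖)) := by
  obtain ⟨B, hB⟩ := hf
  obtain ⟨B', hB'⟩ := hg
  refine ⟨B + B', fun z => ?_⟩
  rw [norm_mul, add_mul, Real.exp_add]
  exact mul_le_mul (hB z) (hB' z) (norm_nonneg _) (Real.exp_nonneg _)

/-- Two pairs of functions with pairwise equal nonzero zeros and asymptotically equal
quotients have equal quotients. -/
theorem RealZeroType.mul_eq_mul {F₁ F₂ G₁ G₂ : ℂ → ℂ} (hF₁ : RealZeroType F₁)
    (hF₂ : RealZeroType F₂) (hG₁ : RealZeroType G₁) (hG₂ : RealZeroType G₂)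
    (h₁ : ∀ z, z ≠ 0 → (F₁ z = 0 ↔ G₁ z = 0)) (h₂ : ∀ z, z ≠ 0 → (F₂ z = 0 ↔ G₂ z = 0))
    (hlim : Tendsto (fun z => F₁ z * G₂ z / (G₁ z * F₂ z)) sectorFilter (𝓝 1)) {z : ℂ}
    (hz : z.im ≠ 0) : F₁ z * G₂ z = G₁ z * F₂ z := by
  obtain ⟨a, b, u, u', hu, hu', hbu, hbu', huu, hq⟩ := hF₁.exists_unit_quotient_pow hG₁ h₁
  obtain ⟨c, d, w, w', hw, hw', hbw, hbw', hww, hr⟩ := hF₂.exists_unit_quotient_pow hG₂ h₂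
  have hne : ∀ z : ℂ, z.im ≠ 0 → z ≠ 0 := fun z hz h => hz (by simp [h])
  have key : ∀ z : ℂ, z.im ≠ 0 → F₁ z * G₂ z / (G₁ z * F₂ z) * z ^ (a + d) =
      (u z * w' z) * z ^ (b + c) := by
    intro z hz
    have h1 := hG₁.ne_zero hz
    have h2 := hF₂.ne_zero hz
    rw [div_mul_eq_mul_div, div_eq_iff (mul_ne_zero h1 h2)]
    linear_combination z ^ d * G₂ z * hq z -
      u z * z ^ b * G₁ z * w' z * hr z - u z * z ^ b * G₁ z * z ^ d * G₂ z * hww z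
  have hfin : a + d = b + c ∧ ∀ z, u z * w' z = 1 := by
    have hH := mul_exp_bound hbu hbw'
    have hH' := mul_exp_bound hbu' hbw
    rcases le_total (a + d) (b + c) with hle | hle
    · obtain ⟨k, hk⟩ := Nat.exists_eq_add_of_le hle
      obtain ⟨B, hB⟩ := hH
      obtain ⟨h3, h4⟩ := eq_one_of_tendsto_sector (f := fun z => u z * w' z) (hu.mul hw') hB
        (k := k) (hlim.congr' (by
          filter_upwards [sectorFilter_im_ne_zero] with z hz
          have h5 := key z hz
          rw [hk, pow_add z (a + d) k, mul_comm (z ^ (a + d)) (z ^ k), ← mul_assoc] at h5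
          exact mul_right_cancel₀ (pow_ne_zero _ (hne z hz)) h5))
      exact ⟨by omega, h4⟩
    · obtain ⟨k, hk⟩ := Nat.exists_eq_add_of_le hle
      obtain ⟨B, hB⟩ := hH'
      have hlim' := hlim.inv₀ one_ne_zero
      rw [inv_one] at hlim'
      obtain ⟨h3, h4⟩ := eq_one_of_tendsto_sector (f := fun z => u' z * w z) (hu'.mul hw) hB
        (k := k) (hlim'.congr' (by
          filter_upwards [sectorFilter_im_ne_zero] with z hz
          have h5 := key z hz
          have hF1 := hF₁.ne_zero hz
          have hF2 := hF₂.ne_zero hz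
          have hG1 := hG₁.ne_zero hz
          have hG2 := hG₂.ne_zero hz
          rw [hk, pow_add z (b + c) k, mul_comm (z ^ (b + c)) (z ^ k), ← mul_assoc] at h5
          have h6 := mul_right_cancel₀ (pow_ne_zero _ (hne z hz)) h5
          refine inv_eq_of_mul_eq_one_right ?_
          calc F₁ z * G₂ z / (G₁ z * F₂ z) * (u' z * w z * z ^ k)
              = (F₁ z * G₂ z / (G₁ z * F₂ z) * z ^ k) * (u' z * w z) := by ring
            _ = (u z * u' z) * (w z * w' z) := by rw [h6]; ring
            _ = 1 := by rw [huu, hww, one_mul]))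
      refine ⟨by omega, fun z => ?_⟩
      calc u z * w' z = (u z * w' z) * (u' z * w z) := by rw [h4, mul_one]
        _ = (u z * u' z) * (w z * w' z) := by ring
        _ = 1 := by rw [huu, hww, one_mul]
  have h5 := key z hz
  rw [hfin.2, hfin.1] at h5
  have h6 := mul_right_cancel₀ (pow_ne_zero _ (hne z hz)) h5
  exact (div_eq_one_iff_eq (mul_ne_zero (hG₁.ne_zero hz) (hF₂.ne_zero hz))).1 h6

/-- The sine solution has no zero in `(0, T]` for nonreal `z`. -/
theorem SLSol.sine_ne_zero {Q : ℝ → ℝ} {z : ℂ} {c c' s s' : ℝ → ℂ} {T : ℝ}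
    (hc : SLSol Q z c c' 0 T) (hs : SLSol Q z s s' 0 T) (hc0 : c 0 = 1)
    (hs0 : s 0 = 0) (hs0' : s' 0 = 1) (hz : z.im ≠ 0) {t : ℝ} (ht : t ∈ Ioc 0 T) : s t ≠ 0 := by
  intro h0
  have hen := hs.energy_eq (x := 0) (y := t) ⟨le_rfl, hs.fst.le⟩ ⟨ht.1.le, ht.2⟩
  rw [h0, hs0] at hen
  simp only [map_zero, mul_zero, Complex.zero_im, sub_zero] at hen
  have hInt : ∫ x in (0:ℝ)..t, ‖s x‖ ^ 2 = 0 := by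
    rcases mul_eq_zero.1 (neg_eq_zero.1 hen.symm) with h | h
    · exact absurd h hz
    · exact h
  have hcont : ContinuousOn s (Icc 0 t) :=
    hs.fst.continuousOn.mono (Icc_subset_Icc_right ht.2)
  have hzero : ∀ x ∈ Icc 0 t, s x = 0 := by
    by_contra hne
    push Not at hne
    obtain ⟨x, hx, hx0⟩ := hne
    exact (intervalIntegral.integral_pos ht.1 (hcont.norm.pow 2)
      (fun y _ => sq_nonneg ‖s y‖) ⟨x, hx, pow_pos (norm_pos_iff.2 hx0) 2⟩).ne' hInt
  have h1 : IsPrim s (fun _ => 0) 0 t :=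
    (IsPrim.const ht.1.le 0).congr fun x hx => (hzero x hx).symm
  have h2 := (hs.fst.mono le_rfl ht.1.le ht.2).ae_eq_deriv h1
  obtain ⟨x, hx, hxI⟩ : ∃ x, (x ∈ Ioo 0 t → s' x = 0) ∧ x ∈ Ioo 0 t := by
    by_contra hcon
    push Not at hcon
    have h3 : ∀ᵐ x, x ∉ Ioo 0 t := by
      filter_upwards [h2] with x hx
      exact hcon x hx
    have h4 : volume (Ioo 0 t) = 0 := by
      rw [ae_iff] at h3
      simp only [not_not] at h3
      exact h3
    rw [Real.volume_Ioo] at h4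
    simp at h4
    linarith [ht.1]
  have hw := hc.wronskian_eq hs (x := x) ⟨hxI.1.le, hxI.2.le.trans ht.2⟩
  rw [hx hxI, hzero x (Ioo_subset_Icc_self hxI), hc0, hs0, hs0'] at hw
  simp at hw

theorem weyl_cross_eq_zero {Q Qh : ℝ → ℝ} {T : ℝ} (hT : 0 < T)
    (hQ : IntervalIntegrable Q volume 0 T) (hQh : IntervalIntegrable Qh volume 0 T)
    {u v uh vh : ℂ → ℝ → ℂ}
    (hu : ∀ z : ℂ, z.im ≠ 0 → SLSol Q z (u z) (v z) 0 T ∧ u z 0 = 1 ∧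
      0 ≤ z.im * (v z T * conj (u z T)).im)
    (huh : ∀ z : ℂ, z.im ≠ 0 → SLSol Qh z (uh z) (vh z) 0 T ∧ uh z 0 = 1 ∧
      0 ≤ z.im * (vh z T * conj (uh z T)).im)
    (hm : ∀ z : ℂ, z.im ≠ 0 → v z 0 = vh z 0)
    {c c' s s' ch ch' sh sh' : ℂ → ℝ → ℂ} {B Bh : ℝ}
    (hc : ∀ z, SLSol Q z (c z) (c' z) 0 T ∧ c z 0 = 1 ∧ c' z 0 = 0)
    (hs : ∀ z, SLSol Q z (s z) (s' z) 0 T ∧ s z 0 = 0 ∧ s' z 0 = 1)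
    (hch : ∀ z, SLSol Qh z (ch z) (ch' z) 0 T ∧ ch z 0 = 1 ∧ ch' z 0 = 0)
    (hsh : ∀ z, SLSol Qh z (sh z) (sh' z) 0 T ∧ sh z 0 = 0 ∧ sh' z 0 = 1)
    (bc : ∀ z, Differentiable ℂ (fun z => c z T) ∧ ‖c z T‖ ≤ Real.exp (B * (1 + ‖z‖)))
    (bs : ∀ z, Differentiable ℂ (fun z => s z T) ∧ ‖s z T‖ ≤ Real.exp (B * (1 + ‖z‖)))
    (bch : ∀ z, Differentiable ℂ (fun z => ch z T) ∧ ‖ch z T‖ ≤ Real.exp (Bh * (1 + ‖z‖)))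
    (bsh : ∀ z, Differentiable ℂ (fun z => sh z T) ∧ ‖sh z T‖ ≤ Real.exp (Bh * (1 + ‖z‖)))
    (z : ℂ) : c z T * sh z T - ch z T * s z T = 0 := by
  have hTT : T ∈ Icc 0 T := ⟨hT.le, le_rfl⟩
  obtain ⟨S1, S2⟩ := SLSol.tendsto_sine hT hQ (fun z => (hs z).1) (fun z => (hs z).2.1)
    (fun z => (hs z).2.2)
  obtain ⟨Sh1, Sh2⟩ := SLSol.tendsto_sine hT hQh (fun z => (hsh z).1) (fun z => (hsh z).2.1)
    (fun z => (hsh z).2.2)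
  have L1 := tendsto_weyl_mul (U := fun z => u z T) (S := fun z => s z T) (S' := fun z => s' z T)
    (Sh := fun z => sh z T) (by
      filter_upwards [sectorFilter_im_ne_zero] with z hz
      exact SLSol.weyl_bound hT.le (hu z hz).1 (hs z).1 (hu z hz).2.1 (hs z).2.1 (hs z).2.2
        (hu z hz).2.2) S1 S2 Sh1
  have L2 := tendsto_weyl_mul (U := fun z => uh z T) (S := fun z => sh z T)
    (S' := fun z => sh' z T) (Sh := fun z => s z T) (by
      filter_upwards [sectorFilter_im_ne_zero] with z hz
      exact SLSol.weyl_bound hT.le (huh z hz).1 (hsh z).1 (huh z hz).2.1 (hsh z).2.1 (hsh z).2.2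
        (huh z hz).2.2) Sh1 Sh2 S1
  have L : Tendsto (fun z => c z T * sh z T - ch z T * s z T) sectorFilter (𝓝 0) := by
    have := L1.sub L2
    rw [sub_zero] at this
    refine this.congr' ?_
    filter_upwards [sectorFilter_im_ne_zero] with z hz
    have e1 := ((hu z hz).1.eq_combination (hc z).1 (hs z).1 (hc z).2.1 (hc z).2.2 (hs z).2.1
      (hs z).2.2 hTT).1
    have e2 := ((huh z hz).1.eq_combination (hch z).1 (hsh z).1 (hch z).2.1 (hch z).2.2
      (hsh z).2.1 (hsh z).2.2 hTT).1
    rw [(hu z hz).2.1] at e1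
    rw [(huh z hz).2.1, ← hm z hz] at e2
    rw [e1, e2]
    ring
  have hbound : ∃ B' : ℝ, ∀ z, ‖c z T * sh z T - ch z T * s z T‖ ≤
      Real.exp (B' * (1 + ‖z‖)) := by
    refine ⟨B + Bh + 1, fun z => ?_⟩
    have h0 := norm_nonneg z
    have h1 : ‖c z T * sh z T‖ ≤ Real.exp ((B + Bh) * (1 + ‖z‖)) := by
      rw [norm_mul, add_mul, Real.exp_add]
      exact mul_le_mul (bc z).2 (bsh z).2 (norm_nonneg _) (Real.exp_nonneg _)
    have h2 : ‖ch z T * s z T‖ ≤ Real.exp ((B + Bh) * (1 + ‖z‖)) := by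
      rw [norm_mul, add_comm B, add_mul, Real.exp_add]
      exact mul_le_mul (bch z).2 (bs z).2 (norm_nonneg _) (Real.exp_nonneg _)
    have h3 : (2:ℝ) ≤ Real.exp (1 * (1 + ‖z‖)) := by
      linarith [Real.add_one_le_exp (1 * (1 + ‖z‖))]
    rw [add_mul _ 1, Real.exp_add]
    refine (norm_sub_le _ _).trans ?_
    nlinarith [Real.exp_pos ((B + Bh) * (1 + ‖z‖))]
  obtain ⟨B', hB'⟩ := hbound
  obtain ⟨k, hk⟩ := eq_const_of_bounded_sector
    (f := fun z => c z T * sh z T - ch z T * s z T)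
    (((bc 0).1.mul (bsh 0).1).sub ((bch 0).1.mul (bs 0).1)) hB' (C := 1) (by
      have := L.norm
      rw [norm_zero] at this
      exact this.eventually_le_const one_pos)
  simp_rw [hk] at L
  exact (hk z).trans (tendsto_nhds_unique tendsto_const_nhds L)

/-- Local Borg–Marchenko uniqueness. -/
theorem potential_ae_eq_of_weyl_eq {Q Qh : ℝ → ℝ} {T : ℝ} (hT : 0 < T) (hT1 : T ≤ 1)
    (hQm : Measurable Q) (hQhm : Measurable Qh)
    (hQ : IntervalIntegrable Q volume 0 T) (hQh : IntervalIntegrable Qh volume 0 T)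
    {u v uh vh : ℂ → ℝ → ℂ}
    (hu : ∀ z : ℂ, z.im ≠ 0 → SLSol Q z (u z) (v z) 0 T ∧ u z 0 = 1 ∧
      ∀ t ∈ Ioc 0 T, 0 ≤ z.im * (v z t * conj (u z t)).im)
    (huh : ∀ z : ℂ, z.im ≠ 0 → SLSol Qh z (uh z) (vh z) 0 T ∧ uh z 0 = 1 ∧
      ∀ t ∈ Ioc 0 T, 0 ≤ z.im * (vh z t * conj (uh z t)).im)
    (hm : ∀ z : ℂ, z.im ≠ 0 → v z 0 = vh z 0) :
    ∀ᵐ t, t ∈ Ioo 0 T → Q t = Qh t := by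
  obtain ⟨c, c', s, s', B, H⟩ := exists_fundamental_system hT.le hT1 hQm hQ
  obtain ⟨ch, ch', sh, sh', Bh, Hh⟩ := exists_fundamental_system hT.le hT1 hQhm hQh
  have hD : ∀ t ∈ Ioc 0 T, ∀ z, c z t * sh z t - ch z t * s z t = 0 := by
    intro t ht z
    have hsub : uIcc 0 t ⊆ uIcc 0 T := by
      rw [uIcc_of_le ht.1.le, uIcc_of_le hT.le]
      exact Icc_subset_Icc_right ht.2
    exact weyl_cross_eq_zero ht.1 (hQ.mono_set hsub) (hQh.mono_set hsub)
      (fun z hz => ⟨(hu z hz).1.mono le_rfl ht.1.le ht.2, (hu z hz).2.1, (hu z hz).2.2 t ht⟩)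
      (fun z hz => ⟨(huh z hz).1.mono le_rfl ht.1.le ht.2, (huh z hz).2.1, (huh z hz).2.2 t ht⟩)
      hm
      (fun z => ⟨(H z).1.1.mono le_rfl ht.1.le ht.2, (H z).1.2⟩)
      (fun z => ⟨(H z).2.1.1.mono le_rfl ht.1.le ht.2, (H z).2.1.2⟩)
      (fun z => ⟨(Hh z).1.1.mono le_rfl ht.1.le ht.2, (Hh z).1.2⟩)
      (fun z => ⟨(Hh z).2.1.1.mono le_rfl ht.1.le ht.2, (Hh z).2.1.2⟩)
      (fun z => (H z).2.2.1 t) (fun z => (H z).2.2.2 t) (fun z => (Hh z).2.2.1 t)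
      (fun z => (Hh z).2.2.2 t) z
  obtain ⟨⟨hc, hc0, hc0'⟩, ⟨hs, hs0, hs0'⟩, -⟩ := H Complex.I
  obtain ⟨⟨hch, hch0, hch0'⟩, ⟨hsh, hsh0, hsh0'⟩, -⟩ := Hh Complex.I
  replace hD : ∀ t ∈ Ioc 0 T, c Complex.I t * sh Complex.I t - ch Complex.I t * s Complex.I t = 0 :=
    fun t ht => hD t ht Complex.I
  generalize c Complex.I = c at *
  generalize c' Complex.I = c' at *
  generalize s Complex.I = s at *
  generalize s' Complex.I = s' at *
  generalize ch Complex.I = ch at *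
  generalize ch' Complex.I = ch' at *
  generalize sh Complex.I = sh at *
  generalize sh' Complex.I = sh' at *
  have hIm : Complex.I.im ≠ 0 := by simp
  have hder : ∀ {f f' : ℝ → ℂ} {Q : ℝ → ℝ}, SLSol Q Complex.I f f' 0 T → ∀ t ∈ Ioo 0 T,
      HasDerivAt f (f' t) t := fun h t ht => h.fst.hasDerivAt h.snd.continuousOn ht
  have hD' : ∀ t ∈ Ioo 0 T, c' t * sh t + c t * sh' t - (ch' t * s t + ch t * s' t) = 0 := by
    intro t ht
    have h1 := ((hder hc t ht).mul (hder hsh t ht)).sub ((hder hch t ht).mul (hder hs t ht))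
    refine (h1.congr_of_eventuallyEq (f₁ := fun _ => (0:ℂ)) ?_).unique (hasDerivAt_const t 0)
    filter_upwards [Ioo_mem_nhds ht.1 ht.2] with x hx
    exact (hD x (Ioo_subset_Ioc_self hx)).symm
  have hsq : ∀ t ∈ Ioo 0 T, s t * s t = sh t * sh t := by
    intro t ht
    have w1 := hc.wronskian_eq hs (Ioo_subset_Icc_self ht)
    have w2 := hch.wronskian_eq hsh (Ioo_subset_Icc_self ht)
    rw [hc0, hc0', hs0, hs0'] at w1
    rw [hch0, hch0', hsh0, hsh0'] at w2
    have d0 := hD t (Ioo_subset_Ioc_self ht)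
    have d1 := hD' t ht
    linear_combination s t * sh t * d1 - (sh' t * s t + sh t * s' t) * d0 - s t ^ 2 * w2 +
      sh t ^ 2 * w1
  have hmix : ∀ t ∈ Ioo 0 T, s t * s' t = sh t * sh' t := by
    intro t ht
    have h1 := (hder hs t ht).mul (hder hs t ht)
    have h2 := (hder hsh t ht).mul (hder hsh t ht)
    have h3 := (h1.congr_of_eventuallyEq (f₁ := fun x => sh x * sh x) (by
      filter_upwards [Ioo_mem_nhds ht.1 ht.2] with x hx
      exact (hsq x hx).symm)).unique h2
    linear_combination h3 / 2
  filter_upwards [(hs.fst.mul hs.snd).ae_hasDerivAt, (hsh.fst.mul hsh.snd).ae_hasDerivAt]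
    with t h1 h2 ht
  have h3 := ((h1 ht).congr_of_eventuallyEq (f₁ := fun x => sh x * sh' x) (by
    filter_upwards [Ioo_mem_nhds ht.1 ht.2] with x hx
    exact (hmix x hx).symm)).unique (h2 ht)
  have hne := hc.sine_ne_zero hs hc0 hs0 hs0' hIm (Ioo_subset_Ioc_self ht)
  have h4 := hsq t ht
  have h5 := hmix t ht
  have h6 : s' t * s' t = sh' t * sh' t := by
    have : (s t * s t) * (s' t * s' t) = (s t * s t) * (sh' t * sh' t) := by
      linear_combination (s t * s' t + sh t * sh' t) * h5 - sh' t * sh' t * h4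
    exact mul_left_cancel₀ (mul_ne_zero hne hne) this
  have h7 : ((Q t : ℂ) - Qh t) * (s t * s t) = 0 := by
    linear_combination h3 - h6 - (Qh t - Complex.I) * h4
  have h8 := (mul_eq_zero.1 h7).resolve_right (mul_ne_zero hne hne)
  exact_mod_cast sub_eq_zero.1 h8

section Reflected

variable {l : ℝ} {q : ℝ → ℝ}

theorem realZeroType_charF (h : WPot (2 * l + 2) q) (hl : -(1:ℝ) / 2 ≤ l) (γ : Option ℝ) :
    RealZeroType (charF h γ) :=
  ⟨differentiable_charF h γ, exists_growth_bound_charF h γ, exists_lower_bound_charF h hl γ⟩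

theorem regU_one_ne_zero (h : WPot (2 * l + 2) q) (hl : -(1:ℝ) / 2 ≤ l) {z : ℂ} (hz : z.im ≠ 0) :
    regU h z 1 ≠ 0 :=
  (realZeroType_charF h hl none).ne_zero hz

theorem measurable_fullPot (h : WPot (2 * l + 2) q) : Measurable (fullPot l q) := by
  unfold fullPot
  exact (measurable_const.div (measurable_id.pow_const 2)).add h.meas

theorem intervalIntegrable_pot (h : WPot (2 * l + 2) q) {a : ℝ} (ha : 0 < a) (ha1 : a ≤ 1) :
    IntervalIntegrable q volume a 1 := by
  have h1 := WPot.intervalIntegrable_of_Ioo (h.integrableOn_weight_mul 0) (a := a) (b := 1)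
    ⟨ha.le, ha1⟩ (by simp)
  have h2 : IntervalIntegrable (fun y => ((y ^ (-(2 * l + 2)) : ℝ) : ℂ) *
      (((y ^ (2 * l + 2) : ℝ) : ℂ) * ((q y : ℂ) - 0))) volume a 1 := by
    refine h1.continuousOn_mul ?_
    rw [uIcc_of_le ha1]
    exact Complex.continuous_ofReal.comp_continuousOn
      ((continuousOn_rpow_pos _).mono fun y hy => ha.trans_le hy.1)
  have h3 : IntervalIntegrable (fun y => (((y ^ (-(2 * l + 2)) : ℝ) : ℂ) *
      (((y ^ (2 * l + 2) : ℝ) : ℂ) * ((q y : ℂ) - 0))).re) volume a 1 := ⟨h2.1.re, h2.2.re⟩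
  refine h3.congr fun y hy => ?_
  rw [uIoc_of_le ha1] at hy
  have hy0 : 0 < y := ha.trans hy.1
  rw [sub_zero, ← mul_assoc, ← Complex.ofReal_mul, ← Real.rpow_add hy0]
  simp

theorem intervalIntegrable_fullPot (h : WPot (2 * l + 2) q) {a : ℝ} (ha : 0 < a) (ha1 : a ≤ 1) :
    IntervalIntegrable (fullPot l q) volume a 1 := by
  refine IntervalIntegrable.add (ContinuousOn.intervalIntegrable ?_)
    (intervalIntegrable_pot h ha ha1)
  rw [uIcc_of_le ha1]
  exact continuousOn_const.div (by fun_prop) fun x hx =>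
    pow_ne_zero 2 (ne_of_gt (ha.trans_le hx.1))

/-- The regular solution normalised at `1` and reflected about `1 / 2`. -/
noncomputable def weylU (h : WPot (2 * l + 2) q) (z : ℂ) (t : ℝ) : ℂ :=
  (regU h z 1)⁻¹ * regU h z (1 - t)

/-- The derivative of `weylU`. -/
noncomputable def weylV (h : WPot (2 * l + 2) q) (z : ℂ) (t : ℝ) : ℂ :=
  (regU h z 1)⁻¹ * -regV h z (1 - t)

theorem slSol_weyl (h : WPot (2 * l + 2) q) (z : ℂ) {T : ℝ} (hT : 0 ≤ T) (hT1 : T < 1) :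
    SLSol (fun t => fullPot l q (1 - t)) z (weylU h z) (weylV h z) 0 T := by
  have h1 := (slSol_reg h z (a := 1 - T) (by linarith) (by linarith)).reflect.const_mul
    (regU h z 1)⁻¹
  rw [sub_self, sub_sub_cancel] at h1
  exact h1

theorem weylU_zero (h : WPot (2 * l + 2) q) (hl : -(1:ℝ) / 2 ≤ l) {z : ℂ} (hz : z.im ≠ 0) :
    weylU h z 0 = 1 := by
  rw [weylU, sub_zero, inv_mul_cancel₀ (regU_one_ne_zero h hl hz)]

theorem weyl_sign (h : WPot (2 * l + 2) q) (z : ℂ) {t : ℝ} (ht : 0 ≤ t) (ht1 : t < 1) :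
    0 ≤ z.im * (weylV h z t * conj (weylU h z t)).im := by
  have h1 := im_reg_sign h z (x := 1 - t) (by linarith) (by linarith)
  have h2 : weylV h z t * conj (weylU h z t) = ((-‖(regU h z 1)⁻¹‖ ^ 2 : ℝ) : ℂ) *
      (regV h z (1 - t) * conj (regU h z (1 - t))) := by
    rw [weylV, weylU, map_mul]
    have : ((‖(regU h z 1)⁻¹‖ ^ 2 : ℝ) : ℂ) = (regU h z 1)⁻¹ * conj (regU h z 1)⁻¹ := by
      rw [Complex.mul_conj, Complex.normSq_eq_norm_sq]
    rw [Complex.ofReal_neg, this]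
    ring
  rw [h2, Complex.im_ofReal_mul]
  nlinarith [sq_nonneg ‖(regU h z 1)⁻¹‖]

theorem intervalIntegrable_fullPot_reflect (h : WPot (2 * l + 2) q) {T : ℝ} (hT : 0 ≤ T)
    (hT1 : T < 1) : IntervalIntegrable (fun t => fullPot l q (1 - t)) volume 0 T := by
  have h1 := ((intervalIntegrable_fullPot h (a := 1 - T) (by linarith)
    (by linarith)).symm).comp_sub_left 1
  rw [sub_self, sub_sub_cancel] at h1
  exact h1

theorem measurable_fullPot_reflect (h : WPot (2 * l + 2) q) :
    Measurable fun t => fullPot l q (1 - t) :=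
  (measurable_fullPot h).comp (measurable_const.sub measurable_id)

theorem tendsto_weylV_zero (h : WPot (2 * l + 2) q) (hl : -(1:ℝ) / 2 ≤ l) :
    Tendsto (fun z => weylV h z 0 / negSqrt z) sectorFilter (𝓝 (-1)) := by
  have hT : (0:ℝ) < 1 / 2 := by norm_num
  have hT1 : (1 / 2 : ℝ) < 1 := by norm_num
  have hInt := intervalIntegrable_fullPot_reflect h hT.le hT1
  obtain ⟨c, c', s, s', B, H⟩ := exists_fundamental_system hT.le hT1.le
    (measurable_fullPot_reflect h) hInt
  obtain ⟨S1, S2⟩ := SLSol.tendsto_sine hT hInt (fun z => (H z).2.1.1) (fun z => (H z).2.1.2.1)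
    (fun z => (H z).2.1.2.2)
  have C1 := SLSol.tendsto_cosine hT hInt (fun z => (H z).1.1) (fun z => (H z).1.2.1)
    (fun z => (H z).1.2.2)
  refine tendsto_weyl_function hT (U := fun z => weylU h z (1 / 2)) ?_ ?_ C1 S1 S2
  · filter_upwards [sectorFilter_im_ne_zero] with z hz
    exact SLSol.weyl_bound hT.le (slSol_weyl h z hT.le hT1) (H z).2.1.1 (weylU_zero h hl hz)
      (H z).2.1.2.1 (H z).2.1.2.2 (weyl_sign h z hT.le hT1)
  · filter_upwards [sectorFilter_im_ne_zero] with z hz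
    have e := ((slSol_weyl h z hT.le hT1).eq_combination (H z).1.1 (H z).2.1.1 (H z).1.2.1
      (H z).1.2.2 (H z).2.1.2.1 (H z).2.1.2.2 (x := 1 / 2) ⟨hT.le, le_rfl⟩).1
    rw [weylU_zero h hl hz, one_mul] at e
    exact e

/-- The leading order of the characteristic function relative to the Dirichlet one. -/
noncomputable def charWeight : Option ℝ → ℂ → ℂ
  | none => fun _ => 1
  | some _ => negSqrt

theorem tendsto_charF_div (h : WPot (2 * l + 2) q) (hl : -(1:ℝ) / 2 ≤ l) (γ : Option ℝ) :
    Tendsto (fun z => charF h γ z / (regU h z 1 * charWeight γ z)) sectorFilter (𝓝 1) := by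
  cases γ with
  | none =>
    refine tendsto_const_nhds.congr' ?_
    filter_upwards [sectorFilter_im_ne_zero] with z hz
    simp [charF, charWeight, regU_one_ne_zero h hl hz]
  | some γ =>
    have h1 : Tendsto (fun z => (γ : ℂ) / negSqrt z) sectorFilter (𝓝 0) := by
      rw [tendsto_zero_iff_norm_tendsto_zero]
      simp_rw [norm_div]
      exact tendsto_const_div_norm_negSqrt _
    have h2 := (tendsto_weylV_zero h hl).neg.add h1
    rw [neg_neg, add_zero] at h2
    refine h2.congr' ?_
    filter_upwards [sectorFilter_im_ne_zero, tendsto_norm_negSqrt.eventually_gt_atTop 0]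
      with z hz h3
    have h4 := regU_one_ne_zero h hl hz
    have h5 := norm_pos_iff.1 h3
    simp only [charF, charWeight, weylV, sub_zero]
    field_simp

end Reflected

section TwoSpectra

variable {l lh : ℝ} {q qh : ℝ → ℝ}

theorem regV_mul_regU_eq (h : WPot (2 * l + 2) q) (hh : WPot (2 * lh + 2) qh)
    (hl : -(1:ℝ) / 2 ≤ l) (hlh : -(1:ℝ) / 2 ≤ lh) {α β : Option ℝ} (hαβ : α ≠ β)
    (hα : ∀ z, z ≠ 0 → (charF h α z = 0 ↔ charF hh α z = 0))
    (hβ : ∀ z, z ≠ 0 → (charF h β z = 0 ↔ charF hh β z = 0)) {z : ℂ} (hz : z.im ≠ 0) :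
    regV h z 1 * regU hh z 1 = regV hh z 1 * regU h z 1 := by
  have hlim : Tendsto (fun z => charF h α z * charF hh β z / (charF hh α z * charF h β z))
      sectorFilter (𝓝 1) := by
    have h1 := ((tendsto_charF_div h hl α).mul (tendsto_charF_div hh hlh β)).div
      ((tendsto_charF_div hh hlh α).mul (tendsto_charF_div h hl β)) (by norm_num)
    rw [mul_one, div_one] at h1
    refine h1.congr' ?_
    filter_upwards [sectorFilter_im_ne_zero, tendsto_norm_negSqrt.eventually_gt_atTop 0]
      with z hz h3
    have hw : ∀ γ, charWeight γ z ≠ 0 := fun γ => by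
      cases γ
      · simp [charWeight]
      · exact norm_pos_iff.1 h3
    have e1 := regU_one_ne_zero h hl hz
    have e2 := regU_one_ne_zero hh hlh hz
    have e3 := hw α
    have e4 := hw β
    have e5 := (realZeroType_charF hh hlh α).ne_zero hz
    have e6 := (realZeroType_charF h hl β).ne_zero hz
    simp only [Pi.div_apply]
    field_simp
  have key := (realZeroType_charF h hl α).mul_eq_mul (realZeroType_charF h hl β)
    (realZeroType_charF hh hlh α) (realZeroType_charF hh hlh β) hα hβ hlim hz
  cases α with
  | none =>
    cases β with
    | none => exact absurd rfl hαβ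
    | some β =>
      simp only [charF] at key
      linear_combination -key
  | some α =>
    cases β with
    | none =>
      simp only [charF] at key
      linear_combination key
    | some β =>
      simp only [charF] at key
      have hne : (α : ℂ) - β ≠ 0 := by
        rw [sub_ne_zero]
        intro h
        exact hαβ (by rw [Complex.ofReal_inj.1 h])
      refine mul_left_cancel₀ hne ?_
      linear_combination -key

theorem fullPot_ae_eq (h : WPot (2 * l + 2) q) (hh : WPot (2 * lh + 2) qh)
    (hl : -(1:ℝ) / 2 ≤ l) (hlh : -(1:ℝ) / 2 ≤ lh)
    (hw : ∀ z : ℂ, z.im ≠ 0 → regV h z 1 * regU hh z 1 = regV hh z 1 * regU h z 1) :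
    ∀ᵐ x ∂(volume.restrict (Ioo (0:ℝ) 1)), fullPot l q x = fullPot lh qh x := by
  have hloc : ∀ n : ℕ, ∀ᵐ t, t ∈ Ioo (0:ℝ) (1 - 1 / (n + 2)) →
      fullPot l q (1 - t) = fullPot lh qh (1 - t) := by
    intro n
    have hn : (0:ℝ) ≤ n := n.cast_nonneg
    have h1 : 1 / ((n:ℝ) + 2) < 1 := by rw [div_lt_one (by linarith)]; linarith
    have h2 : 0 < 1 / ((n:ℝ) + 2) := by positivity
    have hT : (0:ℝ) < 1 - 1 / (n + 2) := by linarith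
    have hT1 : (1:ℝ) - 1 / (n + 2) < 1 := by linarith
    refine potential_ae_eq_of_weyl_eq hT hT1.le (measurable_fullPot_reflect h)
      (measurable_fullPot_reflect hh) (intervalIntegrable_fullPot_reflect h hT.le hT1)
      (intervalIntegrable_fullPot_reflect hh hT.le hT1) (u := weylU h) (v := weylV h)
      (uh := weylU hh) (vh := weylV hh)
      (fun z hz => ⟨slSol_weyl h z hT.le hT1, weylU_zero h hl hz, fun t ht =>
        weyl_sign h z ht.1.le (ht.2.trans_lt hT1)⟩)
      (fun z hz => ⟨slSol_weyl hh z hT.le hT1, weylU_zero hh hlh hz, fun t ht =>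
        weyl_sign hh z ht.1.le (ht.2.trans_lt hT1)⟩) fun z hz => ?_
    have e1 := regU_one_ne_zero h hl hz
    have e2 := regU_one_ne_zero hh hlh hz
    rw [weylV, weylV, sub_zero]
    field_simp
    linear_combination -hw z hz
  have hall : ∀ᵐ t, t ∈ Ioo (0:ℝ) 1 → fullPot l q (1 - t) = fullPot lh qh (1 - t) := by
    filter_upwards [ae_all_iff.2 hloc] with t ht htI
    obtain ⟨n, hn⟩ := exists_nat_one_div_lt (sub_pos.2 htI.2)
    refine ht n ⟨htI.1, ?_⟩
    have : 1 / ((n:ℝ) + 2) ≤ 1 / (n + 1) := by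
      apply one_div_le_one_div_of_le <;> linarith [n.cast_nonneg (α := ℝ)]
    linarith
  rw [ae_restrict_iff' measurableSet_Ioo]
  have hmp : MeasurePreserving (fun x : ℝ => 1 - x) volume volume :=
    Measure.measurePreserving_sub_left volume 1
  filter_upwards [hmp.quasiMeasurePreserving.ae hall] with x hx hxI
  have := hx ⟨by linarith [hxI.2], by linarith [hxI.1]⟩
  simpa using this

theorem integrableOn_id_mul_of_qtilde (hqm : Measurable q)
    (hq : IntegrableOn (fun x => x * qtilde l q x) (Ioo 0 1)) :
    IntegrableOn (fun x => x * q x) (Ioo 0 1) := by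
  refine Integrable.mono' hq (measurable_id.mul hqm).aestronglyMeasurable ?_
  filter_upwards [ae_restrict_mem measurableSet_Ioo] with x hx
  rw [norm_mul, Real.norm_of_nonneg hx.1.le, Real.norm_eq_abs]
  refine mul_le_mul_of_nonneg_left ?_ hx.1.le
  unfold qtilde
  split_ifs
  · exact le_mul_of_one_le_left (abs_nonneg _)
      (by linarith [Real.log_nonpos hx.1.le hx.2.le])
  · exact le_rfl

theorem eq_of_fullPot_ae_eq (hl : -(1:ℝ) / 2 ≤ l) (hlh : -(1:ℝ) / 2 ≤ lh)
    (hq : IntegrableOn (fun x => x * q x) (Ioo 0 1))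
    (hqh : IntegrableOn (fun x => x * qh x) (Ioo 0 1))
    (hae : ∀ᵐ x ∂(volume.restrict (Ioo (0:ℝ) 1)), fullPot l q x = fullPot lh qh x) :
    l = lh ∧ ∀ᵐ x ∂(volume.restrict (Ioo (0:ℝ) 1)), q x = qh x := by
  have hll : l = lh := by
    have h1 : IntegrableOn (fun x : ℝ => (l * (l + 1) - lh * (lh + 1)) * x⁻¹) (Ioo 0 1) := by
      refine (hqh.sub hq).congr ?_
      filter_upwards [hae, ae_restrict_mem measurableSet_Ioo] with x hx hxI
      have hx0 := hxI.1.ne'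
      simp only [fullPot] at hx
      simp only [Pi.sub_apply]
      field_simp at hx ⊢
      linear_combination -hx
    have h2 : l * (l + 1) - lh * (lh + 1) = 0 := by
      by_contra hne
      have h3 : IntegrableOn (fun x : ℝ => x⁻¹) (Ioo 0 1) := by
        have := h1.const_mul (l * (l + 1) - lh * (lh + 1))⁻¹
        refine this.congr (Eventually.of_forall fun x => ?_)
        beta_reduce
        rw [← mul_assoc, inv_mul_cancel₀ hne, one_mul]
      have h4 : IntervalIntegrable (fun x : ℝ => x⁻¹) volume 0 1 := by
        rwa [intervalIntegrable_iff_integrableOn_Ioo_of_le zero_le_one]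
      rw [intervalIntegrable_inv_iff] at h4
      simp at h4
    have h3 : (l - lh) * (l + lh + 1) = 0 := by linear_combination h2
    rcases mul_eq_zero.1 h3 with h4 | h4
    · linarith
    · linarith
  refine ⟨hll, ?_⟩
  filter_upwards [hae] with x hx
  simp only [fullPot, hll] at hx
  linarith

end TwoSpectra

section ExponentialSeries

/-- The exponential generating function of `b`. -/
noncomputable def expSeries (b : ℕ → ℂ) (t : ℂ) : ℂ := ∑' k : ℕ, t ^ k / (k.factorial : ℂ) * b k

variable {b : ℕ → ℂ} {B : ℝ}

theorem norm_expSeries_term_le (hb : ∀ k, ‖b k‖ ≤ B) {t : ℂ} {R : ℝ} (ht : ‖t‖ ≤ R) (k : ℕ) :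
    ‖t ^ k / (k.factorial : ℂ) * b k‖ ≤ R ^ k / (k.factorial : ℝ) * B := by
  rw [norm_mul, norm_div, norm_pow, Complex.norm_natCast]
  have hR : 0 ≤ R := (norm_nonneg t).trans ht
  exact mul_le_mul (by gcongr) (hb k) (norm_nonneg _) (by positivity)

theorem summable_expSeries (hb : ∀ k, ‖b k‖ ≤ B) (t : ℂ) :
    Summable fun k : ℕ => t ^ k / (k.factorial : ℂ) * b k :=
  Summable.of_norm_bounded ((Real.summable_pow_div_factorial ‖t‖).mul_right B)
    fun k => norm_expSeries_term_le hb le_rfl k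

theorem expSeries_zero (b : ℕ → ℂ) : expSeries b 0 = b 0 := by
  rw [expSeries, tsum_eq_single 0 (fun k hk => by simp [hk])]
  simp

theorem expSeries_const_mul (b : ℕ → ℂ) (c t : ℂ) :
    expSeries (fun k => c * b k) t = c * expSeries b t := by
  rw [expSeries, expSeries, ← tsum_mul_left]
  exact tsum_congr fun k => by ring

theorem summable_succ_shift {b : ℕ → ℂ} (hb : ∀ k, ‖b k‖ ≤ B) (t : ℂ) :
    Summable fun k : ℕ => t ^ k / (k.factorial : ℂ) * (k * b k) := by
  refine (summable_nat_add_iff 1).1 ?_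
  refine ((summable_expSeries (fun k => hb (k + 1)) t).mul_left t).congr fun k => ?_
  rw [Nat.factorial_succ]
  push_cast
  have h1 : ((k : ℂ) + 1) ≠ 0 := by exact_mod_cast k.succ_ne_zero
  have h2 : ((k.factorial : ℕ) : ℂ) ≠ 0 := by exact_mod_cast k.factorial_ne_zero
  field_simp
  ring

theorem expSeries_nat_mul (hb : ∀ k, ‖b k‖ ≤ B) (t : ℂ) :
    expSeries (fun k => k * b k) t = t * expSeries (fun k => b (k + 1)) t := by
  rw [expSeries, (summable_succ_shift hb t).tsum_eq_zero_add, expSeries, ← tsum_mul_left]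
  simp only [Nat.cast_zero, zero_mul, mul_zero, zero_add]
  refine tsum_congr fun k => ?_
  rw [Nat.factorial_succ]
  push_cast
  have h1 : ((k : ℂ) + 1) ≠ 0 := by exact_mod_cast k.succ_ne_zero
  have h2 : ((k.factorial : ℕ) : ℂ) ≠ 0 := by exact_mod_cast k.factorial_ne_zero
  field_simp
  ring

theorem hasDerivAt_expSeries (hb : ∀ k, ‖b k‖ ≤ B) (t : ℂ) :
    HasDerivAt (expSeries b) (expSeries (fun k => b (k + 1)) t) t := by
  have hB : 0 ≤ B := (norm_nonneg _).trans (hb 0)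
  set R := ‖t‖ + 1
  have hR : 0 < R := by positivity
  set a : ℕ → ℂ → ℂ := fun k s => k * s ^ (k - 1) / (k.factorial : ℂ) * b k with ha
  have hsucc : ∀ k s, a (k + 1) s = s ^ k / (k.factorial : ℂ) * b (k + 1) := by
    intro k s
    simp only [ha, Nat.add_sub_cancel, Nat.factorial_succ]
    push_cast
    have h1 : ((k : ℂ) + 1) ≠ 0 := by exact_mod_cast k.succ_ne_zero
    have h2 : ((k.factorial : ℕ) : ℂ) ≠ 0 := by exact_mod_cast k.factorial_ne_zero
    field_simp
  have ha0 : ∀ s, a 0 s = 0 := fun s => by simp [ha]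
  set u : ℕ → ℝ := fun k => match k with
    | 0 => 0
    | k + 1 => R ^ k / (k.factorial : ℝ) * B with hu
  have hus : Summable u :=
    (summable_nat_add_iff 1).1 ((Real.summable_pow_div_factorial R).mul_right B)
  have key := hasDerivAt_tsum_of_isPreconnected (g := fun k s => s ^ k / (k.factorial : ℂ) * b k)
    (g' := a) (t := Metric.ball 0 R) (y₀ := 0) (y := t) hus Metric.isOpen_ball
    (convex_ball 0 R).isPreconnected
    (fun k s _ => ((hasDerivAt_pow k s).div_const _).mul_const _)
    (fun k s hs => by
      cases k with
      | zero => rw [ha0, norm_zero]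
      | succ k =>
        rw [hsucc]
        exact norm_expSeries_term_le (fun k => hb (k + 1)) (mem_ball_zero_iff.1 hs).le k)
    (Metric.mem_ball_self hR) (summable_expSeries hb 0) (by simp [R])
  have hsum : ∑' k, a k t = expSeries (fun k => b (k + 1)) t := by
    have hs : Summable fun k => a k t := by
      refine (summable_nat_add_iff 1).1 ?_
      simp_rw [hsucc]
      exact summable_expSeries (fun k => hb (k + 1)) t
    rw [hs.tsum_eq_zero_add, ha0, zero_add, expSeries]
    exact tsum_congr fun k => hsucc k t
  rw [hsum] at key
  exact key

end ExponentialSeries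

section InvGamma

/-- The reciprocal of the Gamma function. -/
noncomputable def invGamma (s : ℂ) : ℂ := (Complex.Gamma s)⁻¹

theorem differentiable_invGamma : Differentiable ℂ invGamma :=
  Complex.differentiable_one_div_Gamma

theorem invGamma_eq (s : ℂ) : invGamma s = s * invGamma (s + 1) :=
  Complex.one_div_Gamma_eq_self_mul_one_div_Gamma_add_one s

theorem exists_bound_invGamma (R : ℝ) : ∃ B : ℝ, ∀ w : ℂ, -R ≤ w.re → |w.im| ≤ R →
    ‖invGamma w‖ ≤ B := by
  obtain ⟨B, hB⟩ := (isCompact_Icc (a := -R) (b := 2)).reProdIm (isCompact_Icc (a := -R) (b := R))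
    |>.exists_bound_of_continuousOn differentiable_invGamma.continuous.continuousOn
  have key : ∀ n : ℕ, ∀ w : ℂ, -R ≤ w.re → |w.im| ≤ R → w.re ≤ 2 + n → ‖invGamma w‖ ≤ max B 0 := by
    intro n
    induction n with
    | zero =>
      intro w h1 h2 h3
      rw [Nat.cast_zero, add_zero] at h3
      exact (hB w ⟨⟨h1, h3⟩, abs_le.1 h2⟩).trans (le_max_left _ _)
    | succ n ih =>
      intro w h1 h2 h3
      rcases le_total w.re 2 with h4 | h4
      · exact (hB w ⟨⟨h1, h4⟩, abs_le.1 h2⟩).trans (le_max_left _ _)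
      · push_cast at h3
        have hR : 0 ≤ R := (abs_nonneg _).trans h2
        have h5 := ih (w - 1) (by simp; linarith) (by simpa using h2) (by simp; linarith)
        rw [invGamma_eq, sub_add_cancel, norm_mul] at h5
        have h6 : 1 ≤ ‖w - 1‖ := by
          have := Complex.re_le_norm (w - 1)
          simp at this
          linarith
        exact (le_mul_of_one_le_left (norm_nonneg _) h6).trans h5
  refine ⟨max B 0, fun w h1 h2 => ?_⟩
  obtain ⟨n, hn⟩ := exists_nat_ge (w.re - 2)
  exact key n w h1 h2 (by linarith)

theorem exists_bound_deriv_invGamma (R : ℝ) : ∃ B : ℝ, ∀ w : ℂ, -R ≤ w.re → |w.im| ≤ R →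
    ‖deriv invGamma w‖ ≤ B := by
  obtain ⟨B, hB⟩ := exists_bound_invGamma (R + 1)
  refine ⟨B / 1, fun w h1 h2 => ?_⟩
  refine Complex.norm_deriv_le_of_forall_mem_sphere_norm_le one_pos
    differentiable_invGamma.diffContOnCl fun s hs => hB s ?_ ?_
  · have h3 := Complex.abs_re_le_norm (s - w)
    rw [← dist_eq_norm, hs, Complex.sub_re, abs_le] at h3
    linarith [h3.1]
  · have h3 := Complex.abs_im_le_norm (s - w)
    rw [← dist_eq_norm, hs, Complex.sub_im, abs_le] at h3
    rw [abs_le] at h2 ⊢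
    constructor <;> linarith [h3.1, h3.2, h2.1, h2.2]

theorem exists_bound_invGamma_shift (R : ℝ) : ∃ B : ℝ, ∀ μ : ℂ, ‖μ‖ ≤ R → ∀ k : ℕ,
    ‖invGamma (μ + k + 1)‖ ≤ B ∧ ‖deriv invGamma (μ + k + 1)‖ ≤ B := by
  obtain ⟨B, hB⟩ := exists_bound_invGamma R
  obtain ⟨B', hB'⟩ := exists_bound_deriv_invGamma R
  refine ⟨max B B', fun μ hμ k => ?_⟩
  have h1 : -R ≤ (μ + k + 1).re := by
    have := (abs_le.1 ((Complex.abs_re_le_norm μ).trans hμ)).1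
    have hk : (0:ℝ) ≤ k := k.cast_nonneg
    simp
    linarith
  have h2 : |(μ + k + 1).im| ≤ R := by simpa using (Complex.abs_im_le_norm μ).trans hμ
  exact ⟨(hB _ h1 h2).trans (le_max_left _ _), (hB' _ h1 h2).trans (le_max_right _ _)⟩

end InvGamma

section BesselSeries

/-- `∑ t ^ k / (k! Γ(μ + k + 1))`. -/
noncomputable def besselK (μ t : ℂ) : ℂ := expSeries (fun k => invGamma (μ + k + 1)) t

/-- The derivative of `besselK` in its first argument. -/
noncomputable def besselK' (μ t : ℂ) : ℂ := expSeries (fun k => deriv invGamma (μ + k + 1)) t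

theorem exists_bound_shift (μ : ℂ) : ∃ B : ℝ, ∀ k : ℕ,
    ‖invGamma (μ + k + 1)‖ ≤ B ∧ ‖deriv invGamma (μ + k + 1)‖ ≤ B :=
  let ⟨B, hB⟩ := exists_bound_invGamma_shift ‖μ‖
  ⟨B, hB μ le_rfl⟩

theorem hasDerivAt_besselK (μ t : ℂ) : HasDerivAt (besselK μ) (besselK (μ + 1) t) t := by
  obtain ⟨B, hB⟩ := exists_bound_shift μ
  have e : besselK (μ + 1) t = expSeries (fun k => invGamma (μ + ((k + 1 : ℕ) : ℂ) + 1)) t := by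
    rw [besselK]
    congr 1
    ext k
    push_cast
    congr 1
    ring
  rw [e]
  exact hasDerivAt_expSeries (fun k => (hB k).1) t

theorem hasDerivAt_besselK' (μ t : ℂ) : HasDerivAt (besselK' μ) (besselK' (μ + 1) t) t := by
  obtain ⟨B, hB⟩ := exists_bound_shift μ
  have e : besselK' (μ + 1) t =
      expSeries (fun k => deriv invGamma (μ + ((k + 1 : ℕ) : ℂ) + 1)) t := by
    rw [besselK']
    congr 1
    ext k
    push_cast
    congr 1
    ring
  rw [e]
  exact hasDerivAt_expSeries (fun k => (hB k).2) t

theorem hasDerivAt_besselK_index (μ t : ℂ) :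
    HasDerivAt (fun μ => besselK μ t) (besselK' μ t) μ := by
  obtain ⟨B, hB⟩ := exists_bound_invGamma_shift (‖μ‖ + 1)
  refine hasDerivAt_tsum_of_isPreconnected
    (g := fun (k : ℕ) μ => t ^ k / (k.factorial : ℂ) * invGamma (μ + k + 1))
    (g' := fun k μ => t ^ k / (k.factorial : ℂ) * deriv invGamma (μ + k + 1))
    (t := Metric.ball 0 (‖μ‖ + 1)) (y₀ := 0) ((Real.summable_pow_div_factorial ‖t‖).mul_right B)
    Metric.isOpen_ball (convex_ball 0 _).isPreconnected (fun k w _ => ?_) (fun k w hw => ?_)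
    (Metric.mem_ball_self (by positivity))
    (summable_expSeries (fun k => (hB 0 (by simp; positivity) k).1) t) (by simp)
  · have h1 : HasDerivAt (fun w : ℂ => w + k + 1) 1 w :=
      ((hasDerivAt_id w).add_const (k : ℂ)).add_const 1
    have h2 := HasDerivAt.comp w (h₂ := invGamma)
      (differentiable_invGamma (w + k + 1)).hasDerivAt h1
    rw [mul_one] at h2
    exact h2.const_mul _
  · rw [norm_mul, norm_div, norm_pow, Complex.norm_natCast]
    exact mul_le_mul_of_nonneg_left (hB w (mem_ball_zero_iff.1 hw).le k).2 (by positivity)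

theorem besselK_contiguous (μ t : ℂ) :
    t * besselK (μ + 2) t + (μ + 1) * besselK (μ + 1) t = besselK μ t := by
  obtain ⟨B, hB⟩ := exists_bound_shift (μ + 1)
  obtain ⟨B₀, hB₀⟩ := exists_bound_shift μ
  have h1 := expSeries_nat_mul (fun k => (hB k).1) t
  have h2 : besselK (μ + 2) t = expSeries (fun k : ℕ => invGamma (μ + 1 + (k + 1 : ℕ) + 1)) t := by
    rw [besselK]
    congr 1
    ext k
    push_cast
    congr 1
    ring
  rw [h2, ← h1, besselK, besselK, expSeries, ← expSeries_const_mul, expSeries, expSeries,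
    ← (summable_succ_shift (fun k => (hB k).1) t).tsum_add]
  · refine tsum_congr fun k => ?_
    rw [invGamma_eq (μ + k + 1), show μ + k + 1 + 1 = μ + 1 + k + 1 by ring]
    ring
  · refine ((summable_expSeries (fun k => (hB k).1) t).mul_left (μ + 1)).congr fun k => ?_
    ring

theorem besselK'_contiguous (μ t : ℂ) :
    t * besselK' (μ + 2) t + (μ + 1) * besselK' (μ + 1) t + besselK (μ + 1) t =
      besselK' μ t := by
  have hs : ∀ c : ℂ, HasDerivAt (fun μ => besselK (μ + c) t) (besselK' (μ + c) t) μ := fun c => by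
    have := HasDerivAt.comp μ (h₂ := fun μ => besselK μ t) (hasDerivAt_besselK_index (μ + c) t)
      ((hasDerivAt_id μ).add_const c)
    rwa [mul_one] at this
  have h1 := ((hs 2).const_mul t).add (((hasDerivAt_id μ).add_const 1).mul (hs 1))
  have h2 := (hasDerivAt_besselK_index μ t).unique (h1.congr_of_eventuallyEq
    (f₁ := fun μ => besselK μ t) (Eventually.of_forall fun μ => (besselK_contiguous μ t).symm))
  rw [h2]
  simp only [id, one_mul]
  ring

theorem besselK_zero_right (μ : ℂ) : besselK μ 0 = invGamma (μ + 1) := by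
  rw [besselK, expSeries_zero]
  simp

theorem invGamma_mul_one_sub (μ : ℂ) :
    (Real.pi : ℂ) * (invGamma μ * invGamma (1 - μ)) = Complex.sin (Real.pi * μ) := by
  rw [invGamma, invGamma, ← mul_inv, Complex.Gamma_mul_Gamma_one_sub, inv_div]
  have : (Real.pi : ℂ) ≠ 0 := by exact_mod_cast Real.pi_ne_zero
  field_simp

theorem besselK_wronskian (μ t : ℂ) :
    (Real.pi : ℂ) * (μ * besselK (-μ) t * besselK μ t + t * (besselK (-μ) t * besselK (μ + 1) t -
      besselK (-μ + 1) t * besselK μ t)) = Complex.sin (Real.pi * μ) := by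
  set E : ℂ → ℂ := fun t => (Real.pi : ℂ) * (μ * besselK (-μ) t * besselK μ t +
    t * (besselK (-μ) t * besselK (μ + 1) t - besselK (-μ + 1) t * besselK μ t)) with hE
  have hd : ∀ t, HasDerivAt E 0 t := by
    intro t
    have k0 := hasDerivAt_besselK μ t
    have k1 := hasDerivAt_besselK (μ + 1) t
    have m0 := hasDerivAt_besselK (-μ) t
    have m1 := hasDerivAt_besselK (-μ + 1) t
    have h1 := (((m0.const_mul μ).mul k0).add ((hasDerivAt_id t).mul
      ((m0.mul k1).sub (m1.mul k0)))).const_mul (Real.pi : ℂ)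
    refine h1.congr_deriv ?_
    have c1 := besselK_contiguous μ t
    have c2 := besselK_contiguous (-μ) t
    rw [show μ + 1 + 1 = μ + 2 by ring, show -μ + 1 + 1 = -μ + 2 by ring]
    simp only [id, Pi.mul_apply, Pi.sub_apply]
    linear_combination ((Real.pi : ℂ) * besselK (-μ) t) * c1 - (Real.pi : ℂ) * besselK μ t * c2
  have hconst := is_const_of_deriv_eq_zero (fun t => (hd t).differentiableAt)
    (fun t => (hd t).deriv) t 0
  have : E t = Complex.sin (Real.pi * μ) := by
    rw [hconst, ← invGamma_mul_one_sub, hE]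
    simp only [besselK_zero_right]
    rw [invGamma_eq μ, show 1 - μ = -μ + 1 by ring]
    ring
  exact this

theorem besselK_neg_nat (n : ℕ) (t : ℂ) : besselK (-n) t = t ^ n * besselK n t := by
  obtain ⟨B, hB⟩ := exists_bound_shift (-n)
  have hz : ∀ k < n, invGamma (-n + k + 1) = 0 := by
    intro k hk
    obtain ⟨j, rfl⟩ := Nat.exists_eq_add_of_lt hk
    rw [invGamma, show (-((k + j + 1 : ℕ) : ℂ) + k + 1) = -(j : ℂ) by push_cast; ring,
      Complex.Gamma_neg_nat_eq_zero, inv_zero]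
  rw [besselK, expSeries, ← (summable_expSeries (fun k => (hB k).1) t).sum_add_tsum_nat_add n,
    Finset.sum_eq_zero fun k hk => by rw [hz k (Finset.mem_range.1 hk), mul_zero], zero_add,
    besselK, expSeries, ← tsum_mul_left]
  refine tsum_congr fun k => ?_
  rw [invGamma, invGamma,
    show (-(n : ℂ) + ((k + n : ℕ) : ℂ) + 1) = (k : ℂ) + 1 by push_cast; ring,
    show ((n : ℂ) + k + 1) = ((k + n : ℕ) : ℂ) + 1 by push_cast; ring,
    Complex.Gamma_nat_eq_factorial, Complex.Gamma_nat_eq_factorial]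
  have h1 : ((k.factorial : ℕ) : ℂ) ≠ 0 := by exact_mod_cast k.factorial_ne_zero
  have h2 : (((k + n).factorial : ℕ) : ℂ) ≠ 0 := by exact_mod_cast (k + n).factorial_ne_zero
  field_simp
  ring

end BesselSeries

section BesselSolutions

/-- The prefactor `√π (x / 2) ^ (μ + 1 / 2)`. -/
noncomputable def besselE (μ : ℂ) (x : ℝ) : ℂ :=
  (√Real.pi : ℂ) * Complex.exp ((μ + 1 / 2) * (Real.log (x / 2) : ℂ))

/-- The argument `-z x² / 4` of the power series. -/
noncomputable def besselArg (z : ℂ) (x : ℝ) : ℂ := -z * (x : ℂ) ^ 2 / 4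

/-- The normalized Bessel solution of `-f'' + (μ² - 1/4) / x² f = z f`. -/
noncomputable def besselP (μ z : ℂ) (x : ℝ) : ℂ := besselE μ x * besselK μ (besselArg z x)

/-- The `x`-derivative of `besselP`. -/
noncomputable def besselP₁ (μ z : ℂ) (x : ℝ) : ℂ :=
  besselE μ x * ((μ + 1 / 2) / (x : ℂ) * besselK μ (besselArg z x) -
    z * x / 2 * besselK (μ + 1) (besselArg z x))

/-- The `μ`-derivative of `besselP`. -/
noncomputable def besselQ (μ z : ℂ) (x : ℝ) : ℂ :=
  besselE μ x * ((Real.log (x / 2) : ℂ) * besselK μ (besselArg z x) +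
    besselK' μ (besselArg z x))

/-- The `μ`-derivative of `besselP₁`. -/
noncomputable def besselQ₁ (μ z : ℂ) (x : ℝ) : ℂ :=
  besselE μ x * ((Real.log (x / 2) : ℂ) * ((μ + 1 / 2) / (x : ℂ) * besselK μ (besselArg z x) -
    z * x / 2 * besselK (μ + 1) (besselArg z x)) + 1 / (x : ℂ) * besselK μ (besselArg z x) +
    (μ + 1 / 2) / (x : ℂ) * besselK' μ (besselArg z x) -
    z * x / 2 * besselK' (μ + 1) (besselArg z x))

theorem hasDerivAt_ofReal_log_half {x : ℝ} (hx : 0 < x) :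
    HasDerivAt (fun x : ℝ => (Real.log (x / 2) : ℂ)) (1 / (x : ℂ)) x := by
  have h := (((hasDerivAt_id x).div_const 2).log (by simpa using hx.ne')).ofReal_comp
  refine h.congr_deriv ?_
  have : (x : ℂ) ≠ 0 := by exact_mod_cast hx.ne'
  simp only [id]
  push_cast
  field_simp

theorem hasDerivAt_besselE (μ : ℂ) {x : ℝ} (hx : 0 < x) :
    HasDerivAt (besselE μ) (besselE μ x * ((μ + 1 / 2) / (x : ℂ))) x := by
  have h := (((hasDerivAt_ofReal_log_half hx).const_mul (μ + 1 / 2)).cexp).const_mul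
    (√Real.pi : ℂ)
  refine h.congr_deriv ?_
  rw [besselE]
  ring

theorem hasDerivAt_besselArg (z : ℂ) (x : ℝ) :
    HasDerivAt (besselArg z) (-(z * x / 2)) x := by
  have h := ((((hasDerivAt_id x).ofReal_comp).pow 2).const_mul (-z)).div_const 4
  refine h.congr_deriv ?_
  simp only [id]
  push_cast
  ring

theorem hasDerivAt_besselK_arg (μ z : ℂ) (x : ℝ) :
    HasDerivAt (fun x : ℝ => besselK μ (besselArg z x))
      (besselK (μ + 1) (besselArg z x) * -(z * x / 2)) x :=
  (hasDerivAt_besselK μ _).comp x (hasDerivAt_besselArg z x)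

theorem hasDerivAt_besselK'_arg (μ z : ℂ) (x : ℝ) :
    HasDerivAt (fun x : ℝ => besselK' μ (besselArg z x))
      (besselK' (μ + 1) (besselArg z x) * -(z * x / 2)) x :=
  (hasDerivAt_besselK' μ _).comp x (hasDerivAt_besselArg z x)

theorem hasDerivAt_const_div_ofReal (c : ℂ) {x : ℝ} (hx : 0 < x) :
    HasDerivAt (fun x : ℝ => c / (x : ℂ)) (-c / (x : ℂ) ^ 2) x := by
  have hx' : (x : ℂ) ≠ 0 := by exact_mod_cast hx.ne'
  have h := ((hasDerivAt_id x).ofReal_comp).inv hx'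
  refine ((h.const_mul c).congr_deriv ?_)
  simp only [id]
  push_cast
  ring

theorem hasDerivAt_besselP (μ z : ℂ) {x : ℝ} (hx : 0 < x) :
    HasDerivAt (besselP μ z) (besselP₁ μ z x) x := by
  refine ((hasDerivAt_besselE μ hx).mul (hasDerivAt_besselK_arg μ z x)).congr_deriv ?_
  rw [besselP₁]
  ring

theorem hasDerivAt_mul_half (z : ℂ) (x : ℝ) :
    HasDerivAt (fun x : ℝ => z * x / 2) (z / 2) x := by
  refine ((((hasDerivAt_id x).ofReal_comp).const_mul z).div_const 2).congr_deriv ?_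
  push_cast
  ring

theorem hasDerivAt_besselP₁ (μ z : ℂ) {x : ℝ} (hx : 0 < x) :
    HasDerivAt (besselP₁ μ z) (((μ ^ 2 - 1 / 4) / (x : ℂ) ^ 2 - z) * besselP μ z x) x := by
  have hx' : (x : ℂ) ≠ 0 := by exact_mod_cast hx.ne'
  have h := (hasDerivAt_besselE μ hx).mul
    (((hasDerivAt_const_div_ofReal (μ + 1 / 2) hx).mul (hasDerivAt_besselK_arg μ z x)).sub
      ((hasDerivAt_mul_half z x).mul (hasDerivAt_besselK_arg (μ + 1) z x)))
  refine h.congr_deriv ?_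
  have c := besselK_contiguous μ (besselArg z x)
  rw [show μ + 1 + 1 = μ + 2 by ring]
  simp only [Pi.mul_apply, Pi.sub_apply, besselP]
  have e : besselArg z x = -z * (x : ℂ) ^ 2 / 4 := rfl
  generalize besselK μ (besselArg z x) = k0 at *
  generalize besselK (μ + 1) (besselArg z x) = k1 at *
  generalize besselK (μ + 2) (besselArg z x) = k2 at *
  generalize besselE μ x = E at *
  rw [e] at c
  field_simp
  linear_combination (-16 * (x : ℂ) ^ 2 * z * E) * c

theorem hasDerivAt_besselQ (μ z : ℂ) {x : ℝ} (hx : 0 < x) :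
    HasDerivAt (besselQ μ z) (besselQ₁ μ z x) x := by
  refine ((hasDerivAt_besselE μ hx).mul (((hasDerivAt_ofReal_log_half hx).mul
    (hasDerivAt_besselK_arg μ z x)).add (hasDerivAt_besselK'_arg μ z x))).congr_deriv ?_
  simp only [Pi.mul_apply, Pi.add_apply]
  rw [besselQ₁]
  ring

theorem hasDerivAt_besselQ₁ (μ z : ℂ) {x : ℝ} (hx : 0 < x) :
    HasDerivAt (besselQ₁ μ z) (((μ ^ 2 - 1 / 4) / (x : ℂ) ^ 2 - z) * besselQ μ z x +
      2 * μ / (x : ℂ) ^ 2 * besselP μ z x) x := by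
  have hx' : (x : ℂ) ≠ 0 := by exact_mod_cast hx.ne'
  have h := (hasDerivAt_besselE μ hx).mul
    (((((hasDerivAt_ofReal_log_half hx).mul
      (((hasDerivAt_const_div_ofReal (μ + 1 / 2) hx).mul (hasDerivAt_besselK_arg μ z x)).sub
      ((hasDerivAt_mul_half z x).mul (hasDerivAt_besselK_arg (μ + 1) z x)))).add
      ((hasDerivAt_const_div_ofReal 1 hx).mul (hasDerivAt_besselK_arg μ z x))).add
      ((hasDerivAt_const_div_ofReal (μ + 1 / 2) hx).mul (hasDerivAt_besselK'_arg μ z x))).sub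
      ((hasDerivAt_mul_half z x).mul (hasDerivAt_besselK'_arg (μ + 1) z x)))
  refine h.congr_deriv ?_
  have c := besselK_contiguous μ (besselArg z x)
  have c' := besselK'_contiguous μ (besselArg z x)
  rw [show μ + 1 + 1 = μ + 2 by ring]
  simp only [Pi.mul_apply, Pi.sub_apply, Pi.add_apply, besselP, besselQ]
  have e : besselArg z x = -z * (x : ℂ) ^ 2 / 4 := rfl
  generalize besselK μ (besselArg z x) = k0 at *
  generalize besselK (μ + 1) (besselArg z x) = k1 at *
  generalize besselK (μ + 2) (besselArg z x) = k2 at *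
  generalize besselK' μ (besselArg z x) = j0 at *
  generalize besselK' (μ + 1) (besselArg z x) = j1 at *
  generalize besselK' (μ + 2) (besselArg z x) = j2 at *
  generalize besselE μ x = E at *
  generalize (Real.log (x / 2) : ℂ) = L at *
  rw [e] at c c'
  field_simp
  linear_combination (-16 * (x : ℂ) ^ 2 * z * L * E) * c + (-16 * (x : ℂ) ^ 2 * z * E) * c'

theorem hasDerivAt_besselE_index (μ : ℂ) (x : ℝ) :
    HasDerivAt (fun μ => besselE μ x) (besselE μ x * (Real.log (x / 2) : ℂ)) μ := by
  have h := (((((hasDerivAt_id μ).add_const (1 / 2 : ℂ)).mul_const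
    (Real.log (x / 2) : ℂ))).cexp).const_mul (√Real.pi : ℂ)
  refine h.congr_deriv ?_
  simp only [besselE, id]
  ring

theorem hasDerivAt_besselP_index (μ z : ℂ) (x : ℝ) :
    HasDerivAt (fun μ => besselP μ z x) (besselQ μ z x) μ := by
  refine ((hasDerivAt_besselE_index μ x).mul
    (hasDerivAt_besselK_index μ (besselArg z x))).congr_deriv ?_
  rw [besselQ]
  ring

theorem hasDerivAt_besselP₁_index (μ z : ℂ) (x : ℝ) :
    HasDerivAt (fun μ => besselP₁ μ z x) (besselQ₁ μ z x) μ := by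
  have h1 : HasDerivAt (fun μ => besselK (μ + 1) (besselArg z x))
      (besselK' (μ + 1) (besselArg z x)) μ :=
    (hasDerivAt_besselK_index (μ + 1) (besselArg z x)).comp_add_const μ 1
  have h := (hasDerivAt_besselE_index μ x).mul
    ((((((hasDerivAt_id μ).add_const (1 / 2 : ℂ)).div_const (x : ℂ)).mul
      (hasDerivAt_besselK_index μ (besselArg z x))).sub (h1.const_mul (z * x / 2))))
  refine h.congr_deriv ?_
  simp only [Pi.mul_apply, Pi.sub_apply, id, besselQ₁]
  ring

theorem besselE_neg_mul (μ : ℂ) {x : ℝ} (hx : 0 < x) :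
    besselE (-μ) x * besselE μ x = Real.pi * (x / 2 : ℝ) := by
  rw [besselE, besselE, mul_mul_mul_comm, ← Complex.exp_add, ← Complex.ofReal_mul,
    Real.mul_self_sqrt Real.pi_pos.le,
    show (-μ + 1 / 2) * (Real.log (x / 2) : ℂ) + (μ + 1 / 2) * (Real.log (x / 2) : ℂ) =
      (Real.log (x / 2) : ℂ) by ring, ← Complex.ofReal_exp, Real.exp_log (by positivity)]

theorem besselP_wronskian (μ z : ℂ) {x : ℝ} (hx : 0 < x) :
    besselP (-μ) z x * besselP₁ μ z x - besselP₁ (-μ) z x * besselP μ z x =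
      Complex.sin (Real.pi * μ) := by
  have hx' : (x : ℂ) ≠ 0 := by exact_mod_cast hx.ne'
  rw [← besselK_wronskian μ (besselArg z x)]
  have hE := besselE_neg_mul μ hx
  have e : besselArg z x = -z * (x : ℂ) ^ 2 / 4 := rfl
  push_cast at hE
  simp only [besselP, besselP₁]
  generalize besselK μ (besselArg z x) = k0 at *
  generalize besselK (μ + 1) (besselArg z x) = k1 at *
  generalize besselK (-μ) (besselArg z x) = m0 at *
  generalize besselK (-μ + 1) (besselArg z x) = m1 at *
  rw [e]
  generalize besselE μ x = E at *
  generalize besselE (-μ) x = E' at *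
  have h2 : E' * E * (2 * μ / x * (m0 * k0) - z * x / 2 * (m0 * k1 - m1 * k0)) =
      Real.pi * (μ * m0 * k0 + -z * (x : ℂ) ^ 2 / 4 * (m0 * k1 - m1 * k0)) := by
    rw [hE]
    field_simp
    ring
  rw [← h2]
  field_simp
  ring

theorem besselP_neg_nat (n : ℕ) (z : ℂ) {x : ℝ} (hx : 0 < x) :
    besselP (-n) z x = (-z) ^ n * besselP n z x := by
  rw [besselP, besselP, besselK_neg_nat]
  have h : besselE (-n) x * ((x : ℂ) / 2) ^ (2 * n) = besselE n x := by
    have h2 : ((x : ℂ) / 2) ^ (2 * n) = Complex.exp (2 * n * (Real.log (x / 2) : ℂ)) := by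
      rw [show (2 * n * (Real.log (x / 2) : ℂ)) = ((2 * n : ℕ) : ℂ) * (Real.log (x / 2) : ℂ) by
        push_cast; ring, Complex.exp_nat_mul, ← Complex.ofReal_exp, Real.exp_log (by positivity)]
      push_cast
      rfl
    rw [h2, besselE, besselE, mul_assoc, ← Complex.exp_add]
    congr 2
    ring
  rw [← h, show besselArg z x = (-z) * ((x : ℂ) / 2) ^ 2 by rw [besselArg]; ring, mul_pow,
    ← pow_mul]
  ring

theorem besselP₁_neg_nat (n : ℕ) (z : ℂ) {x : ℝ} (hx : 0 < x) :
    besselP₁ (-n) z x = (-z) ^ n * besselP₁ n z x := by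
  refine (hasDerivAt_besselP (-n) z hx).unique
    (((hasDerivAt_besselP n z hx).const_mul ((-z) ^ n)).congr_of_eventuallyEq ?_)
  filter_upwards [lt_mem_nhds hx] with y hy
  exact besselP_neg_nat n z hy

/-- Differentiating the Wronskian identity in the index at an integer. -/
theorem besselQ_wronskian (n : ℕ) (z : ℂ) {x : ℝ} (hx : 0 < x) :
    -(besselQ (-n) z x * besselP₁ n z x - besselQ₁ (-n) z x * besselP n z x) +
      (-z) ^ n * (besselP n z x * besselQ₁ n z x - besselP₁ n z x * besselQ n z x) =
      Real.pi * (-1) ^ n := by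
  have hP := hasDerivAt_besselP_index n z x
  have hP₁ := hasDerivAt_besselP₁_index n z x
  have hM : HasDerivAt (fun μ => besselP (-μ) z x) (-besselQ (-n) z x) (n : ℂ) :=
    ((hasDerivAt_besselP_index (-n) z x).comp (n : ℂ) (hasDerivAt_neg (n : ℂ))).congr_deriv
      (by ring)
  have hM₁ : HasDerivAt (fun μ => besselP₁ (-μ) z x) (-besselQ₁ (-n) z x) (n : ℂ) :=
    ((hasDerivAt_besselP₁_index (-n) z x).comp (n : ℂ) (hasDerivAt_neg (n : ℂ))).congr_deriv
      (by ring)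
  have h := (hM.mul hP₁).sub (hM₁.mul hP)
  have hs : HasDerivAt (fun μ : ℂ => Complex.sin (Real.pi * μ)) (Real.pi * (-1) ^ n) (n : ℂ) := by
    refine (((hasDerivAt_id (n : ℂ)).const_mul (Real.pi : ℂ)).csin).congr_deriv ?_
    rw [show (Real.pi : ℂ) * id (n : ℂ) = ((n * Real.pi : ℝ) : ℂ) by push_cast; simp [mul_comm],
      ← Complex.ofReal_cos, Real.cos_nat_mul_pi]
    push_cast
    ring
  have hu := h.unique (hs.congr_of_eventuallyEq
    (Eventually.of_forall fun μ => besselP_wronskian μ z hx))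
  rw [← hu, besselP_neg_nat n z hx, besselP₁_neg_nat n z hx]
  ring

end BesselSolutions

section FreeSolutions

variable {l : ℝ} {z : ℂ} {x : ℝ}

theorem sqrt_pi_mul_half (hx : 0 < x) :
    (√(Real.pi * x / 2) : ℂ) = √Real.pi * Complex.exp (1 / 2 * (Real.log (x / 2) : ℂ)) := by
  rw [mul_div_assoc, Real.sqrt_mul Real.pi_pos.le, Complex.ofReal_mul,
    Real.sqrt_eq_rpow (x / 2), Real.rpow_def_of_pos (by positivity)]
  push_cast
  congr 2
  ring

theorem log_cpow_half_mul (hz : z ≠ 0) (hx : 0 < x) :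
    Complex.log (z ^ (1 / 2 : ℂ) * (x : ℂ) / 2) = Complex.log z / 2 + Real.log (x / 2) := by
  have e : z ^ (1 / 2 : ℂ) * (x : ℂ) / 2 = ((x / 2 : ℝ) : ℂ) * Complex.exp (Complex.log z / 2) := by
    rw [Complex.cpow_def_of_ne_zero hz, mul_one_div]
    push_cast
    ring
  rw [e, Complex.log_ofReal_mul (by positivity) (Complex.exp_ne_zero _), Complex.log_exp, add_comm]
  · have := Complex.neg_pi_lt_log_im z
    have := Real.pi_pos
    rw [show (Complex.log z / 2).im = (Complex.log z).im / 2 by simp]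
    linarith
  · have := Complex.log_im_le_pi z
    have := Real.pi_pos
    rw [show (Complex.log z / 2).im = (Complex.log z).im / 2 by simp]
    linarith

theorem sqrt_mul_besselJ (hz : z ≠ 0) (hx : 0 < x) (ν : ℝ) :
    (√(Real.pi * x / 2) : ℂ) * besselJ ν (z ^ (1 / 2 : ℂ) * (x : ℂ)) =
      Complex.exp (ν * (Complex.log z / 2)) * besselP ν z x := by
  have hx' : (x : ℂ) ≠ 0 := by exact_mod_cast hx.ne'
  have hw : z ^ (1 / 2 : ℂ) * (x : ℂ) / 2 ≠ 0 :=
    div_ne_zero (mul_ne_zero (by simp [Complex.cpow_eq_zero_iff, hz]) hx') two_ne_zero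
  have key : besselJ ν (z ^ (1 / 2 : ℂ) * (x : ℂ)) =
      Complex.exp (ν * (Complex.log z / 2 + Real.log (x / 2))) * besselK ν (besselArg z x) := by
    rw [besselJ, besselK, expSeries, ← tsum_mul_left]
    refine tsum_congr fun k => ?_
    have e2 : besselArg z x = -Complex.exp (2 * (Complex.log z / 2 + Real.log (x / 2))) := by
      rw [show 2 * (Complex.log z / 2 + (Real.log (x / 2) : ℂ)) =
        Complex.log z + Real.log (x / 2) + Real.log (x / 2) by ring, Complex.exp_add,
        Complex.exp_add, Complex.exp_log hz, ← Complex.ofReal_exp, Real.exp_log (by positivity),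
        besselArg]
      push_cast
      ring
    rw [Complex.cpow_def_of_ne_zero hw, log_cpow_half_mul hz hx, e2, invGamma,
      neg_pow (Complex.exp _), ← Complex.exp_nat_mul]
    generalize Complex.log z / 2 + (Real.log (x / 2) : ℂ) = a
    rw [show a * ((ν : ℂ) + 2 * k) = ν * a + k * (2 * a) by ring, Complex.exp_add]
    field_simp
  rw [key, sqrt_pi_mul_half hx, besselP, besselE, mul_add, add_mul, Complex.exp_add,
    Complex.exp_add]
  ring

theorem phil_eq_besselP (hz : z ≠ 0) (hx : 0 < x) :
    phil l z x = besselP ((l : ℂ) + 1 / 2) z x := by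
  have h := sqrt_mul_besselJ hz hx (l + 1 / 2)
  push_cast at h
  rw [phil, Complex.cpow_def_of_ne_zero hz, mul_right_comm, h, mul_right_comm, ← Complex.exp_add,
    show ((l : ℂ) + 1 / 2) * (Complex.log z / 2) + Complex.log z * (-(2 * (l : ℂ) + 1) / 4) = 0 by
      ring, Complex.exp_zero, one_mul]

theorem thetal_eq_besselP (hz : z ≠ 0) (hx : 0 < x) (hn : ¬ ∃ n : ℕ, l + 1 / 2 = (n : ℝ)) :
    thetal l z x = besselP (-((l : ℂ) + 1 / 2)) z x / (Real.sin ((l + 1 / 2) * Real.pi) : ℂ) := by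
  have h := sqrt_mul_besselJ hz hx (-(l + 1 / 2))
  push_cast at h
  rw [thetal, if_neg hn, Complex.cpow_def_of_ne_zero hz, mul_assoc (Complex.exp _), h, ← mul_assoc,
    ← Complex.exp_add,
    show Complex.log z * ((2 * (l : ℂ) + 1) / 4) + -((l : ℂ) + 1 / 2) * (Complex.log z / 2) = 0 by
      ring, Complex.exp_zero, one_mul]

/-- The limit formula for the Bessel function of the second kind at an integer index. -/
theorem sqrt_mul_besselY (hz : z ≠ 0) (hx : 0 < x) (n : ℕ) :
    (Real.pi : ℂ) * ((√(Real.pi * x / 2) : ℂ) * besselY n (z ^ (1 / 2 : ℂ) * (x : ℂ))) =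
      Complex.exp (n * (Complex.log z / 2)) * (Complex.log z * besselP n z x + besselQ n z x) +
      (-1) ^ n * Complex.exp (-n * (Complex.log z / 2)) * besselQ (-n) z x := by
  set a : ℂ := Complex.log z / 2 with ha
  set s : ℂ := (√(Real.pi * x / 2) : ℂ) with hs
  have hs0 : s ≠ 0 := by
    rw [hs]
    exact_mod_cast (Real.sqrt_pos.2 (by positivity)).ne'
  have hpi : (Real.pi : ℂ) ≠ 0 := by exact_mod_cast Real.pi_ne_zero
  have hea : Complex.exp (n * a) * Complex.exp (n * a) = z ^ n := by
    rw [← Complex.exp_add, show (n : ℂ) * a + n * a = n * Complex.log z by rw [ha]; ring,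
      Complex.exp_nat_mul, Complex.exp_log hz]
  have hea' : Complex.exp (-n * a) * (-z) ^ n = (-1) ^ n * Complex.exp (n * a) := by
    rw [neg_pow, ← hea, show Complex.exp (-n * a) * ((-1) ^ n * (Complex.exp (n * a) *
      Complex.exp (n * a))) = (-1) ^ n * (Complex.exp (-n * a) * Complex.exp (n * a)) *
      Complex.exp (n * a) by ring, ← Complex.exp_add]
    simp
  have hsq : ((-1 : ℂ) ^ n) * (-1) ^ n = 1 := by rw [← mul_pow]; simp
  set N : ℂ → ℂ := fun μ => Complex.exp (μ * a) * besselP μ z x * Complex.cos (μ * Real.pi) -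
    Complex.exp (-μ * a) * besselP (-μ) z x with hN
  set D : ℂ := (-1) ^ n * Complex.exp (n * a) * (2 * a * besselP n z x + besselQ n z x) +
    Complex.exp (-n * a) * besselQ (-n) z x with hD
  have hcos : Complex.cos ((n : ℂ) * Real.pi) = (-1) ^ n := by
    rw [show ((n : ℂ) * Real.pi) = ((n * Real.pi : ℝ) : ℂ) by push_cast; rfl, ← Complex.ofReal_cos,
      Real.cos_nat_mul_pi]
    push_cast
    rfl
  have hsin : Complex.sin ((n : ℂ) * Real.pi) = 0 := by
    rw [show ((n : ℂ) * Real.pi) = ((n * Real.pi : ℝ) : ℂ) by push_cast; rfl, ← Complex.ofReal_sin,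
      Real.sin_nat_mul_pi, Complex.ofReal_zero]
  have hNn : N n = 0 := by
    simp only [hN]
    rw [hcos, besselP_neg_nat n z hx]
    linear_combination -besselP n z x * hea'
  have hNd : HasDerivAt N D n := by
    have h1 := ((hasDerivAt_id (n : ℂ)).mul_const a).cexp
    have h2 := hasDerivAt_besselP_index n z x
    have h3 := ((hasDerivAt_id (n : ℂ)).mul_const (Real.pi : ℂ)).ccos
    have h4 := ((hasDerivAt_neg (n : ℂ)).mul_const a).cexp
    have h5 : HasDerivAt (fun μ => besselP (-μ) z x) (-besselQ (-n) z x) (n : ℂ) :=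
      ((hasDerivAt_besselP_index (-n) z x).comp (n : ℂ) (hasDerivAt_neg (n : ℂ))).congr_deriv
        (by ring)
    refine (((h1.mul h2).mul h3).sub (h4.mul h5)).congr_deriv ?_
    simp only [id, Pi.mul_apply]
    rw [hcos, hsin, hD, besselP_neg_nat n z hx]
    linear_combination a * besselP n z x * hea'
  have hNr : HasDerivAt (fun μ : ℝ => N μ) D (n : ℝ) := by
    have : HasDerivAt N D ((n : ℝ) : ℂ) := by simpa using hNd
    exact this.comp_ofReal
  have hSr : HasDerivAt (fun μ : ℝ => Real.sin (μ * Real.pi)) (Real.pi * (-1) ^ n) (n : ℝ) := by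
    refine (((hasDerivAt_id (n : ℝ)).mul_const Real.pi).sin).congr_deriv ?_
    simp only [id]
    rw [Real.cos_nat_mul_pi]
    ring
  have hc0 : Real.pi * (-1) ^ n ≠ 0 := mul_ne_zero Real.pi_ne_zero (pow_ne_zero _ (by norm_num))
  have hset : 𝓝[{μ : ℝ | Real.sin (μ * Real.pi) ≠ 0}] (n : ℝ) = 𝓝[≠] (n : ℝ) := by
    refine le_antisymm (nhdsWithin_mono _ fun μ hμ h => hμ ?_)
      (nhdsWithin_le_of_mem (hSr.eventually_ne hc0))
    rw [mem_singleton_iff.1 h, Real.sin_nat_mul_pi]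
  have hlim : Tendsto (fun μ : ℝ => (besselJ μ (z ^ (1 / 2 : ℂ) * (x : ℂ)) *
      Real.cos (μ * Real.pi) - besselJ (-μ) (z ^ (1 / 2 : ℂ) * (x : ℂ))) /
      (Real.sin (μ * Real.pi) : ℂ)) (𝓝[≠] (n : ℝ))
      (𝓝 (D / s / ((Real.pi * (-1) ^ n : ℝ) : ℂ))) := by
    have t1 := (hasDerivAt_iff_tendsto_slope.1 hNr).div_const s
    have t2 := (Complex.continuous_ofReal.tendsto _).comp (hasDerivAt_iff_tendsto_slope.1 hSr)
    refine (t1.div t2 (by exact_mod_cast hc0)).congr' ?_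
    filter_upwards [self_mem_nhdsWithin] with μ hμ
    have hμn : ((μ : ℂ) - n) ≠ 0 := by
      rw [sub_ne_zero]
      exact_mod_cast hμ
    have j1 : besselJ μ (z ^ (1 / 2 : ℂ) * (x : ℂ)) =
        Complex.exp (μ * a) * besselP μ z x / s := by
      rw [eq_div_iff hs0, ← sqrt_mul_besselJ hz hx, mul_comm]
    have j2 : besselJ (-μ) (z ^ (1 / 2 : ℂ) * (x : ℂ)) =
        Complex.exp (-μ * a) * besselP (-μ) z x / s := by
      have := sqrt_mul_besselJ hz hx (-μ)
      push_cast at this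
      rw [eq_div_iff hs0, ← this, mul_comm]
    rw [j1, j2]
    simp only [Function.comp_apply, slope_def_module, Complex.real_smul, smul_eq_mul,
      Pi.div_apply]
    rw [show N ((n : ℝ) : ℂ) = 0 by simpa using hNn, Real.sin_nat_mul_pi]
    simp only [hN]
    push_cast
    rw [sub_zero, sub_zero, mul_div_assoc, mul_div_mul_left _ _ (inv_ne_zero hμn)]
    congr 1
    ring
  have hY : besselY n (z ^ (1 / 2 : ℂ) * (x : ℂ)) = D / s / ((Real.pi * (-1) ^ n : ℝ) : ℂ) := by
    rw [besselY, if_neg (by rw [Real.sin_nat_mul_pi]; simp), hset]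
    exact hlim.limUnder_eq
  have h1n : ((-1 : ℂ) ^ n) ≠ 0 := pow_ne_zero _ (by norm_num)
  rw [hY, show Complex.log z = 2 * a by rw [ha]; ring]
  push_cast
  have : (Real.pi : ℂ) * (s * (D / s / (Real.pi * (-1) ^ n))) = (-1) ^ n * D := by
    field_simp
    linear_combination -D * hsq
  rw [this, hD]
  linear_combination (Complex.exp (n * a) * (2 * a * besselP n z x + besselQ n z x)) * hsq

theorem thetal_eq_besselQ (hz : z ≠ 0) (hx : 0 < x) {n : ℕ} (hn : l + 1 / 2 = (n : ℝ)) :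
    thetal l z x =
      -(1 / Real.pi) * (z ^ n * besselQ n z x + (-1) ^ n * besselQ (-n) z x) := by
  have hpi : (Real.pi : ℂ) ≠ 0 := by exact_mod_cast Real.pi_ne_zero
  have hl : (l : ℂ) = n - 1 / 2 := by
    have h := congrArg (fun r : ℝ => (r : ℂ)) hn
    push_cast at h
    linear_combination h
  have hY := sqrt_mul_besselY hz hx n
  have hJ := sqrt_mul_besselJ hz hx n
  rw [thetal, if_pos ⟨n, hn⟩, hn, Complex.cpow_def_of_ne_zero hz,
    show Complex.log z * ((2 * (l : ℂ) + 1) / 4) = n * (Complex.log z / 2) by rw [hl]; ring]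
  have hea : Complex.exp (n * (Complex.log z / 2)) * Complex.exp (n * (Complex.log z / 2)) =
      z ^ n := by
    rw [← Complex.exp_add, show (n : ℂ) * (Complex.log z / 2) + n * (Complex.log z / 2) =
      n * Complex.log z by ring, Complex.exp_nat_mul, Complex.exp_log hz]
  have hea' : Complex.exp (n * (Complex.log z / 2)) * Complex.exp (-n * (Complex.log z / 2)) =
      1 := by
    rw [← Complex.exp_add]
    simp
  rw [Complex.ofReal_natCast] at hJ
  have e : (Real.pi : ℂ) * (Complex.exp (n * (Complex.log z / 2)) * (√(Real.pi * x / 2) : ℂ) *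
      (besselY n (z ^ (1 / 2 : ℂ) * (x : ℂ)) - 1 / (Real.pi : ℂ) * Complex.log z *
        besselJ n (z ^ (1 / 2 : ℂ) * (x : ℂ)))) =
      z ^ n * besselQ n z x + (-1) ^ n * besselQ (-n) z x := by
    generalize Complex.exp (n * (Complex.log z / 2)) = E at *
    generalize Complex.exp (-n * (Complex.log z / 2)) = E' at *
    field_simp
    linear_combination E * hY - E * Complex.log z * hJ + besselQ n z x * hea +
      (-1) ^ n * besselQ (-n) z x * hea'
  rw [← e]
  field_simp

/-- The regular solution, divided by `x ^ (l + 1)`. -/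
noncomputable def philQuot (l : ℝ) (z : ℂ) (x : ℝ) : ℂ :=
  (√Real.pi : ℂ) * Complex.exp (((l : ℂ) + 1) * -(Real.log 2 : ℂ)) *
    besselK ((l : ℂ) + 1 / 2) (besselArg z x)

theorem phil_eq_rpow_mul (hz : z ≠ 0) (hx : 0 < x) :
    phil l z x = ((x ^ (l + 1) : ℝ) : ℂ) * philQuot l z x := by
  rw [phil_eq_besselP hz hx, besselP, besselE, philQuot, Real.log_div hx.ne' two_ne_zero,
    Real.rpow_def_of_pos hx, show ((l : ℂ) + 1 / 2 + 1 / 2) = (l : ℂ) + 1 by ring]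
  push_cast
  rw [sub_eq_add_neg, mul_add, Complex.exp_add, mul_comm (Real.log x : ℂ)]
  ring

theorem continuous_philQuot (l : ℝ) (z : ℂ) : Continuous (philQuot l z) :=
  continuous_const.mul (continuous_iff_continuousAt.2 fun x =>
    (hasDerivAt_besselK_arg _ z x).continuousAt)

theorem philQuot_zero_ne_zero (hl : -(1 : ℝ) / 2 ≤ l) (z : ℂ) : philQuot l z 0 ≠ 0 := by
  have hpi : (√Real.pi : ℂ) ≠ 0 := by exact_mod_cast (Real.sqrt_pos.2 Real.pi_pos).ne'
  refine mul_ne_zero (mul_ne_zero hpi (Complex.exp_ne_zero _)) ?_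
  rw [show besselArg z 0 = 0 by simp [besselArg], besselK_zero_right, invGamma]
  refine inv_ne_zero (Complex.Gamma_ne_zero_of_re_pos ?_)
  simp
  linarith

/-- `P₁` and `T₁` are the derivatives of the unperturbed solutions `phil l z` and `thetal l z`,
which form a fundamental system with Wronskian one. -/
structure FreeDerivs (l : ℝ) (z : ℂ) (P₁ T₁ : ℝ → ℂ) : Prop where
  phil_deriv : ∀ x : ℝ, 0 < x → HasDerivAt (phil l z) (P₁ x) x
  phil_ode : ∀ x : ℝ, 0 < x →
    HasDerivAt P₁ ((((l * (l + 1) / x ^ 2 : ℝ) : ℂ) - z) * phil l z x) x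
  thetal_deriv : ∀ x : ℝ, 0 < x → HasDerivAt (thetal l z) (T₁ x) x
  thetal_ode : ∀ x : ℝ, 0 < x →
    HasDerivAt T₁ ((((l * (l + 1) / x ^ 2 : ℝ) : ℂ) - z) * thetal l z x) x
  wronskian : ∀ x : ℝ, 0 < x → thetal l z x * P₁ x - T₁ x * phil l z x = 1

theorem exists_freeDerivs (hl : -(1 : ℝ) / 2 ≤ l) (hz : z ≠ 0) :
    ∃ P₁ T₁ : ℝ → ℂ, FreeDerivs l z P₁ T₁ := by
  have hpi : (Real.pi : ℂ) ≠ 0 := by exact_mod_cast Real.pi_ne_zero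
  have hphi : ∀ x : ℝ, 0 < x → phil l z =ᶠ[𝓝 x] besselP ((l : ℂ) + 1 / 2) z := fun x hx => by
    filter_upwards [lt_mem_nhds hx] with y hy
    exact phil_eq_besselP hz hy
  have hV : ∀ x : ℝ, ((((l : ℂ) + 1 / 2) ^ 2 - 1 / 4) / (x : ℂ) ^ 2 - z) =
      ((l * (l + 1) / x ^ 2 : ℝ) : ℂ) - z := fun x => by
    push_cast
    ring
  suffices H : ∃ P₁ T₁ : ℝ → ℂ, ∀ x : ℝ, 0 < x →
      HasDerivAt (phil l z) (P₁ x) x ∧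
      HasDerivAt P₁ ((((l * (l + 1) / x ^ 2 : ℝ) : ℂ) - z) * phil l z x) x ∧
      HasDerivAt (thetal l z) (T₁ x) x ∧
      HasDerivAt T₁ ((((l * (l + 1) / x ^ 2 : ℝ) : ℂ) - z) * thetal l z x) x ∧
      thetal l z x * P₁ x - T₁ x * phil l z x = 1 by
    obtain ⟨P₁, T₁, H⟩ := H
    exact ⟨P₁, T₁, fun x hx => (H x hx).1, fun x hx => (H x hx).2.1, fun x hx => (H x hx).2.2.1,
      fun x hx => (H x hx).2.2.2.1, fun x hx => (H x hx).2.2.2.2⟩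
  by_cases hn : ∃ n : ℕ, l + 1 / 2 = (n : ℝ)
  · obtain ⟨n, hn⟩ := hn
    have hln : (l : ℂ) + 1 / 2 = n := by
      have h := congrArg (fun r : ℝ => (r : ℂ)) hn
      push_cast at h
      exact h
    rw [hln] at hphi hV
    refine ⟨besselP₁ n z, fun x => -(1 / Real.pi) * (z ^ n * besselQ₁ n z x +
      (-1) ^ n * besselQ₁ (-n) z x), fun x hx => ?_⟩
    have hx' : (x : ℂ) ≠ 0 := by exact_mod_cast hx.ne'
    have hP := (hphi x hx).eq_of_nhds
    have hT := thetal_eq_besselQ hz hx hn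
    refine ⟨(hasDerivAt_besselP _ z hx).congr_of_eventuallyEq (hphi x hx), ?_, ?_, ?_, ?_⟩
    · rw [hP, ← hV]
      exact hasDerivAt_besselP₁ _ z hx
    · refine ((((hasDerivAt_besselQ n z hx).const_mul (z ^ n)).add
        ((hasDerivAt_besselQ (-n) z hx).const_mul ((-1) ^ n))).const_mul
          (-(1 / (Real.pi : ℂ)))).congr_of_eventuallyEq ?_
      filter_upwards [lt_mem_nhds hx] with y hy
      exact thetal_eq_besselQ hz hy hn
    · refine ((((hasDerivAt_besselQ₁ n z hx).const_mul (z ^ n)).add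
        ((hasDerivAt_besselQ₁ (-n) z hx).const_mul ((-1) ^ n))).const_mul
          (-(1 / (Real.pi : ℂ)))).congr_deriv ?_
      rw [hT, ← hV, besselP_neg_nat n z hx, neg_pow z n]
      have hsq : ((-1 : ℂ) ^ n) * (-1) ^ n = 1 := by rw [← mul_pow]; simp
      linear_combination (1 / (Real.pi : ℂ)) * (2 * n / (x : ℂ) ^ 2) * z ^ n * besselP n z x * hsq
    · have hW := besselQ_wronskian n z hx
      rw [hT, hP]
      have hsq : ((-1 : ℂ) ^ n) * (-1) ^ n = 1 := by rw [← mul_pow]; simp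
      rw [neg_pow z n] at hW
      field_simp
      linear_combination (-1) ^ n * hW + (Real.pi + z ^ n * (besselQ n z x * besselP₁ n z x -
        besselQ₁ n z x * besselP n z x)) * hsq
  · have hsin : (Real.sin ((l + 1 / 2) * Real.pi) : ℂ) ≠ 0 := by
      norm_cast
      rw [← ne_eq, Real.sin_ne_zero_iff]
      intro k hk
      have hk' : (k : ℝ) = l + 1 / 2 := mul_right_cancel₀ Real.pi_ne_zero hk
      have hk0 : 0 ≤ k := by
        have : (0 : ℝ) ≤ k := by rw [hk']; linarith
        exact_mod_cast this
      lift k to ℕ using hk0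
      exact hn ⟨k, by rw [← hk']; simp⟩
    have hV' : ∀ x : ℝ, (((-((l : ℂ) + 1 / 2)) ^ 2 - 1 / 4) / (x : ℂ) ^ 2 - z) =
      ((l * (l + 1) / x ^ 2 : ℝ) : ℂ) - z := fun x => by rw [neg_sq, hV]
    refine ⟨besselP₁ ((l : ℂ) + 1 / 2) z, fun x => besselP₁ (-((l : ℂ) + 1 / 2)) z x /
      (Real.sin ((l + 1 / 2) * Real.pi) : ℂ), fun x hx => ?_⟩
    have hP := (hphi x hx).eq_of_nhds
    have hT := thetal_eq_besselP hz hx hn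
    refine ⟨(hasDerivAt_besselP _ z hx).congr_of_eventuallyEq (hphi x hx), ?_, ?_, ?_, ?_⟩
    · rw [hP, ← hV]
      exact hasDerivAt_besselP₁ _ z hx
    · refine ((hasDerivAt_besselP _ z hx).div_const _).congr_of_eventuallyEq ?_
      filter_upwards [lt_mem_nhds hx] with y hy
      exact thetal_eq_besselP hz hy hn
    · refine ((hasDerivAt_besselP₁ _ z hx).div_const _).congr_deriv ?_
      rw [hT, ← hV']
      ring
    · rw [hT, hP]
      have hW := besselP_wronskian ((l : ℂ) + 1 / 2) z hx
      have e : Complex.sin (Real.pi * ((l : ℂ) + 1 / 2)) =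
          (Real.sin ((l + 1 / 2) * Real.pi) : ℂ) := by
        push_cast
        rw [mul_comm]
      rw [e] at hW
      rw [div_mul_eq_mul_div, div_mul_eq_mul_div, ← sub_div, hW, div_self hsin]

end FreeSolutions

section Volterra

variable {l : ℝ} {q : ℝ → ℝ} {z : ℂ} {φ : ℂ → ℝ → ℂ} {P₁ T₁ : ℝ → ℂ}

theorem eq_zero_of_data_one (h : WPot (2 * l + 2) q) {u v : ℝ → ℂ} {a : ℝ} (ha : 0 < a)
    (hs : SLSol (fullPot l q) z u v a 1) (hu : u 1 = 0) (hv : v 1 = 0) : u a = 0 ∧ v a = 0 := by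
  have hT : 0 ≤ 1 - a := by linarith [hs.fst.le]
  have hT1 : 1 - a < 1 := by linarith
  obtain ⟨c, c', s, s', B, H⟩ := exists_fundamental_system hT hT1.le
    (measurable_fullPot_reflect h) (intervalIntegrable_fullPot_reflect h hT hT1)
  have hr := hs.reflect
  rw [sub_self] at hr
  have e := hr.eq_combination (H z).1.1 (H z).2.1.1 (H z).1.2.1
    (H z).1.2.2 (H z).2.1.2.1 (H z).2.1.2.2 (x := 1 - a) ⟨hT, le_rfl⟩
  simpa [hu, hv] using e

namespace FreeDerivs

theorem continuousOn_phil (hF : FreeDerivs l z P₁ T₁) : ContinuousOn (phil l z) (Ioi 0) :=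
  fun x hx => (hF.phil_deriv x hx).continuousAt.continuousWithinAt

theorem continuousOn_thetal (hF : FreeDerivs l z P₁ T₁) : ContinuousOn (thetal l z) (Ioi 0) :=
  fun x hx => (hF.thetal_deriv x hx).continuousAt.continuousWithinAt

theorem continuousOn_P₁ (hF : FreeDerivs l z P₁ T₁) : ContinuousOn P₁ (Ioi 0) :=
  fun x hx => (hF.phil_ode x hx).continuousAt.continuousWithinAt

theorem continuousOn_T₁ (hF : FreeDerivs l z P₁ T₁) : ContinuousOn T₁ (Ioi 0) :=
  fun x hx => (hF.thetal_ode x hx).continuousAt.continuousWithinAt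

theorem exists_green_ne_zero (hF : FreeDerivs l z P₁ T₁) :
    ∃ a ∈ Ioo (0 : ℝ) 1, phil l z 1 * thetal l z a - phil l z a * thetal l z 1 ≠ 0 := by
  have hd := ((hF.thetal_deriv 1 one_pos).const_mul (phil l z 1)).sub
    ((hF.phil_deriv 1 one_pos).mul_const (thetal l z 1))
  have hne : phil l z 1 * T₁ 1 - P₁ 1 * thetal l z 1 ≠ 0 := by
    rw [show phil l z 1 * T₁ 1 - P₁ 1 * thetal l z 1 = -1 by
      linear_combination -hF.wronskian 1 one_pos]
    norm_num
  have h1 : ∀ᶠ a in 𝓝[<] (1 : ℝ),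
      phil l z 1 * thetal l z a - phil l z a * thetal l z 1 ≠ 0 :=
    (hd.eventually_ne hne (c := 0)).filter_mono
      (nhdsWithin_mono _ fun y hy => ne_of_lt (mem_Iio.1 hy))
  obtain ⟨a, h2, h3⟩ := (h1.and (Ioo_mem_nhdsLT (zero_lt_one (α := ℝ)))).exists
  exact ⟨a, h3, h2⟩

theorem integrableOn_mul (hF : FreeDerivs l z P₁ T₁) (h : WPot (2 * l + 2) q)
    (hφ : IsSol l q φ) :
    IntegrableOn (fun y => phil l z y * ((q y : ℂ) * φ z y)) (Ioo 0 1) ∧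
      IntegrableOn (fun y => thetal l z y * ((q y : ℂ) * φ z y)) (Ioo 0 1) := by
  obtain ⟨a, ha, hg⟩ := hF.exists_green_ne_zero
  set g := phil l z 1 * thetal l z a - phil l z a * thetal l z 1 with hgdef
  have i1 := ((hφ.2 z 1 (by simp)).1).mono_set (Ioo_subset_Ioo_right ha.2.le)
  have i2 := (hφ.2 z a ⟨ha.1, ha.2.le⟩).1
  have hq : IntegrableOn (fun y => (q y : ℂ)) (Ioc a 1) := by
    have := (intervalIntegrable_pot h ha.1 ha.2.le).1
    exact this.ofReal
  have hcont : ∀ {f : ℝ → ℂ}, ContinuousOn f (Ioi 0) →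
      IntegrableOn (fun y => f y * ((q y : ℂ) * φ z y)) (Icc a 1) := by
    intro f hf
    have hq' : IntegrableOn (fun y => (q y : ℂ)) (Icc a 1) :=
      (integrableOn_Icc_iff_integrableOn_Ioc).2 hq
    exact (hq'.mul_continuousOn ((hφ.1 z).mono fun y hy => ⟨ha.1.trans_le hy.1, hy.2⟩)
      isCompact_Icc).continuousOn_mul (hf.mono fun y hy => ha.1.trans_le hy.1) isCompact_Icc
  have hsub : Ioo (0 : ℝ) 1 ⊆ Ioo 0 a ∪ Icc a 1 := fun y hy => by
    rcases lt_or_ge y a with h | h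
    · exact Or.inl ⟨hy.1, h⟩
    · exact Or.inr ⟨h, hy.2.le⟩
  refine ⟨(IntegrableOn.union ?_ (hcont hF.continuousOn_phil)).mono_set hsub,
    (IntegrableOn.union ?_ (hcont hF.continuousOn_thetal)).mono_set hsub⟩
  · refine ((((i1.const_mul (phil l z a)).sub (i2.const_mul (phil l z 1))).const_mul g⁻¹)).congr ?_
    refine Eventually.of_forall fun y => ?_
    simp only [Pi.sub_apply, Greenl]
    field_simp
    rw [hgdef]
    ring
  · refine ((((i1.const_mul (thetal l z a)).sub
      (i2.const_mul (thetal l z 1))).const_mul g⁻¹)).congr ?_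
    refine Eventually.of_forall fun y => ?_
    simp only [Pi.sub_apply, Greenl]
    field_simp
    rw [hgdef]
    ring

end FreeDerivs

/-- Variation of constants: the coefficient of `phil`. -/
noncomputable def coeffA (l : ℝ) (q : ℝ → ℝ) (φ : ℂ → ℝ → ℂ) (z : ℂ) (x : ℝ) : ℂ :=
  1 + ∫ y in (0 : ℝ)..x, thetal l z y * ((q y : ℂ) * φ z y)

/-- Variation of constants: minus the coefficient of `thetal`. -/
noncomputable def coeffB (l : ℝ) (q : ℝ → ℝ) (φ : ℂ → ℝ → ℂ) (z : ℂ) (x : ℝ) : ℂ :=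
  ∫ y in (0 : ℝ)..x, phil l z y * ((q y : ℂ) * φ z y)

namespace FreeDerivs

theorem isSol_eq (hF : FreeDerivs l z P₁ T₁) (h : WPot (2 * l + 2) q) (hφ : IsSol l q φ)
    {x : ℝ} (hx : x ∈ Ioc (0 : ℝ) 1) :
    φ z x = phil l z x * coeffA l q φ z x - thetal l z x * coeffB l q φ z x := by
  obtain ⟨iP, iT⟩ := hF.integrableOn_mul h hφ
  have e := (hφ.2 z x hx).2
  have e2 : ∫ y in Ioo (0 : ℝ) x, Greenl l z x y * (q y : ℂ) * φ z y =
      phil l z x * (∫ y in Ioo (0 : ℝ) x, thetal l z y * ((q y : ℂ) * φ z y)) -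
      thetal l z x * ∫ y in Ioo (0 : ℝ) x, phil l z y * ((q y : ℂ) * φ z y) := by
    rw [← integral_const_mul, ← integral_const_mul, ← integral_sub]
    · refine integral_congr_ae (Eventually.of_forall fun y => ?_)
      simp only [Greenl]
      ring
    · exact (iT.mono_set (Ioo_subset_Ioo_right hx.2)).const_mul _
    · exact (iP.mono_set (Ioo_subset_Ioo_right hx.2)).const_mul _
  rw [coeffA, coeffB, intervalIntegral.integral_of_le hx.1.le,
    intervalIntegral.integral_of_le hx.1.le, integral_Ioc_eq_integral_Ioo,
    integral_Ioc_eq_integral_Ioo, mul_add, mul_one, add_sub_assoc, ← e2]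
  exact e

theorem isPrim_coeff (hF : FreeDerivs l z P₁ T₁) (h : WPot (2 * l + 2) q) (hφ : IsSol l q φ)
    {a : ℝ} (ha : 0 ≤ a) (ha1 : a ≤ 1) :
    IsPrim (coeffA l q φ z) (fun y => thetal l z y * ((q y : ℂ) * φ z y)) a 1 ∧
      IsPrim (coeffB l q φ z) (fun y => phil l z y * ((q y : ℂ) * φ z y)) a 1 := by
  obtain ⟨iP, iT⟩ := hF.integrableOn_mul h hφ
  refine ⟨?_, WPot.isPrim_primitive iP ha ha1⟩
  exact ((IsPrim.const ha1 1).add (WPot.isPrim_primitive iT ha ha1)).congr_deriv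
    fun x _ => zero_add _

theorem slSol (hF : FreeDerivs l z P₁ T₁) (h : WPot (2 * l + 2) q) (hφ : IsSol l q φ)
    {a : ℝ} (ha : 0 < a) (ha1 : a ≤ 1) :
    SLSol (fullPot l q) z (φ z)
      (fun x => P₁ x * coeffA l q φ z x - T₁ x * coeffB l q φ z x) a 1 := by
  obtain ⟨pA, pB⟩ := hF.isPrim_coeff h hφ ha.le ha1
  have hpos : ∀ {x : ℝ}, x ∈ Icc a 1 → 0 < x := fun hx => ha.trans_le hx.1
  have hV : ContinuousOn (fun x : ℝ => (((l * (l + 1) / x ^ 2 : ℝ) : ℂ) - z)) (Icc a 1) := by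
    refine (Complex.continuous_ofReal.comp_continuousOn ?_).sub continuousOn_const
    exact continuousOn_const.div (by fun_prop) fun x hx => pow_ne_zero 2 (hpos hx).ne'
  have pP : IsPrim (phil l z) P₁ a 1 := IsPrim.of_hasDerivAt ha1
    (fun x hx => hF.phil_deriv x (hpos hx)) (hF.continuousOn_P₁.mono fun x hx => hpos hx)
  have pT : IsPrim (thetal l z) T₁ a 1 := IsPrim.of_hasDerivAt ha1
    (fun x hx => hF.thetal_deriv x (hpos hx)) (hF.continuousOn_T₁.mono fun x hx => hpos hx)
  have pP₁ := IsPrim.of_hasDerivAt ha1 (fun x hx => hF.phil_ode x (hpos hx))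
    (hV.mul (hF.continuousOn_phil.mono fun x hx => hpos hx))
  have pT₁ := IsPrim.of_hasDerivAt ha1 (fun x hx => hF.thetal_ode x (hpos hx))
    (hV.mul (hF.continuousOn_thetal.mono fun x hx => hpos hx))
  constructor
  · refine (((pP.mul pA).sub (pT.mul pB)).congr_deriv fun x hx => ?_).congr fun x hx => ?_
    · ring
    · exact (hF.isSol_eq h hφ ⟨hpos hx, hx.2⟩).symm
  · refine ((pP₁.mul pA).sub (pT₁.mul pB)).congr_deriv fun x hx => ?_
    have e := hF.isSol_eq h hφ ⟨hpos hx, hx.2⟩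
    have w := hF.wronskian x (hpos hx)
    simp only [fullPot, Complex.ofReal_add]
    linear_combination (q x : ℂ) * φ z x * w -
      (((l * (l + 1) / x ^ 2 : ℝ) : ℂ) - z) * e

theorem derivWithin_eq (hF : FreeDerivs l z P₁ T₁) (h : WPot (2 * l + 2) q) (hφ : IsSol l q φ) :
    derivWithin (φ z) (Ioc 0 1) 1 = P₁ 1 * coeffA l q φ z 1 - T₁ 1 * coeffB l q φ z 1 := by
  have hs := hF.slSol h hφ (a := 1 / 2) (by norm_num) (by norm_num)
  have hd := hs.fst.hasDerivWithinAt_right (by norm_num) hs.snd.continuousOn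
  exact (hd.mono Ioc_subset_Iic_self).derivWithin
    (uniqueDiffOn_Ioc 0 1 1 (by simp))

theorem tendsto_coeff (hF : FreeDerivs l z P₁ T₁) (h : WPot (2 * l + 2) q) (hφ : IsSol l q φ) :
    Tendsto (coeffA l q φ z) (𝓝[>] 0) (𝓝 1) ∧ Tendsto (coeffB l q φ z) (𝓝[>] 0) (𝓝 0) := by
  obtain ⟨pA, pB⟩ := hF.isPrim_coeff h hφ le_rfl zero_le_one
  have hle : 𝓝[>] (0 : ℝ) ≤ 𝓝[Icc 0 1] 0 :=
    nhdsWithin_le_of_mem (mem_of_superset (Ioo_mem_nhdsGT one_pos) Ioo_subset_Icc_self)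
  have tA := (pA.continuousOn 0 (by simp)).tendsto.mono_left hle
  have tB := (pB.continuousOn 0 (by simp)).tendsto.mono_left hle
  simp only [coeffA, coeffB, intervalIntegral.integral_same, add_zero] at tA tB
  exact ⟨tA, tB⟩

/-- The derivative of `philQuot`, divided by `x`. -/
theorem exists_philQuot_deriv (l : ℝ) (z : ℂ) : ∃ g : ℝ → ℂ, Continuous g ∧
    ∀ x : ℝ, HasDerivAt (philQuot l z) (x * g x) x := by
  refine ⟨fun x => (√Real.pi : ℂ) * Complex.exp (((l : ℂ) + 1) * -(Real.log 2 : ℂ)) *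
    (besselK ((l : ℂ) + 1 / 2 + 1) (besselArg z x) * -(z / 2)), ?_, fun x => ?_⟩
  · exact continuous_const.mul ((continuous_iff_continuousAt.2 fun x =>
      (hasDerivAt_besselK_arg _ z x).continuousAt).mul continuous_const)
  · refine ((hasDerivAt_besselK_arg _ z x).const_mul _).congr_deriv ?_
    ring

theorem tendsto_wronskian_phil (hF : FreeDerivs l z P₁ T₁) (hz : z ≠ 0)
    (h : WPot (2 * l + 2) q) :
    Tendsto (fun x => (phil l z x * regV h z x - P₁ x * regU h z x) *
      ((1 - wS (2 * l + 2) x : ℝ) : ℂ)) (𝓝[>] 0) (𝓝 0) := by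
  obtain ⟨g, hgc, hg⟩ := exists_philQuot_deriv l z
  have t1 : Tendsto (fun x => h.quasi 1 z x * ((1 - wS (2 * l + 2) x : ℝ) : ℂ)) (𝓝[>] 0)
      (𝓝 0) := by
    rw [tendsto_zero_iff_norm_tendsto_zero]
    refine (tendsto_quasi_mul h z).congr' ?_
    filter_upwards [Ioo_mem_nhdsGT (zero_lt_one (α := ℝ))] with x hx
    rw [norm_mul, Complex.norm_real, Real.norm_of_nonneg
      (by linarith [wS_nonpos (m := 2 * l + 2) hx.1 hx.2.le])]
  have tk : Tendsto (philQuot l z) (𝓝[>] 0) (𝓝 (philQuot l z 0)) :=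
    ((continuous_philQuot l z).tendsto 0).mono_left nhdsWithin_le_nhds
  have t2 : Tendsto (fun x : ℝ => (x : ℂ) * g x * h.sol 1 z x) (𝓝[>] 0) (𝓝 0) := by
    have h1 : Tendsto (fun x : ℝ => (x : ℂ) * g x) (𝓝[>] 0) (𝓝 (((0 : ℝ) : ℂ) * g 0)) :=
      ((Complex.continuous_ofReal.mul hgc).tendsto 0).mono_left nhdsWithin_le_nhds
    simpa using h1.mul (tendsto_sol_one h z)
  have t3 : Tendsto (fun x : ℝ => ((x ^ (2 * l + 2) * (1 - wS (2 * l + 2) x) : ℝ) : ℂ) *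
      ((x : ℂ) * g x * h.sol 1 z x)) (𝓝[>] 0) (𝓝 0) := by
    have t2' := t2.norm.const_mul 2
    rw [norm_zero, mul_zero] at t2'
    refine squeeze_zero_norm' ?_ t2'
    filter_upwards [Ioo_mem_nhdsGT (zero_lt_one (α := ℝ))] with x hx
    rw [norm_mul, Complex.norm_real, Real.norm_of_nonneg (WPot.weight_nonneg hx)]
    exact mul_le_mul_of_nonneg_right (rpow_mul_one_sub_wS_le h.hm hx.1 hx.2.le) (norm_nonneg _)
  have t4 := (tk.mul t1).sub t3
  rw [mul_zero, sub_zero] at t4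
  refine t4.congr' ?_
  filter_upwards [Ioo_mem_nhdsGT (zero_lt_one (α := ℝ))] with x hx
  have hP₁ : P₁ x = (((l + 1) * x ^ l : ℝ) : ℂ) * philQuot l z x +
      ((x ^ (l + 1) : ℝ) : ℂ) * (x * g x) := by
    have hr : HasDerivAt (fun x : ℝ => ((x ^ (l + 1) : ℝ) : ℂ)) (((l + 1) * x ^ l : ℝ) : ℂ) x := by
      have := (Real.hasDerivAt_rpow_const (x := x) (p := l + 1) (Or.inl hx.1.ne')).ofReal_comp
      rwa [add_sub_cancel_right] at this
    refine (hF.phil_deriv x hx.1).unique ((hr.mul (hg x)).congr_of_eventuallyEq ?_)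
    filter_upwards [lt_mem_nhds hx.1] with y hy
    exact phil_eq_rpow_mul hz hy
  have e1 : ((x ^ (l + 1) : ℝ) : ℂ) * ((x ^ (-l - 1) : ℝ) : ℂ) = 1 := by
    rw [← Complex.ofReal_mul, ← Real.rpow_add hx.1]
    simp
  have e2 : ((x ^ (2 * l + 2) : ℝ) : ℂ) = ((x ^ (l + 1) : ℝ) : ℂ) * ((x ^ (l + 1) : ℝ) : ℂ) := by
    rw [← Complex.ofReal_mul, ← Real.rpow_add hx.1]
    congr 2
    ring
  rw [Complex.ofReal_mul (x ^ (2 * l + 2)), e2, hP₁, phil_eq_rpow_mul hz hx.1, regU, regV]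
  linear_combination -philQuot l z x * h.quasi 1 z x * ((1 - wS (2 * l + 2) x : ℝ) : ℂ) * e1

theorem exists_ratio_bound (hF : FreeDerivs l z P₁ T₁) (hl : -(1 : ℝ) / 2 ≤ l) (hz : z ≠ 0) :
    ∃ C : ℝ, ∀ᶠ x in 𝓝[>] (0 : ℝ), phil l z x ≠ 0 ∧
      ‖thetal l z x / phil l z x‖ ≤ C * (1 - wS (2 * l + 2) x) := by
  have hk0 := norm_pos_iff.2 (philQuot_zero_ne_zero hl z)
  set c := ‖philQuot l z 0‖ / 2 with hc
  have hcpos : 0 < c := half_pos hk0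
  have hev : ∀ᶠ x in 𝓝 (0 : ℝ), c < ‖philQuot l z x‖ :=
    (continuous_philQuot l z).norm.tendsto 0 |>.eventually (lt_mem_nhds (half_lt_self hk0))
  obtain ⟨ε, hε, hball⟩ := Metric.eventually_nhds_iff.1 hev
  set δ := min (ε / 2) 1 with hδ
  have hδ0 : 0 < δ := lt_min (half_pos hε) one_pos
  have hδ1 : δ ≤ 1 := min_le_right _ _
  have hkb : ∀ x, 0 < x → x ≤ δ → c < ‖philQuot l z x‖ := by
    intro x hx hxδ
    refine hball ?_
    rw [Real.dist_eq, sub_zero, abs_of_pos hx]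
    have : δ ≤ ε / 2 := min_le_left _ _
    linarith
  have hPn : ∀ x, 0 < x → ‖phil l z x‖ = x ^ (l + 1) * ‖philQuot l z x‖ := by
    intro x hx
    rw [phil_eq_rpow_mul hz hx, norm_mul, Complex.norm_real,
      Real.norm_of_nonneg (Real.rpow_nonneg hx.le _)]
  have hP0 : ∀ x, 0 < x → x ≤ δ → phil l z x ≠ 0 := by
    intro x hx hxδ
    rw [← norm_pos_iff, hPn x hx]
    exact mul_pos (Real.rpow_pos_of_pos hx _) (hcpos.trans (hkb x hx hxδ))
  set r : ℝ → ℂ := fun x => thetal l z x / phil l z x with hr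
  have hrd : ∀ x, 0 < x → x ≤ δ → HasDerivAt r (-1 / phil l z x ^ 2) x := by
    intro x hx hxδ
    refine ((hF.thetal_deriv x hx).div (hF.phil_deriv x hx) (hP0 x hx hxδ)).congr_deriv ?_
    congr 1
    linear_combination -hF.wronskian x hx
  have hrb : ∀ x, 0 < x → x ≤ δ → ‖-1 / phil l z x ^ 2‖ ≤ (c ^ 2)⁻¹ * x ^ (-(2 * l + 2)) := by
    intro x hx hxδ
    have e : x ^ (-(2 * l + 2)) = ((x ^ (l + 1)) ^ 2)⁻¹ := by
      rw [Real.rpow_neg hx.le, ← Real.rpow_natCast, ← Real.rpow_mul hx.le]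
      congr 2
      push_cast
      ring
    have hxl := Real.rpow_pos_of_pos hx (l + 1)
    rw [norm_div, norm_neg, norm_one, norm_pow, hPn x hx, mul_pow, e, one_div, mul_inv, mul_comm]
    have := hkb x hx hxδ
    gcongr
  refine ⟨‖r δ‖ + (c ^ 2)⁻¹, ?_⟩
  filter_upwards [Ioo_mem_nhdsGT hδ0] with x hx
  refine ⟨hP0 x hx.1 hx.2.le, ?_⟩
  have hb : ‖r δ - r x‖ ≤ (c ^ 2)⁻¹ * (wS (2 * l + 2) δ - wS (2 * l + 2) x) := by
    have hpos : ∀ {t : ℝ}, t ∈ Icc x δ → 0 < t := fun ht => hx.1.trans_le ht.1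
    have hB : ∀ t, 0 < t → HasDerivAt
        (fun t => (c ^ 2)⁻¹ * (wS (2 * l + 2) t - wS (2 * l + 2) x))
        ((c ^ 2)⁻¹ * t ^ (-(2 * l + 2))) t := fun t ht =>
      ((hasDerivAt_wS ht).sub_const _).const_mul _
    exact image_norm_le_of_norm_deriv_right_le_deriv_boundary'
      (f := fun t => r t - r x) (f' := fun t => -1 / phil l z t ^ 2) (a := x) (b := δ)
      (B := fun t => (c ^ 2)⁻¹ * (wS (2 * l + 2) t - wS (2 * l + 2) x))
      (B' := fun t => (c ^ 2)⁻¹ * t ^ (-(2 * l + 2)))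
      (fun t ht => ((hrd t (hpos ht) ht.2).sub_const _).continuousAt.continuousWithinAt)
      (fun t ht => ((hrd t (hpos (Ico_subset_Icc_self ht)) ht.2.le).sub_const _).hasDerivWithinAt)
      (by simp)
      (fun t ht => (hB t (hpos ht)).continuousAt.continuousWithinAt)
      (fun t ht => (hB t (hpos (Ico_subset_Icc_self ht))).hasDerivWithinAt)
      (fun t ht => hrb t (hpos (Ico_subset_Icc_self ht)) ht.2.le)
      ⟨hx.2.le, le_rfl⟩
  have h1 : ‖r x‖ ≤ ‖r δ‖ + ‖r δ - r x‖ := by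
    have := norm_sub_le (r δ) (r δ - r x)
    rwa [sub_sub_cancel] at this
  have hw := wS_nonpos (m := 2 * l + 2) hx.1 (hx.2.le.trans hδ1)
  have hwδ := wS_nonpos (m := 2 * l + 2) hδ0 hδ1
  have hci : 0 ≤ (c ^ 2)⁻¹ := by positivity
  have hrn := norm_nonneg (r δ)
  change ‖r x‖ ≤ _
  nlinarith [mul_nonneg hrn (neg_nonneg.2 hw), mul_nonneg hci (neg_nonneg.2 hwδ)]

/-- The solution of the Volterra equation has vanishing Wronskian with the regular solution. -/
theorem wronskian_regU_eq_zero (hF : FreeDerivs l z P₁ T₁) (hl : -(1 : ℝ) / 2 ≤ l) (hz : z ≠ 0)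
    (h : WPot (2 * l + 2) q) (hφ : IsSol l q φ) :
    φ z 1 * regV h z 1 - derivWithin (φ z) (Ioc 0 1) 1 * regU h z 1 = 0 := by
  obtain ⟨C, hC⟩ := hF.exists_ratio_bound hl hz
  obtain ⟨tA, tB⟩ := hF.tendsto_coeff h hφ
  have tw1 := hF.tendsto_wronskian_phil hz h
  set w : ℝ → ℂ := fun x => phil l z x * regV h z x - P₁ x * regU h z x with hw
  have hwS1 : ∀ x ∈ Ioo (0 : ℝ) 1, (1 : ℝ) ≤ 1 - wS (2 * l + 2) x := fun x hx => by
    linarith [wS_nonpos (m := 2 * l + 2) hx.1 hx.2.le]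
  have twn := tw1.norm
  rw [norm_zero] at twn
  have tw : Tendsto w (𝓝[>] 0) (𝓝 0) := by
    refine squeeze_zero_norm' ?_ twn
    filter_upwards [Ioo_mem_nhdsGT (zero_lt_one (α := ℝ))] with x hx
    have h1 := hwS1 x hx
    rw [norm_mul, Complex.norm_real, Real.norm_of_nonneg (by linarith)]
    exact le_mul_of_one_le_right (norm_nonneg _) h1
  have tr : Tendsto (fun x => thetal l z x / phil l z x * w x) (𝓝[>] 0) (𝓝 0) := by
    have twC := twn.const_mul C
    rw [mul_zero] at twC
    refine squeeze_zero_norm' ?_ twC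
    filter_upwards [hC, Ioo_mem_nhdsGT (zero_lt_one (α := ℝ))] with x hCx hx
    have h1 := hwS1 x hx
    rw [norm_mul, norm_mul, Complex.norm_real,
      Real.norm_of_nonneg (show 0 ≤ 1 - wS (2 * l + 2) x by linarith)]
    calc _ ≤ C * (1 - wS (2 * l + 2) x) * ‖w x‖ :=
          mul_le_mul_of_nonneg_right hCx.2 (norm_nonneg _)
      _ = _ := by ring
  have tu : Tendsto (fun x => h.sol 1 z x / philQuot l z x) (𝓝[>] 0) (𝓝 (1 / philQuot l z 0)) :=
    (tendsto_sol_one h z).div (((continuous_philQuot l z).tendsto 0).mono_left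
      nhdsWithin_le_nhds) (philQuot_zero_ne_zero hl z)
  have tlim := (tA.mul tw).sub (tB.mul (tr.add tu))
  rw [mul_zero, zero_mul, sub_zero] at tlim
  refine tendsto_nhds_unique (tendsto_const_nhds.congr' ?_) tlim
  filter_upwards [hC, Ioo_mem_nhdsGT (zero_lt_one (α := ℝ))] with x hCx hx
  have hW := (hF.slSol h hφ hx.1 hx.2.le).wronskian_eq (slSol_reg h z hx.1 hx.2.le)
    (x := 1) ⟨hx.2.le, le_rfl⟩
  rw [hF.derivWithin_eq h hφ, hW, hF.isSol_eq h hφ ⟨hx.1, hx.2.le⟩]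
  have hu : h.sol 1 z x / philQuot l z x = regU h z x / phil l z x := by
    rw [phil_eq_rpow_mul hz hx.1, regU, mul_div_mul_left]
    exact_mod_cast (Real.rpow_pos_of_pos hx.1 _).ne'
  have hP := hCx.1
  have hwr := hF.wronskian x hx.1
  have hT₁ : T₁ x = (thetal l z x * P₁ x - 1) / phil l z x := by
    rw [eq_div_iff hP]
    linear_combination -hwr
  rw [hu, hT₁]
  simp only [hw]
  field_simp
  ring

theorem phil_ne_zero_or (hF : FreeDerivs l z P₁ T₁) (h : WPot (2 * l + 2) q) (hφ : IsSol l q φ) :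
    φ z 1 ≠ 0 ∨ derivWithin (φ z) (Ioc 0 1) 1 ≠ 0 := by
  by_contra! hcon
  rw [hF.derivWithin_eq h hφ] at hcon
  have hzero : ∀ x ∈ Ioc (0 : ℝ) 1, φ z x = 0 := fun x hx =>
    (eq_zero_of_data_one h hx.1 (hF.slSol h hφ hx.1 hx.2) hcon.1 hcon.2).1
  have hP : ∀ x ∈ Ioc (0 : ℝ) 1, phil l z x = 0 := by
    intro x hx
    have e := (hφ.2 z x hx).2
    rw [hzero x hx, setIntegral_congr_fun measurableSet_Ioo (g := fun _ => (0 : ℂ))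
      (fun y hy => by simp [hzero y ⟨hy.1, hy.2.le.trans hx.2⟩]), integral_zero, add_zero] at e
    exact e.symm
  have hP₁ : P₁ (1 / 2) = 0 := by
    refine (hF.phil_deriv (1 / 2) (by norm_num)).unique
      ((hasDerivAt_const (1 / 2 : ℝ) (0 : ℂ)).congr_of_eventuallyEq ?_)
    filter_upwards [Ioo_mem_nhds (show (0 : ℝ) < 1 / 2 by norm_num)
      (show (1 / 2 : ℝ) < 1 by norm_num)] with y hy
    exact hP y ⟨hy.1, hy.2.le⟩
  have hw := hF.wronskian (1 / 2) (by norm_num)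
  rw [hP₁, hP (1 / 2) (by norm_num)] at hw
  simp at hw

end FreeDerivs

theorem regU_one_ne_zero_or (h : WPot (2 * l + 2) q) (z : ℂ) :
    regU h z 1 ≠ 0 ∨ regV h z 1 ≠ 0 := by
  by_contra! hcon
  have hlim := tendsto_sol_one h z
  have hzero : ∀ᶠ x in 𝓝[>] (0 : ℝ), h.sol 1 z x = 0 := by
    filter_upwards [Ioo_mem_nhdsGT (zero_lt_one (α := ℝ))] with x hx
    have e := (eq_zero_of_data_one h hx.1 (slSol_reg h z hx.1 hx.2.le) hcon.1 hcon.2).1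
    rw [regU, mul_eq_zero] at e
    refine e.resolve_left ?_
    exact_mod_cast (Real.rpow_pos_of_pos hx.1 _).ne'
  exact zero_ne_one (tendsto_nhds_unique
    ((tendsto_const_nhds (x := (0 : ℂ))).congr' (hzero.mono fun x hx => hx.symm)) hlim)

/-- Away from `z = 0` the boundary functions of the Volterra solution and of the regular solution
have the same zeros. -/
theorem bcFun_eq_zero_iff (hl : -(1 : ℝ) / 2 ≤ l) (h : WPot (2 * l + 2) q) (hφ : IsSol l q φ)
    (hz : z ≠ 0) (γ : Option ℝ) : bcFun φ γ z = 0 ↔ charF h γ z = 0 := by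
  obtain ⟨P₁, T₁, hF⟩ := exists_freeDerivs hl hz
  have hW := hF.wronskian_regU_eq_zero hl hz h hφ
  have hn := hF.phil_ne_zero_or h hφ
  have hr := regU_one_ne_zero_or h z
  obtain ⟨C, hC, e1, e2⟩ : ∃ C : ℂ, C ≠ 0 ∧ φ z 1 = C * regU h z 1 ∧
      derivWithin (φ z) (Ioc 0 1) 1 = C * regV h z 1 := by
    by_cases hu : regU h z 1 = 0
    · have hv := hr.resolve_left (not_not.2 hu)
      rw [hu, mul_zero, sub_zero, mul_eq_zero] at hW
      have h0 := hW.resolve_right hv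
      refine ⟨derivWithin (φ z) (Ioc 0 1) 1 / regV h z 1,
        div_ne_zero (hn.resolve_left (not_not.2 h0)) hv, by rw [h0, hu, mul_zero], ?_⟩
      rw [div_mul_cancel₀ _ hv]
    · have e2 : derivWithin (φ z) (Ioc 0 1) 1 = φ z 1 / regU h z 1 * regV h z 1 := by
        rw [div_mul_eq_mul_div, eq_div_iff hu]
        linear_combination -hW
      refine ⟨φ z 1 / regU h z 1, ?_, by rw [div_mul_cancel₀ _ hu], e2⟩
      intro h0
      rw [h0, zero_mul] at e2
      exact hn.elim (fun hh => hh ((div_eq_zero_iff.1 h0).resolve_right hu)) (fun hh => hh e2)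
  cases γ with
  | none => simp [bcFun, charF, e1, hC]
  | some γ =>
    simp only [bcFun, charF, e1, e2]
    rw [show C * regV h z 1 + (γ : ℂ) * (C * regU h z 1) =
      C * (regV h z 1 + (γ : ℂ) * regU h z 1) by ring, mul_eq_zero, or_iff_right hC]

end Volterra

/-- Two spectra corresponding to two distinct boundary conditions at
`x = 1` (given by `α ≠ β` in `ℝ ∪ {∞}`, with `none` denoting `∞`, i.e. the Dirichlet
condition) uniquely determine `q` and `l`. -/
theorem two_spectra_uniqueness
    (l lh : ℝ) (q qh : ℝ → ℝ)
    (hl : -(1:ℝ)/2 ≤ l) (hqm : Measurable q)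
    (hq : MeasureTheory.IntegrableOn (fun x => x * qtilde l q x) (Set.Ioo 0 1))
    (hlh : -(1:ℝ)/2 ≤ lh) (hqhm : Measurable qh)
    (hqh : MeasureTheory.IntegrableOn (fun x => x * qtilde lh qh x) (Set.Ioo 0 1))
    (φ φh : ℂ → ℝ → ℂ) (hφ : IsSol l q φ) (hφh : IsSol lh qh φh)
    (α β : Option ℝ) (hαβ : α ≠ β)
    (hspecα : {z : ℂ | bcFun φ α z = 0} = {z : ℂ | bcFun φh α z = 0})
    (hspecβ : {z : ℂ | bcFun φ β z = 0} = {z : ℂ | bcFun φh β z = 0}) :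
    l = lh ∧ ∀ᵐ x ∂(MeasureTheory.volume.restrict (Set.Ioo (0:ℝ) 1)), q x = qh x := by
  have h := wPot_of_qtilde hl hqm hq
  have hh := wPot_of_qtilde hlh hqhm hqh
  have hchar : ∀ γ, {z : ℂ | bcFun φ γ z = 0} = {z : ℂ | bcFun φh γ z = 0} →
      ∀ z, z ≠ 0 → (charF h γ z = 0 ↔ charF hh γ z = 0) := fun γ hγ z hz =>
    (bcFun_eq_zero_iff hl h hφ hz γ).symm.trans
      ((Set.ext_iff.1 hγ z).trans (bcFun_eq_zero_iff hlh hh hφh hz γ))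
  exact eq_of_fullPot_ae_eq hl hlh (integrableOn_id_mul_of_qtilde hqm hq)
    (integrableOn_id_mul_of_qtilde hqhm hqh)
    (fullPot_ae_eq h hh hl hlh fun z hz =>
      regV_mul_regU_eq h hh hl hlh hαβ (hchar α hspecα) (hchar β hspecβ) hz)
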